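/- Digital inner bound: a tuple (k,D,Δ) ∈ ℝ₊³ is achievable whenever (k,D,Δ) ∈ ℛ_digital, i.e., whenever there exist finite sets 𝒰, 𝒱, 𝒬, 𝒯 and random variables U, V, Q, T, X with joint distribution p(u,v,q,t,a,b,e,x,y,z) = p(u|v)·p(v|a)·p(a,b,e)·p(q)·p(t|q)·p(x|t)·p(y,z|x), and a function Â : 𝒱×ℬ → 𝒜, satisfying I(U;A|B) ≤ k·I(Q;Y), I(V;A|B) ≤ k·I(T;Y), D ≥ E[d(A, Â(V,B))], and Δ ≤ H(A|U,E) − [ I(V;A|U,B) − k·( I(T;Y|Q) − I(T;Z|Q) ) ]₊. -/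

import Mathlib

open Finset

namespace SecureSC

/-- Shannon entropy (base 2) of a finitely supported distribution `q`. -/
noncomputable def entropy {γ : Type} [Fintype γ] (q : γ → ℝ) : ℝ :=
  -∑ c, q c * Real.logb 2 (q c)

open Classical in
/-- Pushforward of a distribution along a map. -/
noncomputable def pushf {γ α : Type} [Fintype γ] (q : γ → ℝ) (f : γ → α) : α → ℝ :=
  fun a => ∑ c, if f c = a then q c else 0

/-- Entropy `H(f)` of the random variable `f` under the joint distribution `q`. -/
noncomputable def Hof {γ α : Type} [Fintype γ] [Fintype α] (q : γ → ℝ) (f : γ → α) : ℝ :=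
  entropy (pushf q f)

/-- Conditional entropy `H(f | g)` under the joint distribution `q`. -/
noncomputable def condH {γ α β : Type} [Fintype γ] [Fintype α] [Fintype β]
    (q : γ → ℝ) (f : γ → α) (g : γ → β) : ℝ :=
  Hof q (fun c => (f c, g c)) - Hof q g

/-- Mutual information `I(f ; g)` under the joint distribution `q`. -/
noncomputable def mutInf {γ α β : Type} [Fintype γ] [Fintype α] [Fintype β]
    (q : γ → ℝ) (f : γ → α) (g : γ → β) : ℝ :=
  Hof q f + Hof q g - Hof q (fun c => (f c, g c))

/-- Conditional mutual information `I(f ; g | h)` under the joint distribution `q`. -/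
noncomputable def condMutInf {γ α β δ : Type} [Fintype γ] [Fintype α] [Fintype β] [Fintype δ]
    (q : γ → ℝ) (f : γ → α) (g : γ → β) (h : γ → δ) : ℝ :=
  condH q f h - condH q f (fun c => (g c, h c))

/-- Expectation of `φ` under the distribution `q`. -/
noncomputable def expVal {γ : Type} [Fintype γ] (q : γ → ℝ) (φ : γ → ℝ) : ℝ :=
  ∑ c, q c * φ c

/-- `q` is a probability mass function. -/
def IsPMF {γ : Type} [Fintype γ] (q : γ → ℝ) : Prop :=
  (∀ c, 0 ≤ q c) ∧ ∑ c, q c = 1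

/-- `W` is a transition probability (stochastic kernel). -/
def IsKernel {α β : Type} [Fintype β] (W : α → β → ℝ) : Prop :=
  ∀ a, IsPMF (W a)

variable {A B E X Y Z : Type} [Fintype A] [Fintype B] [Fintype E]
  [Fintype X] [Fintype Y] [Fintype Z]

/-- Component-wise mean distortion on sequences. -/
noncomputable def seqDist (d : A → A → ℝ) {n : ℕ} (a a' : Fin n → A) : ℝ :=
  (n : ℝ)⁻¹ * ∑ i, d (a i) (a' i)

/-- Joint distribution of `(Aⁿ, Bⁿ, Eⁿ, Xᵐ, Yᵐ, Zᵐ)` induced by the i.i.d. source `pS`,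
the stochastic encoder `F` and the memoryless channel `Wch`. -/
noncomputable def codeJoint (pS : A × B × E → ℝ) (Wch : X → Y × Z → ℝ) {n m : ℕ}
    (F : (Fin n → A) → (Fin m → X) → ℝ) :
    (Fin n → A) × (Fin n → B) × (Fin n → E) × (Fin m → X) × (Fin m → Y) × (Fin m → Z) → ℝ :=
  fun w =>
    (∏ i, pS (w.1 i, w.2.1 i, w.2.2.1 i)) * F w.1 w.2.2.2.1 *
      ∏ j, Wch (w.2.2.2.1 j) (w.2.2.2.2.1 j, w.2.2.2.2.2 j)

/-- A tuple `(k, D, Δ)` is achievable for the secure joint source-channel coding problem. -/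
def Achievable (pS : A × B × E → ℝ) (Wch : X → Y × Z → ℝ) (d : A → A → ℝ)
    (k D Δ : ℝ) : Prop :=
  ∀ ε : ℝ, 0 < ε →
    ∃ (n m : ℕ), 0 < n ∧
      ∃ (F : (Fin n → A) → (Fin m → X) → ℝ)
        (g : (Fin n → B) → (Fin m → Y) → Fin n → A),
        IsKernel F ∧
        (m : ℝ) / n ≤ k + ε ∧
        expVal (codeJoint pS Wch F)
          (fun w => seqDist d w.1 (g w.2.1 w.2.2.2.2.1)) ≤ D + ε ∧
        Δ - ε ≤ (n : ℝ)⁻¹ *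
          condH (codeJoint pS Wch F) (fun w => w.1)
            (fun w => (w.2.2.1, w.2.2.2.2.2))

/-- Joint distribution of `(U, V, A, B, E)` with factorization `p(u|v) p(v|a) p(a,b,e)`. -/
noncomputable def sourceJointChain {𝒰 𝒱 : Type} [Fintype 𝒰] [Fintype 𝒱]
    (pS : A × B × E → ℝ) (pU : 𝒱 → 𝒰 → ℝ) (pV : A → 𝒱 → ℝ) : 𝒰 × 𝒱 × A × B × E → ℝ :=
  fun w => pU w.2.1 w.1 * pV w.2.2.1 w.2.1 * pS (w.2.2.1, w.2.2.2.1, w.2.2.2.2)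

/-- Joint distribution of `(Q, T, X, Y, Z)` with factorization `p(q) p(t|q) p(x|t) p(y,z|x)`. -/
noncomputable def chanJointQT {𝒬 𝒯 : Type} [Fintype 𝒬] [Fintype 𝒯]
    (Wch : X → Y × Z → ℝ) (pQ : 𝒬 → ℝ) (pT : 𝒬 → 𝒯 → ℝ) (pXk : 𝒯 → X → ℝ) :
    𝒬 × 𝒯 × X × Y × Z → ℝ :=
  fun w => pQ w.1 * pT w.1 w.2.1 * pXk w.2.1 w.2.2.1 * Wch w.2.2.1 (w.2.2.2.1, w.2.2.2.2)

/-- The single-letter conditions defining the digital inner bound `ℛ_digital` (Theorem 2),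
for given auxiliary finite alphabets `𝒰, 𝒱, 𝒬, 𝒯`. -/
def DigitalCond (𝒰 𝒱 𝒬 𝒯 : Type) [Fintype 𝒰] [Fintype 𝒱] [Fintype 𝒬] [Fintype 𝒯]
    (pS : A × B × E → ℝ) (Wch : X → Y × Z → ℝ) (d : A → A → ℝ)
    (k D Δ : ℝ) : Prop :=
  ∃ (pU : 𝒱 → 𝒰 → ℝ) (pV : A → 𝒱 → ℝ)
    (pQ : 𝒬 → ℝ) (pT : 𝒬 → 𝒯 → ℝ) (pXk : 𝒯 → X → ℝ) (Ahat : 𝒱 → B → A),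
    IsKernel pU ∧ IsKernel pV ∧ IsPMF pQ ∧ IsKernel pT ∧ IsKernel pXk ∧
    -- I(U;A|B) ≤ k · I(Q;Y)
    condMutInf (sourceJointChain pS pU pV)
        (fun w => w.1) (fun w => w.2.2.1) (fun w => w.2.2.2.1)
      ≤ k * mutInf (chanJointQT Wch pQ pT pXk)
        (fun w => w.1) (fun w => w.2.2.2.1) ∧
    -- I(V;A|B) ≤ k · I(T;Y)
    condMutInf (sourceJointChain pS pU pV)
        (fun w => w.2.1) (fun w => w.2.2.1) (fun w => w.2.2.2.1)
      ≤ k * mutInf (chanJointQT Wch pQ pT pXk)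
        (fun w => w.2.1) (fun w => w.2.2.2.1) ∧
    -- D ≥ E[d(A, Â(V,B))]
    expVal (sourceJointChain pS pU pV)
        (fun w => d w.2.2.1 (Ahat w.2.1 w.2.2.2.1)) ≤ D ∧
    -- Δ ≤ H(A|U,E) − [ I(V;A|U,B) − k·(I(T;Y|Q) − I(T;Z|Q)) ]₊
    Δ ≤ condH (sourceJointChain pS pU pV)
          (fun w => w.2.2.1) (fun w => (w.1, w.2.2.2.2))
        - max 0
          (condMutInf (sourceJointChain pS pU pV)
              (fun w => w.2.1) (fun w => w.2.2.1) (fun w => (w.1, w.2.2.2.1))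
           - k * (condMutInf (chanJointQT Wch pQ pT pXk)
                    (fun w => w.2.1) (fun w => w.2.2.2.1) (fun w => w.1)
                  - condMutInf (chanJointQT Wch pQ pT pXk)
                    (fun w => w.2.1) (fun w => w.2.2.2.2) (fun w => w.1)))

set_option linter.unusedSectionVars false

section part1
/-! ### Product distributions and two-layer random codebooks -/

lemma sum_prod_fun {ι α : Type} [Fintype ι] [DecidableEq ι] [Fintype α] (p : ι → α → ℝ) :
    ∑ f : ι → α, ∏ i, p i (f i) = ∏ i, ∑ x, p i x := by
  rw [Finset.prod_univ_sum, Fintype.piFinset_univ]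

lemma sum_prod_one {ι α : Type} [Fintype ι] [DecidableEq ι] [Fintype α] (p : ι → α → ℝ)
    (hp : ∀ i, ∑ x, p i x = 1) (i₀ : ι) (g : α → ℝ) :
    ∑ f : ι → α, (∏ i, p i (f i)) * g (f i₀) = ∑ x, p i₀ x * g x := by
  have h : ∀ f : ι → α, (∏ i, p i (f i)) * g (f i₀)
      = ∏ i, (p i (f i) * (if i = i₀ then g (f i) else 1)) := by
    intro f
    rw [Finset.prod_mul_distrib]
    congr 1
    rw [Finset.prod_ite_eq' univ i₀ (fun i => g (f i))]
    simp
  simp_rw [h]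
  rw [sum_prod_fun (fun i x => p i x * (if i = i₀ then g x else 1))]
  rw [Finset.prod_eq_single i₀]
  · simp
  · intro b _ hb
    simp [hb, hp]
  · simp

lemma sum_prod_two_mul {ι α : Type} [Fintype ι] [DecidableEq ι] [Fintype α] (p : ι → α → ℝ)
    (hp : ∀ i, ∑ x, p i x = 1) (i₀ i₁ : ι) (h01 : i₀ ≠ i₁) (g h : α → ℝ) :
    ∑ f : ι → α, (∏ i, p i (f i)) * (g (f i₀) * h (f i₁))
      = (∑ x, p i₀ x * g x) * ∑ x, p i₁ x * h x := by
  have h' : ∀ f : ι → α, (∏ i, p i (f i)) * (g (f i₀) * h (f i₁))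
      = ∏ i, (p i (f i) * ((if i = i₀ then g (f i) else 1) * (if i = i₁ then h (f i) else 1))) := by
    intro f
    rw [Finset.prod_mul_distrib, Finset.prod_mul_distrib]
    congr 1
    rw [Finset.prod_ite_eq' univ i₀ (fun i => g (f i)),
      Finset.prod_ite_eq' univ i₁ (fun i => h (f i))]
    simp
  simp_rw [h']
  rw [sum_prod_fun (fun i x => p i x * ((if i = i₀ then g x else 1) * (if i = i₁ then h x else 1)))]
  rw [← Finset.mul_prod_erase univ _ (mem_univ i₀),
    ← Finset.mul_prod_erase (univ.erase i₀) _ (mem_erase.2 ⟨h01.symm, mem_univ i₁⟩)]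
  rw [Finset.prod_eq_one]
  · simp [h01, h01.symm]
  · intro x hx
    simp only [mem_erase, mem_univ, and_true] at hx
    simp [hx.1, hx.2, hp]

lemma sum_prod_two {ι α : Type} [Fintype ι] [DecidableEq ι] [Fintype α] (p : ι → α → ℝ)
    (hp : ∀ i, ∑ x, p i x = 1) (i₀ i₁ : ι) (h01 : i₀ ≠ i₁) (g : α → α → ℝ) :
    ∑ f : ι → α, (∏ i, p i (f i)) * g (f i₀) (f i₁)
      = ∑ x, p i₀ x * ∑ y, p i₁ y * g x y := by
  classical
  have h : ∀ f : ι → α, (∏ i, p i (f i)) * g (f i₀) (f i₁)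
      = ∑ x, (∏ i, p i (f i)) * ((if f i₀ = x then 1 else 0) * g x (f i₁)) := by
    intro f
    rw [← Finset.mul_sum]
    simp
  simp_rw [h]
  rw [Finset.sum_comm]
  refine Finset.sum_congr rfl fun x _ => ?_
  rw [sum_prod_two_mul p hp i₀ i₁ h01 (fun z => if z = x then 1 else 0) (g x)]
  simp

section book
variable {I K U V : Type} [Fintype I] [DecidableEq I] [Fintype K] [DecidableEq K]
  [Fintype U] [Fintype V]

/-- Weight of a two-layer random codebook. -/
noncomputable def bw (pU : U → ℝ) (kV : U → V → ℝ) (π : K → I) (c : (I → U) × (K → V)) : ℝ :=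
  (∏ i, pU (c.1 i)) * ∏ k, kV (c.1 (π k)) (c.2 k)

lemma bw_nonneg {pU : U → ℝ} {kV : U → V → ℝ} (hU : IsPMF pU) (hV : IsKernel kV) (π : K → I)
    (c : (I → U) × (K → V)) : 0 ≤ bw pU kV π c :=
  mul_nonneg (prod_nonneg fun _ _ => hU.1 _) (prod_nonneg fun _ _ => (hV _).1 _)

lemma bw_sum {pU : U → ℝ} {kV : U → V → ℝ} (hU : IsPMF pU) (hV : IsKernel kV) (π : K → I) :
    ∑ c, bw pU kV π c = 1 := by
  rw [Fintype.sum_prod_type]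
  simp only [bw, ← Finset.mul_sum]
  have : ∀ x : I → U, ∑ y : K → V, ∏ k, kV (x (π k)) (y k) = 1 := by
    intro x
    rw [sum_prod_fun (fun k v => kV (x (π k)) v)]
    exact Finset.prod_eq_one fun k _ => (hV _).2
  simp only [this, mul_one]
  rw [sum_prod_fun (fun _ u => pU u)]
  exact Finset.prod_eq_one fun k _ => hU.2

lemma bw_one {pU : U → ℝ} {kV : U → V → ℝ} (hU : IsPMF pU) (hV : IsKernel kV) (π : K → I)
    (k : K) (g : U → V → ℝ) :
    ∑ c, bw pU kV π c * g (c.1 (π k)) (c.2 k) = ∑ u, ∑ v, pU u * kV u v * g u v := by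
  rw [Fintype.sum_prod_type]
  simp only [bw, mul_assoc, ← Finset.mul_sum]
  have : ∀ x : I → U, ∑ y : K → V, (∏ k, kV (x (π k)) (y k)) * g (x (π k)) (y k)
      = ∑ v, kV (x (π k)) v * g (x (π k)) v := fun x =>
    sum_prod_one (fun k v => kV (x (π k)) v) (fun k => (hV _).2) k (fun v => g (x (π k)) v)
  simp only [this]
  exact sum_prod_one (fun _ u => pU u) (fun _ => hU.2) (π k) (fun u => ∑ v, kV u v * g u v)

lemma bw_same {pU : U → ℝ} {kV : U → V → ℝ} (hU : IsPMF pU) (hV : IsKernel kV) (π : K → I)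
    (k k' : K) (hk : k ≠ k') (hπ : π k = π k') (g : U → V → V → ℝ) :
    ∑ c, bw pU kV π c * g (c.1 (π k)) (c.2 k) (c.2 k')
      = ∑ u, ∑ v, pU u * kV u v * ∑ v', kV u v' * g u v v' := by
  rw [Fintype.sum_prod_type]
  simp only [bw, mul_assoc, ← Finset.mul_sum]
  have : ∀ x : I → U, ∑ y : K → V, (∏ k, kV (x (π k)) (y k)) * g (x (π k)) (y k) (y k')
      = ∑ v, kV (x (π k)) v * ∑ v', kV (x (π k)) v' * g (x (π k)) v v' := fun x => by
    have := sum_prod_two (fun k v => kV (x (π k)) v) (fun k => (hV _).2) k k' hk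
      (fun v v' => g (x (π k)) v v')
    simpa only [hπ] using this
  simp only [this]
  exact sum_prod_one (fun _ u => pU u) (fun _ => hU.2) (π k)
    (fun u => ∑ v, kV u v * ∑ v', kV u v' * g u v v')

lemma bw_diff {pU : U → ℝ} {kV : U → V → ℝ} (hU : IsPMF pU) (hV : IsKernel kV) (π : K → I)
    (k k' : K) (hπ : π k ≠ π k') (g : U → V → V → ℝ) :
    ∑ c, bw pU kV π c * g (c.1 (π k)) (c.2 k) (c.2 k')
      = ∑ u, ∑ v, pU u * kV u v * ∑ u', pU u' * ∑ v', kV u' v' * g u v v' := by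
  have hk : k ≠ k' := fun h => hπ (by rw [h])
  rw [Fintype.sum_prod_type]
  simp only [bw, mul_assoc, ← Finset.mul_sum]
  have : ∀ x : I → U, ∑ y : K → V, (∏ k, kV (x (π k)) (y k)) * g (x (π k)) (y k) (y k')
      = ∑ v, kV (x (π k)) v * ∑ v', kV (x (π k')) v' * g (x (π k)) v v' := fun x => 
    sum_prod_two (fun k v => kV (x (π k)) v) (fun k => (hV _).2) k k' hk
      (fun v v' => g (x (π k)) v v')
  simp only [this]
  rw [sum_prod_two (fun _ u => pU u) (fun _ => hU.2) (π k) (π k') hπ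
    (fun u u' => ∑ v, kV u v * ∑ v', kV u' v' * g u v v')]
  refine Finset.sum_congr rfl fun u _ => ?_
  congr 1
  simp only [Finset.mul_sum]
  rw [Finset.sum_comm]
  refine Finset.sum_congr rfl fun v _ => Finset.sum_congr rfl fun u' _ =>
    Finset.sum_congr rfl fun v' _ => by ring

end book

/-- composition of a distribution and a kernel -/
noncomputable def pc {α β : Type} [Fintype α] (p : α → ℝ) (k : α → β → ℝ) (b : β) : ℝ :=
  ∑ a, p a * k a b

/-- composition of kernels -/
noncomputable def kc {α β γ : Type} [Fintype β] (k : α → β → ℝ) (l : β → γ → ℝ) (a : α) (c : γ) : ℝ :=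
  ∑ b, k a b * l b c

lemma pc_pmf {α β : Type} [Fintype α] [Fintype β] {p : α → ℝ} {k : α → β → ℝ}
    (hp : IsPMF p) (hk : IsKernel k) : IsPMF (pc p k) := by
  refine ⟨fun b => sum_nonneg fun a _ => mul_nonneg (hp.1 a) ((hk a).1 b), ?_⟩
  unfold pc
  rw [Finset.sum_comm]
  simp [← Finset.mul_sum, (hk _).2, hp.2]

lemma kc_kernel {α β γ : Type} [Fintype β] [Fintype γ] {k : α → β → ℝ} {l : β → γ → ℝ}
    (hk : IsKernel k) (hl : IsKernel l) : IsKernel (kc k l) := fun a => pc_pmf (hk a) hl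
end part1

section part2
/-! ### Soft covering -/

lemma log_one_add_le_rpow {y s : ℝ} (hy : 0 ≤ y) (hs : 0 < s) (hs1 : s ≤ 1) :
    Real.log (1 + y) ≤ y ^ s / s := by
  have h1 : (1 + y) ^ s ≤ 1 + y ^ s := by
    have := Real.rpow_add_le_add_rpow (p := s) zero_le_one hy hs.le hs1
    simpa using this
  have h2 : s * Real.log (1 + y) = Real.log ((1 + y) ^ s) := by
    rw [Real.log_rpow (by linarith)]
  have h3 : Real.log ((1 + y) ^ s) ≤ y ^ s := by
    have h4 : Real.log ((1 + y) ^ s) ≤ (1 + y) ^ s - 1 :=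
      Real.log_le_sub_one_of_pos (Real.rpow_pos_of_pos (by linarith) _)
    linarith
  rw [le_div_iff₀ hs]
  linarith

lemma log_tangent {x z : ℝ} (hx : 0 < x) (hz : 0 < z) :
    Real.log x ≤ Real.log z + x / z - 1 := by
  have := Real.log_le_sub_one_of_pos (div_pos hx hz)
  rw [Real.log_div hx.ne' hz.ne'] at this
  linarith

lemma sqrt_ineq {x : ℝ} (hx : 0 ≤ x) : (1 - √x) ^ 2 ≤ x * Real.log x - x + 1 := by
  rcases hx.eq_or_lt with rfl | hx
  · simp
  have hq : 0 < √x := Real.sqrt_pos.2 hx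
  have h := Real.log_le_sub_one_of_pos (inv_pos.2 hq)
  rw [Real.log_inv, Real.log_sqrt hx.le] at h
  have hxx : √x * √x = x := Real.mul_self_sqrt hx.le
  have h2 : x * (√x)⁻¹ = √x := by
    field_simp
    nlinarith
  nlinarith [mul_le_mul_of_nonneg_left h hx.le]

lemma l1_of_kl {Ω : Type} [Fintype Ω] (μ x : Ω → ℝ) (hμ : IsPMF μ) (hx : ∀ o, 0 ≤ x o)
    (h1 : ∑ o, μ o * x o = 1) (t : ℝ) (ht : ∑ o, μ o * (x o * Real.log (x o)) ≤ t) :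
    ∑ o, μ o * |1 - x o| ≤ 2 * √t := by
  have hA : ∑ o, μ o * (1 - √(x o)) ^ 2 ≤ t := by
    calc ∑ o, μ o * (1 - √(x o)) ^ 2 ≤ ∑ o, μ o * (x o * Real.log (x o) - x o + 1) :=
          sum_le_sum fun o _ => mul_le_mul_of_nonneg_left (sqrt_ineq (hx o)) (hμ.1 o)
      _ = ∑ o, μ o * (x o * Real.log (x o)) - ∑ o, μ o * x o + ∑ o, μ o := by
          rw [← sum_sub_distrib, ← sum_add_distrib]
          exact sum_congr rfl fun o _ => by ring
      _ ≤ t := by rw [h1, hμ.2]; linarith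
  have hB : ∑ o, μ o * (1 + √(x o)) ^ 2 ≤ 4 := by
    calc ∑ o, μ o * (1 + √(x o)) ^ 2 ≤ ∑ o, μ o * (2 + 2 * x o) := by
          refine sum_le_sum fun o _ => mul_le_mul_of_nonneg_left ?_ (hμ.1 o)
          nlinarith [sq_nonneg (1 - √(x o)), Real.mul_self_sqrt (hx o)]
      _ = 2 * ∑ o, μ o + 2 * ∑ o, μ o * x o := by
          rw [mul_sum, mul_sum, ← sum_add_distrib]
          exact sum_congr rfl fun o _ => by ring
      _ = 4 := by rw [h1, hμ.2]; norm_num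
  have hCS := Finset.sum_mul_sq_le_sq_mul_sq univ (fun o => √(μ o) * |1 - √(x o)|)
    (fun o => √(μ o) * (1 + √(x o)))
  have e1 : ∀ o, √(μ o) * |1 - √(x o)| * (√(μ o) * (1 + √(x o))) = μ o * |1 - x o| := by
    intro o
    have : |1 - x o| = |1 - √(x o)| * (1 + √(x o)) := by
      rw [← abs_of_nonneg (show 0 ≤ 1 + √(x o) by positivity), ← abs_mul]
      congr 1
      nlinarith [Real.mul_self_sqrt (hx o)]
    rw [this]
    have := Real.mul_self_sqrt (hμ.1 o)
    calc _ = (√(μ o) * √(μ o)) * (|1 - √(x o)| * (1 + √(x o))) := by ring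
      _ = _ := by rw [this]
  have e2 : ∀ o, (√(μ o) * |1 - √(x o)|) ^ 2 = μ o * (1 - √(x o)) ^ 2 := by
    intro o; rw [mul_pow, Real.sq_sqrt (hμ.1 o), sq_abs]
  have e3 : ∀ o, (√(μ o) * (1 + √(x o))) ^ 2 = μ o * (1 + √(x o)) ^ 2 := by
    intro o; rw [mul_pow, Real.sq_sqrt (hμ.1 o)]
  simp only [e1, e2, e3] at hCS
  have hA0 : 0 ≤ ∑ o, μ o * (1 - √(x o)) ^ 2 :=
    sum_nonneg fun o _ => mul_nonneg (hμ.1 o) (sq_nonneg _)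
  have ht0 : 0 ≤ t := hA0.trans hA
  have hfin : (∑ o, μ o * |1 - x o|) ^ 2 ≤ (2 * √t) ^ 2 := by
    rw [mul_pow, Real.sq_sqrt ht0]
    nlinarith [mul_le_mul hA hB (sum_nonneg fun o _ => mul_nonneg (hμ.1 o) (sq_nonneg _)) ht0]
  exact le_of_sq_le_sq hfin (by positivity)
where
  le_of_sq_le_sq {a b : ℝ} (h : a ^ 2 ≤ b ^ 2) (hb : 0 ≤ b) : a ≤ b := abs_le_of_sq_le_sq' h hb |>.2

section
variable {M1 M2 : ℕ} {U V A : Type} [Fintype U] [Fintype V] [Fintype A]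

lemma competitor {pU : U → ℝ} {kV : U → V → ℝ} (hU : IsPMF pU) (hV : IsKernel kV)
    (k : Fin M1 × Fin M2) (f : U → V → ℝ) (hf : ∀ u v, 0 ≤ f u v) (h : V → ℝ) (hh : ∀ v, 0 ≤ h v) :
    ∑ c, bw pU kV (Prod.fst : Fin M1 × Fin M2 → Fin M1) c *
        (f (c.1 k.1) (c.2 k) * ∑ k', h (c.2 k'))
      ≤ ∑ u, ∑ v, pU u * kV u v * (f u v *
        (h v + M2 * (∑ v', kV u v' * h v') + (M1 * M2) * ∑ u', pU u' * ∑ v', kV u' v' * h v')) := by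
  set hb : U → ℝ := fun u => ∑ v', kV u v' * h v' with hhb
  set hbb : ℝ := ∑ u', pU u' * hb u' with hhbb
  have hb0 : ∀ u, 0 ≤ hb u := fun u => sum_nonneg fun v _ => mul_nonneg ((hV u).1 v) (hh v)
  have hbb0 : 0 ≤ hbb := sum_nonneg fun u _ => mul_nonneg (hU.1 u) (hb0 u)
  have key : ∀ k', ∑ c, bw pU kV (Prod.fst : Fin M1 × Fin M2 → Fin M1) c *
        (f (c.1 k.1) (c.2 k) * h (c.2 k')) ≤ ∑ u, ∑ v, pU u * kV u v * (f u v *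
        ((if k' = k then h v else 0) + (if k'.1 = k.1 then hb u else 0) + hbb)) := by
    intro k'
    by_cases h1 : k' = k
    · subst h1
      rw [bw_one hU hV Prod.fst k' (fun u v => f u v * h v)]
      refine sum_le_sum fun u _ => sum_le_sum fun v _ => ?_
      refine mul_le_mul_of_nonneg_left ?_ (mul_nonneg (hU.1 u) ((hV u).1 v))
      refine mul_le_mul_of_nonneg_left ?_ (hf u v)
      simp only [if_true]
      linarith [hb0 u]
    by_cases h2 : k'.1 = k.1
    · rw [bw_same hU hV Prod.fst k k' (Ne.symm h1) h2.symm (fun u v v' => f u v * h v')]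
      refine sum_le_sum fun u _ => sum_le_sum fun v _ => ?_
      refine mul_le_mul_of_nonneg_left ?_ (mul_nonneg (hU.1 u) ((hV u).1 v))
      simp only [h1, h2, if_true, if_false]
      have : ∑ v', kV u v' * (f u v * h v') = f u v * hb u := by
        rw [hhb, mul_sum]; exact sum_congr rfl fun _ _ => by ring
      rw [this]
      refine mul_le_mul_of_nonneg_left ?_ (hf u v)
      linarith
    · rw [bw_diff hU hV Prod.fst k k' (Ne.symm h2) (fun u v v' => f u v * h v')]
      refine sum_le_sum fun u _ => sum_le_sum fun v _ => ?_
      refine mul_le_mul_of_nonneg_left ?_ (mul_nonneg (hU.1 u) ((hV u).1 v))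
      simp only [h1, h2, if_false]
      have : ∑ u', pU u' * ∑ v', kV u' v' * (f u v * h v') = f u v * hbb := by
        rw [hhbb, hhb, mul_sum]
        refine sum_congr rfl fun _ _ => ?_
        simp only [mul_sum]
        exact sum_congr rfl fun _ _ => by ring
      rw [this]
      refine mul_le_mul_of_nonneg_left ?_ (hf u v)
      linarith
  calc _ = ∑ k', ∑ c, bw pU kV (Prod.fst : Fin M1 × Fin M2 → Fin M1) c *
        (f (c.1 k.1) (c.2 k) * h (c.2 k')) := by
        rw [sum_comm]
        refine sum_congr rfl fun c _ => ?_
        rw [mul_sum, mul_sum]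
    _ ≤ _ := sum_le_sum fun k' _ => key k'
    _ = _ := by
        rw [sum_comm]
        refine sum_congr rfl fun u _ => ?_
        rw [sum_comm]
        refine sum_congr rfl fun v _ => ?_
        rw [← mul_sum, ← mul_sum]
        congr 2
        rw [sum_add_distrib, sum_add_distrib]
        congr 1
        · congr 1
          · simp
          · rw [Fintype.sum_prod_type, sum_comm]
            simp [hhb]
        · simp

/-- Output distribution of the codebook. -/
noncomputable def Phat (kA : V → A → ℝ) (c : (Fin M1 → U) × (Fin M1 × Fin M2 → V)) (a : A) : ℝ :=
  ((M1 : ℝ) * M2)⁻¹ * ∑ k, kA (c.2 k) a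

/-- The soft covering exponent term. -/
noncomputable def SCterm (pU : U → ℝ) (kV : U → V → ℝ) (kA : V → A → ℝ) (s m1 m : ℝ) : ℝ :=
  (∑ a, ∑ u, ∑ v, pU u * kV u v * (kA v a * ((kc kV kA u a / (m1 * pc pU (kc kV kA) a)) ^ s +
    (kA v a / (m * pc pU (kc kV kA) a)) ^ s))) / s

set_option maxHeartbeats 2000000 in
lemma soft_cover {pU : U → ℝ} {kV : U → V → ℝ} {kA : V → A → ℝ} (hU : IsPMF pU) (hV : IsKernel kV)
    (hA : IsKernel kA) (h1 : 0 < M1) (h2 : 0 < M2) {s : ℝ} (hs : 0 < s) (hs1 : s ≤ 1) :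
    ∑ c, bw pU kV (Prod.fst : Fin M1 × Fin M2 → Fin M1) c *
      ∑ a, pc pU (kc kV kA) a * |1 - Phat kA c a / pc pU (kc kV kA) a|
      ≤ 2 * √(SCterm pU kV kA s M1 (M1 * M2)) := by
  set pA := pc pU (kc kV kA) with hpA
  have hpApmf : IsPMF pA := pc_pmf hU (kc_kernel hV hA)
  set w := bw pU kV (Prod.fst : Fin M1 × Fin M2 → Fin M1) with hw
  have hw0 : ∀ c, 0 ≤ w c := bw_nonneg hU hV _
  have m1 : (0 : ℝ) < M1 := by exact_mod_cast h1
  have m2 : (0 : ℝ) < M2 := by exact_mod_cast h2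
  have hmean : ∀ k : Fin M1 × Fin M2, ∀ a, ∑ c, w c * kA (c.2 k) a = pA a := by
    intro k a
    rw [hw, bw_one hU hV Prod.fst k (fun u v => kA v a), hpA]
    unfold pc kc
    refine sum_congr rfl fun u _ => ?_
    rw [mul_sum]
    exact sum_congr rfl fun v _ => by ring
  have hmeanP : ∀ a, ∑ c, w c * Phat kA c a = pA a := by
    intro a
    unfold Phat
    have : ∀ c : (Fin M1 → U) × (Fin M1 × Fin M2 → V), w c * (((M1 : ℝ) * M2)⁻¹ * ∑ k, kA (c.2 k) a)
        = ((M1 : ℝ) * M2)⁻¹ * ∑ k, w c * kA (c.2 k) a := by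
      intro c; rw [← mul_sum]; ring
    simp only [this]
    rw [← mul_sum, sum_comm]
    simp only [hmean]
    simp
    field_simp
  have hPhat0 : ∀ c a, 0 ≤ Phat (M1 := M1) (M2 := M2) (U := U) kA c a := fun c a =>
    mul_nonneg (by positivity) (sum_nonneg fun k _ => (hA _).1 a)
  have hμ : IsPMF (fun o : ((Fin M1 → U) × (Fin M1 × Fin M2 → V)) × A => w o.1 * pA o.2) := by
    refine ⟨fun o => mul_nonneg (hw0 _) (hpApmf.1 _), ?_⟩
    rw [Fintype.sum_prod_type]
    simp only [← mul_sum, hpApmf.2, mul_one]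
    exact bw_sum hU hV _
  have hx1 : ∑ o : ((Fin M1 → U) × (Fin M1 × Fin M2 → V)) × A,
      w o.1 * pA o.2 * (Phat kA o.1 o.2 / pA o.2) = 1 := by
    rw [Fintype.sum_prod_type_right]
    rw [← hpApmf.2]
    refine sum_congr rfl fun a _ => ?_
    by_cases ha : pA a = 0
    · simp [ha]
    · rw [← hmeanP a]
      refine sum_congr rfl fun c _ => ?_
      dsimp only
      field_simp
  have main := l1_of_kl (fun o : ((Fin M1 → U) × (Fin M1 × Fin M2 → V)) × A => w o.1 * pA o.2)
    (fun o : ((Fin M1 → U) × (Fin M1 × Fin M2 → V)) × A => Phat kA o.1 o.2 / pA o.2) hμ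
    (fun o => div_nonneg (hPhat0 _ _) (hpApmf.1 _)) hx1 (SCterm pU kV kA s M1 (M1 * M2)) ?_
  · have e : ∑ c : (Fin M1 → U) × (Fin M1 × Fin M2 → V), w c * ∑ a, pA a * |1 - Phat kA c a / pA a| =
        ∑ o : ((Fin M1 → U) × (Fin M1 × Fin M2 → V)) × A,
          w o.1 * pA o.2 * |1 - Phat kA o.1 o.2 / pA o.2| := by
      conv_rhs => rw [Fintype.sum_prod_type]
      refine sum_congr rfl fun c _ => ?_
      rw [mul_sum]
      refine sum_congr rfl fun a _ => ?_
      rw [mul_assoc]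
    rw [e]
    exact main
  rw [Fintype.sum_prod_type_right]
  unfold SCterm
  rw [Finset.sum_div]
  refine sum_le_sum fun a _ => ?_
  dsimp only
  rcases (hpApmf.1 a).eq_or_lt with ha | ha
  · rw [← ha]
    simp only [mul_zero, zero_mul, sum_const_zero]
    refine div_nonneg (sum_nonneg fun u _ => sum_nonneg fun v _ => ?_) hs.le
    rw [← hpA, ← ha]
    simp [Real.zero_rpow hs.ne']
  -- main case
  set xb : U → V → ℝ := fun u v => 1 + (kc kV kA u a / (M1 * pA a) + kA v a / (M1 * M2 * pA a)) with hxb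
  have hkAU : ∀ u, 0 ≤ kc kV kA u a := fun u => (kc_kernel hV hA u).1 a
  have hxb1 : ∀ u v, 1 ≤ xb u v := by
    intro u v
    have := hkAU u
    have := (hA v).1 a
    rw [hxb]
    have : 0 ≤ kc kV kA u a / (M1 * pA a) + kA v a / (M1 * M2 * pA a) := by positivity
    linarith
  have hk : ∀ k : Fin M1 × Fin M2, ∑ c, w c * (kA (c.2 k) a * Real.log (Phat kA c a / pA a))
      ≤ ∑ u, ∑ v, pU u * kV u v * (kA v a * Real.log (xb u v)) := by
    intro k
    have step1 : ∀ c : (Fin M1 → U) × (Fin M1 × Fin M2 → V),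
        kA (c.2 k) a * Real.log (Phat kA c a / pA a) ≤
        kA (c.2 k) a * (Real.log (xb (c.1 k.1) (c.2 k)) - 1) +
        ((M1 : ℝ) * M2 * pA a)⁻¹ * (kA (c.2 k) a / xb (c.1 k.1) (c.2 k) * ∑ k', kA (c.2 k') a) := by
      intro c
      rcases ((hA (c.2 k)).1 a).eq_or_lt with h0 | h0
      · rw [← h0]; simp
      have hS : 0 < ∑ k', kA (c.2 k') a :=
        sum_pos' (fun k' _ => (hA _).1 a) ⟨k, mem_univ _, h0⟩
      have hP : 0 < Phat kA c a := mul_pos (by positivity) hS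
      have hx0 : 0 < xb (c.1 k.1) (c.2 k) := lt_of_lt_of_le one_pos (hxb1 _ _)
      have := mul_le_mul_of_nonneg_left (log_tangent (div_pos hP ha) hx0) h0.le
      refine this.trans (le_of_eq ?_)
      unfold Phat
      field_simp
      ring
    have step2 := competitor hU hV k (fun u v => kA v a / xb u v)
      (fun u v => div_nonneg ((hA v).1 a) (zero_le_one.trans (hxb1 u v))) (fun v => kA v a)
      (fun v => (hA v).1 a)
    calc _ ≤ ∑ c, w c * (kA (c.2 k) a * (Real.log (xb (c.1 k.1) (c.2 k)) - 1) +
        ((M1 : ℝ) * M2 * pA a)⁻¹ * (kA (c.2 k) a / xb (c.1 k.1) (c.2 k) * ∑ k', kA (c.2 k') a)) :=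
          sum_le_sum fun c _ => mul_le_mul_of_nonneg_left (step1 c) (hw0 c)
      _ = ∑ c, w c * (kA (c.2 k) a * (Real.log (xb (c.1 k.1) (c.2 k)) - 1)) +
          ((M1 : ℝ) * M2 * pA a)⁻¹ * ∑ c, w c *
            (kA (c.2 k) a / xb (c.1 k.1) (c.2 k) * ∑ k', kA (c.2 k') a) := by
          rw [mul_sum, ← sum_add_distrib]
          exact sum_congr rfl fun c _ => by ring
      _ ≤ ∑ u, ∑ v, pU u * kV u v * (kA v a * (Real.log (xb u v) - 1)) +
          ((M1 : ℝ) * M2 * pA a)⁻¹ * ∑ u, ∑ v, pU u * kV u v * (kA v a / xb u v *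
        (kA v a + M2 * (∑ v', kV u v' * kA v' a) +
          (M1 * M2) * ∑ u', pU u' * ∑ v', kV u' v' * kA v' a)) := by
          refine add_le_add (le_of_eq ?_) (mul_le_mul_of_nonneg_left step2 (by positivity))
          exact bw_one hU hV Prod.fst k (fun u v => kA v a * (Real.log (xb u v) - 1))
      _ = _ := by
          simp only [mul_sum]
          rw [← sum_add_distrib]
          refine sum_congr rfl fun u _ => ?_
          rw [← sum_add_distrib]
          refine sum_congr rfl fun v _ => ?_
          simp only [← mul_sum]
          have e1 : ∑ u', pU u' * ∑ v', kV u' v' * kA v' a = pA a := rfl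
          have e2 : ∑ v', kV u v' * kA v' a = kc kV kA u a := rfl
          rw [e1, e2]
          have hx0 : 0 < xb u v := lt_of_lt_of_le one_pos (hxb1 _ _)
          have e3 : kA v a + M2 * kc kV kA u a + M1 * M2 * pA a = (M1 * M2 * pA a) * xb u v := by
            rw [hxb]; field_simp; ring
          rw [e3]
          field_simp
          ring
  calc ∑ c, w c * pA a * (Phat kA c a / pA a * Real.log (Phat kA c a / pA a))
      = ((M1 : ℝ) * M2)⁻¹ * ∑ k, ∑ c, w c * (kA (c.2 k) a * Real.log (Phat kA c a / pA a)) := by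
        rw [sum_comm, mul_sum]
        refine sum_congr rfl fun c _ => ?_
        rw [← mul_sum, ← sum_mul]
        have : Phat kA c a = ((M1 : ℝ) * M2)⁻¹ * ∑ k, kA (c.2 k) a := rfl
        have : w c * pA a * (Phat kA c a / pA a * Real.log (Phat kA c a / pA a)) =
          w c * (Phat kA c a * Real.log (Phat kA c a / pA a)) := by field_simp
        rw [this]
        conv_lhs => rw [show Phat kA c a * Real.log (Phat kA c a / pA a) =
          (((M1 : ℝ) * M2)⁻¹ * ∑ k, kA (c.2 k) a) * Real.log (Phat kA c a / pA a) from rfl]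
        ring
    _ ≤ ((M1 : ℝ) * M2)⁻¹ * ∑ k : Fin M1 × Fin M2,
          ∑ u, ∑ v, pU u * kV u v * (kA v a * Real.log (xb u v)) :=
        mul_le_mul_of_nonneg_left (sum_le_sum fun k _ => hk k) (by positivity)
    _ = ∑ u, ∑ v, pU u * kV u v * (kA v a * Real.log (xb u v)) := by
        simp
        field_simp
    _ ≤ _ := by
        rw [sum_div]
        refine sum_le_sum fun u _ => ?_
        rw [sum_div]
        refine sum_le_sum fun v _ => ?_
        rw [mul_div_assoc, mul_div_assoc]
        refine mul_le_mul_of_nonneg_left ?_ (mul_nonneg (hU.1 u) ((hV u).1 v))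
        refine mul_le_mul_of_nonneg_left ?_ ((hA v).1 a)
        have a1 : 0 ≤ kc kV kA u a / (M1 * pA a) := div_nonneg (hkAU u) (by positivity)
        have a2 : 0 ≤ kA v a / (M1 * M2 * pA a) := div_nonneg ((hA v).1 a) (by positivity)
        refine (log_one_add_le_rpow (add_nonneg a1 a2) hs hs1).trans ?_
        refine div_le_div_of_nonneg_right ?_ hs.le
        exact Real.rpow_add_le_add_rpow a1 a2 hs.le hs1
end
end part2

section part3
/-! ### Decoding and leakage -/

section
variable {M1 M2 L : ℕ} {U V B Q T Y Z : Type} [Fintype U] [Fintype V] [Fintype B] [Fintype Q]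
  [Fintype T] [Fintype Y] [Fintype Z]

/-- score of a codeword pair -/
noncomputable def score (kb : V → B → ℝ) (ky : T → Y → ℝ)
    (c1 : (Fin M1 → U) × (Fin M1 × Fin M2 → V))
    (c2 : (Fin M1 → Q) × ((Fin M1 × Fin M2) × Fin L → T)) (b : B) (y : Y) (k : Fin M1 × Fin M2) : ℝ :=
  kb (c1.2 k) b * ∑ l, ky (c2.2 (k, l)) y

/-- the projection of the second codebook -/
def pr2 {M1 M2 L : ℕ} (x : (Fin M1 × Fin M2) × Fin L) : Fin M1 := x.1.1

lemma min_le_rpow {r n s : ℝ} (hr : 0 ≤ r) (hn : 0 ≤ n) (hs : 0 < s) (hs1 : s < 1) :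
    min r n ≤ r ^ (1 - s) * n ^ s := by
  have h0 : 0 ≤ min r n := le_min hr hn
  have e : min r n = (min r n) ^ (1 - s) * (min r n) ^ s := by
    rcases h0.eq_or_lt with h | h
    · rw [← h, Real.zero_rpow hs.ne', mul_zero]
    · rw [← Real.rpow_add h]; simp
  rw [e]
  exact mul_le_mul (Real.rpow_le_rpow h0 (min_le_left _ _) (by linarith))
    (Real.rpow_le_rpow h0 (min_le_right _ _) hs.le) (Real.rpow_nonneg h0 _) (Real.rpow_nonneg hr _)

lemma decode_fixed {pU : U → ℝ} {kV : U → V → ℝ} {pQ : Q → ℝ} {kT : Q → T → ℝ}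
    (hU : IsPMF pU) (hV : IsKernel kV) (hQ : IsPMF pQ) (hT : IsKernel kT)
    {kb : V → B → ℝ} {ky : T → Y → ℝ} (hb : IsKernel kb) (hy : IsKernel ky)
    (b : B) (y : Y) (k : Fin M1 × Fin M2) (l : Fin L) {s : ℝ} (hs : 0 < s) (hs1 : s < 1)
    (dec : (Fin M1 → U) × (Fin M1 × Fin M2 → V) →
      (Fin M1 → Q) × ((Fin M1 × Fin M2) × Fin L → T) → Fin M1 × Fin M2)
    (hdec : ∀ c1 c2 k', score kb ky c1 c2 b y k' ≤ score kb ky c1 c2 b y (dec c1 c2)) :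
    ∑ c1, bw pU kV (Prod.fst : Fin M1 × Fin M2 → Fin M1) c1 * ∑ c2, bw pQ kT pr2 c2 *
      (if dec c1 c2 = k then 0 else kb (c1.2 k) b * ky (c2.2 (k, l)) y) ≤
    ∑ u, ∑ v, pU u * kV u v * ∑ q, ∑ t, pQ q * kT q t *
      ((kb v b * ky t y) ^ (1 - s) *
        (((M1 * M2 * L) * (pc pU (kc kV kb) b * pc pQ (kc kT ky) y)) ^ s +
          (((M2 : ℝ) - 1) * L * (kc kV kb u b * kc kT ky q y)) ^ s)) := by
  classical
  have hM2 : (1 : ℝ) ≤ M2 := by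
    have := k.2.pos
    exact_mod_cast this
  set β : ℝ := pc pU (kc kV kb) b * pc pQ (kc kT ky) y with hβ
  set α : U → Q → ℝ := fun u q => kc kV kb u b * kc kT ky q y with hα
  have hβ0 : 0 ≤ β := mul_nonneg ((pc_pmf hU (kc_kernel hV hb)).1 b) ((pc_pmf hQ (kc_kernel hT hy)).1 y)
  have hα0 : ∀ u q, 0 ≤ α u q := fun u q =>
    mul_nonneg ((kc_kernel hV hb u).1 b) ((kc_kernel hT hy q).1 y)
  set N : U → Q → ℝ := fun u q => (M1 * M2 * L) * β + ((M2 : ℝ) - 1) * L * α u q with hN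
  have hN1 : ∀ u q, 0 ≤ ((M2 : ℝ) - 1) * L * α u q := fun u q =>
    mul_nonneg (mul_nonneg (by linarith) (Nat.cast_nonneg _)) (hα0 u q)
  have hN2 : 0 ≤ (M1 * M2 * L) * β := by positivity
  set χ : U → V → Q → T → ℝ := fun u v q t => if N u q ≤ kb v b * ky t y then 1 else 0 with hχ
  have hχ0 : ∀ u v q t, 0 ≤ χ u v q t := by
    intro u v q t; rw [hχ]; dsimp only; split_ifs <;> norm_num
  have hρ : ∀ v t, 0 ≤ kb v b * ky t y := fun v t => mul_nonneg ((hb v).1 b) ((hy t).1 y)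
  -- pointwise bound
  have pt : ∀ c1 c2, (if dec c1 c2 = k then 0 else kb (c1.2 k) b * ky (c2.2 (k, l)) y) ≤
      (1 - χ (c1.1 k.1) (c1.2 k) (c2.1 k.1) (c2.2 (k, l))) * (kb (c1.2 k) b * ky (c2.2 (k, l)) y)
      + ∑ k', ∑ l', (if k' = k then 0 else χ (c1.1 k.1) (c1.2 k) (c2.1 k.1) (c2.2 (k, l)) *
        (kb (c1.2 k') b * ky (c2.2 (k', l')) y)) := by
    intro c1 c2
    set x := χ (c1.1 k.1) (c1.2 k) (c2.1 k.1) (c2.2 (k, l)) with hx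
    have hx01 : x = 0 ∨ x = 1 := by
      rw [hx, hχ]; dsimp only; split_ifs <;> simp
    have hS0 : ∀ k', 0 ≤ ∑ l', (if k' = k then 0 else x * (kb (c1.2 k') b * ky (c2.2 (k', l')) y)) := by
      intro k'
      refine sum_nonneg fun l' _ => ?_
      split_ifs
      · exact le_rfl
      · exact mul_nonneg (hχ0 _ _ _ _) (hρ _ _)
    have hSS : 0 ≤ ∑ k', ∑ l', (if k' = k then 0 else x * (kb (c1.2 k') b * ky (c2.2 (k', l')) y)) :=
      sum_nonneg fun k' _ => hS0 k'
    have hr := hρ (c1.2 k) (c2.2 (k, l))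
    by_cases hd : dec c1 c2 = k
    · rw [if_pos hd]
      rcases hx01 with h | h <;> rw [h] at hSS ⊢ <;> linarith
    · rw [if_neg hd]
      rcases hx01 with h | h
      · rw [h] at hSS ⊢; linarith
      · have h1 : kb (c1.2 k) b * ky (c2.2 (k, l)) y ≤ score kb ky c1 c2 b y k := by
          unfold score
          refine mul_le_mul_of_nonneg_left ?_ ((hb _).1 b)
          exact single_le_sum (f := fun l => ky (c2.2 (k, l)) y) (fun l _ => (hy _).1 y) (mem_univ l)
        have h2 := hdec c1 c2 k
        have h3 : score kb ky c1 c2 b y (dec c1 c2) ≤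
            ∑ k', ∑ l', (if k' = k then 0 else x * (kb (c1.2 k') b * ky (c2.2 (k', l')) y)) := by
          refine le_trans (le_of_eq ?_) (single_le_sum (fun k' _ => hS0 k') (mem_univ (dec c1 c2)))
          unfold score
          rw [mul_sum]
          refine sum_congr rfl fun l' _ => ?_
          rw [if_neg hd, h, one_mul]
        rw [h] at h3 ⊢
        linarith
  -- expectation of each competitor
  have comp : ∀ k' : Fin M1 × Fin M2, ∀ l' : Fin L,
      ∑ c1, bw pU kV (Prod.fst : Fin M1 × Fin M2 → Fin M1) c1 * ∑ c2, bw pQ kT pr2 c2 *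
        (if k' = k then 0 else χ (c1.1 k.1) (c1.2 k) (c2.1 k.1) (c2.2 (k, l)) *
        (kb (c1.2 k') b * ky (c2.2 (k', l')) y)) ≤
      ∑ u, ∑ v, pU u * kV u v * ∑ q, ∑ t, pQ q * kT q t * (χ u v q t *
        ((if k'.1 = k.1 then α u q else 0) + β - (if k' = k then α u q else 0))) := by
    intro k' l'
    by_cases h1 : k' = k
    · subst h1
      simp only [if_true, mul_zero, sum_const_zero]
      refine sum_nonneg fun u _ => sum_nonneg fun v _ => mul_nonneg (mul_nonneg (hU.1 u) ((hV u).1 v))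
        (sum_nonneg fun q _ => sum_nonneg fun t _ => mul_nonneg (mul_nonneg (hQ.1 q) ((hT q).1 t))
          (mul_nonneg (hχ0 _ _ _ _) ?_))
      linarith
    have hkl : (k, l) ≠ (k', l') := fun h => h1 (by rw [Prod.mk.injEq] at h; exact h.1.symm)
    by_cases h2 : k'.1 = k.1
    · refine le_trans (le_of_eq (b := ∑ u, ∑ v, pU u * kV u v * ∑ q, ∑ t, pQ q * kT q t * (χ u v q t *
        α u q)) ?_) ?_
      · have in2 : ∀ c1 : (Fin M1 → U) × (Fin M1 × Fin M2 → V),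
            ∑ c2, bw pQ kT pr2 c2 *
            (if k' = k then 0 else χ (c1.1 k.1) (c1.2 k) (c2.1 k.1) (c2.2 (k, l)) *
            (kb (c1.2 k') b * ky (c2.2 (k', l')) y)) =
            ∑ q, ∑ t, pQ q * kT q t * (χ (c1.1 k.1) (c1.2 k) q t * (kb (c1.2 k') b * kc kT ky q y)) := by
          intro c1
          simp only [h1, if_false]
          refine (bw_same hQ hT pr2 (k, l) (k', l') hkl h2.symm
            (fun q t t' => χ (c1.1 k.1) (c1.2 k) q t * (kb (c1.2 k') b * ky t' y))).trans ?_
          refine sum_congr rfl fun q _ => sum_congr rfl fun t _ => ?_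
          congr 1
          unfold kc
          simp only [mul_sum]
          exact sum_congr rfl fun t' _ => by ring
        simp only [in2]
        rw [bw_same hU hV Prod.fst k k' (Ne.symm h1) h2.symm
          (fun u v v' => ∑ q, ∑ t, pQ q * kT q t * (χ u v q t * (kb v' b * kc kT ky q y)))]
        refine sum_congr rfl fun u _ => sum_congr rfl fun v _ => ?_
        congr 1
        simp only [mul_sum]
        rw [sum_comm]
        refine sum_congr rfl fun q _ => ?_
        rw [sum_comm]
        refine sum_congr rfl fun t _ => ?_
        rw [hα]
        dsimp only
        conv_rhs => rw [kc, sum_mul, mul_sum, mul_sum]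
        exact sum_congr rfl fun v' _ => by ring
      · refine sum_le_sum fun u _ => sum_le_sum fun v _ => mul_le_mul_of_nonneg_left
          (sum_le_sum fun q _ => sum_le_sum fun t _ => mul_le_mul_of_nonneg_left
          (mul_le_mul_of_nonneg_left ?_ (hχ0 _ _ _ _)) (mul_nonneg (hQ.1 q) ((hT q).1 t)))
          (mul_nonneg (hU.1 u) ((hV u).1 v))
        rw [if_pos h2, if_neg h1]
        linarith
    · refine le_of_eq ?_
      simp only [h1, h2, if_false, zero_add, sub_zero]
      have in2 : ∀ c1 : (Fin M1 → U) × (Fin M1 × Fin M2 → V),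
            ∑ c2, bw pQ kT pr2 c2 *
            (χ (c1.1 k.1) (c1.2 k) (c2.1 k.1) (c2.2 (k, l)) *
            (kb (c1.2 k') b * ky (c2.2 (k', l')) y)) =
            ∑ q, ∑ t, pQ q * kT q t * (χ (c1.1 k.1) (c1.2 k) q t *
              (kb (c1.2 k') b * pc pQ (kc kT ky) y)) := by
        intro c1
        refine (bw_diff hQ hT pr2 (k, l) (k', l') (Ne.symm h2)
          (fun q t t' => χ (c1.1 k.1) (c1.2 k) q t * (kb (c1.2 k') b * ky t' y))).trans ?_
        refine sum_congr rfl fun q _ => sum_congr rfl fun t _ => ?_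
        congr 1
        unfold pc kc
        simp only [mul_sum]
        exact sum_congr rfl fun q' _ => sum_congr rfl fun t' _ => by ring
      simp only [in2]
      rw [bw_diff hU hV Prod.fst k k' (Ne.symm h2)
          (fun u v v' => ∑ q, ∑ t, pQ q * kT q t * (χ u v q t * (kb v' b * pc pQ (kc kT ky) y)))]
      refine sum_congr rfl fun u _ => sum_congr rfl fun v _ => ?_
      congr 1
      have e1 : ∀ v', ∑ q, ∑ t, pQ q * kT q t * (χ u v q t * (kb v' b * pc pQ (kc kT ky) y)) =
          kb v' b * ∑ q, ∑ t, pQ q * kT q t * (χ u v q t * pc pQ (kc kT ky) y) := by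
        intro v'
        simp only [mul_sum]
        exact sum_congr rfl fun q _ => sum_congr rfl fun t _ => by ring
      simp only [e1]
      have e2 : ∀ S : ℝ, ∑ u', pU u' * ∑ v', kV u' v' * (kb v' b * S) = pc pU (kc kV kb) b * S := by
        intro S
        unfold pc kc
        simp only [sum_mul, mul_sum]
        exact sum_congr rfl fun u' _ => sum_congr rfl fun v' _ => by ring
      rw [e2, hβ]
      simp only [mul_sum]
      exact sum_congr rfl fun q _ => sum_congr rfl fun t _ => by ring
  -- assemble
  have hw1 : ∀ c, 0 ≤ bw pU kV (Prod.fst : Fin M1 × Fin M2 → Fin M1) c := bw_nonneg hU hV _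
  have hw2 : ∀ c, 0 ≤ bw pQ kT (pr2 : (Fin M1 × Fin M2) × Fin L → Fin M1) c := bw_nonneg hQ hT _
  calc _ ≤ ∑ c1, bw pU kV (Prod.fst : Fin M1 × Fin M2 → Fin M1) c1 * ∑ c2, bw pQ kT pr2 c2 *
        ((1 - χ (c1.1 k.1) (c1.2 k) (c2.1 k.1) (c2.2 (k, l))) * (kb (c1.2 k) b * ky (c2.2 (k, l)) y)
      + ∑ k', ∑ l', (if k' = k then 0 else χ (c1.1 k.1) (c1.2 k) (c2.1 k.1) (c2.2 (k, l)) *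
        (kb (c1.2 k') b * ky (c2.2 (k', l')) y))) :=
        sum_le_sum fun c1 _ => mul_le_mul_of_nonneg_left (sum_le_sum fun c2 _ =>
          mul_le_mul_of_nonneg_left (pt c1 c2) (hw2 c2)) (hw1 c1)
    _ = ∑ c1, bw pU kV (Prod.fst : Fin M1 × Fin M2 → Fin M1) c1 * (∑ c2, bw pQ kT pr2 c2 *
        ((1 - χ (c1.1 k.1) (c1.2 k) (c2.1 k.1) (c2.2 (k, l))) * (kb (c1.2 k) b * ky (c2.2 (k, l)) y)))
      + ∑ k', ∑ l', ∑ c1, bw pU kV (Prod.fst : Fin M1 × Fin M2 → Fin M1) c1 * ∑ c2, bw pQ kT pr2 c2 *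
        (if k' = k then 0 else χ (c1.1 k.1) (c1.2 k) (c2.1 k.1) (c2.2 (k, l)) *
        (kb (c1.2 k') b * ky (c2.2 (k', l')) y)) := by
        simp only [mul_add, sum_add_distrib]
        congr 1
        simp only [mul_sum]
        have e : ∀ (F : (Fin M1 → U) × (Fin M1 × Fin M2 → V) →
            (Fin M1 → Q) × ((Fin M1 × Fin M2) × Fin L → T) → Fin M1 × Fin M2 → Fin L → ℝ),
            ∑ c1, ∑ c2, ∑ k', ∑ l', F c1 c2 k' l' = ∑ k', ∑ l', ∑ c1, ∑ c2, F c1 c2 k' l' := by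
          intro F
          calc _ = ∑ c1, ∑ k', ∑ c2, ∑ l', F c1 c2 k' l' := sum_congr rfl fun _ _ => sum_comm
            _ = ∑ c1, ∑ k', ∑ l', ∑ c2, F c1 c2 k' l' :=
              sum_congr rfl fun _ _ => sum_congr rfl fun _ _ => sum_comm
            _ = ∑ k', ∑ c1, ∑ l', ∑ c2, F c1 c2 k' l' := sum_comm
            _ = _ := sum_congr rfl fun _ _ => sum_comm
        exact e _
    _ ≤ ∑ u, ∑ v, pU u * kV u v * (∑ q, ∑ t, pQ q * kT q t * ((1 - χ u v q t) * (kb v b * ky t y)))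
      + ∑ k' : Fin M1 × Fin M2, ∑ l' : Fin L, ∑ u, ∑ v, pU u * kV u v * ∑ q, ∑ t, pQ q * kT q t * (χ u v q t *
        ((if k'.1 = k.1 then α u q else 0) + β - (if k' = k then α u q else 0))) := by
        refine add_le_add (le_of_eq ?_) (sum_le_sum fun k' _ => sum_le_sum fun l' _ => comp k' l')
        have in2 : ∀ c1 : (Fin M1 → U) × (Fin M1 × Fin M2 → V), ∑ c2, bw pQ kT pr2 c2 *
          ((1 - χ (c1.1 k.1) (c1.2 k) (c2.1 k.1) (c2.2 (k, l))) * (kb (c1.2 k) b * ky (c2.2 (k, l)) y))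
          = ∑ q, ∑ t, pQ q * kT q t * ((1 - χ (c1.1 k.1) (c1.2 k) q t) * (kb (c1.2 k) b * ky t y)) :=
          fun c1 => bw_one hQ hT pr2 (k, l)
            (fun q t => (1 - χ (c1.1 k.1) (c1.2 k) q t) * (kb (c1.2 k) b * ky t y))
        simp only [in2]
        exact bw_one hU hV Prod.fst k
          (fun u v => ∑ q, ∑ t, pQ q * kT q t * ((1 - χ u v q t) * (kb v b * ky t y)))
    _ = ∑ u, ∑ v, pU u * kV u v * ∑ q, ∑ t, pQ q * kT q t *
          ((1 - χ u v q t) * (kb v b * ky t y) + χ u v q t * N u q) := by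
        have e : ∀ (F : U → V → Fin M1 × Fin M2 → Fin L → ℝ),
            ∑ k', ∑ l', ∑ u, ∑ v, F u v k' l' = ∑ u, ∑ v, ∑ k', ∑ l', F u v k' l' := by
          intro F
          symm
          calc _ = ∑ c1, ∑ k', ∑ c2, ∑ l', F c1 c2 k' l' := sum_congr rfl fun _ _ => sum_comm
            _ = ∑ c1, ∑ k', ∑ l', ∑ c2, F c1 c2 k' l' :=
              sum_congr rfl fun _ _ => sum_congr rfl fun _ _ => sum_comm
            _ = ∑ k', ∑ c1, ∑ l', ∑ c2, F c1 c2 k' l' := sum_comm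
            _ = _ := sum_congr rfl fun _ _ => sum_comm
        have e' : ∀ (F : Q → T → Fin M1 × Fin M2 → Fin L → ℝ),
            ∑ k', ∑ l', ∑ u, ∑ v, F u v k' l' = ∑ u, ∑ v, ∑ k', ∑ l', F u v k' l' := by
          intro F
          symm
          calc _ = ∑ c1, ∑ k', ∑ c2, ∑ l', F c1 c2 k' l' := sum_congr rfl fun _ _ => sum_comm
            _ = ∑ c1, ∑ k', ∑ l', ∑ c2, F c1 c2 k' l' :=
              sum_congr rfl fun _ _ => sum_congr rfl fun _ _ => sum_comm
            _ = ∑ k', ∑ c1, ∑ l', ∑ c2, F c1 c2 k' l' := sum_comm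
            _ = _ := sum_congr rfl fun _ _ => sum_comm
        rw [e, ← sum_add_distrib]
        refine sum_congr rfl fun u _ => ?_
        rw [← sum_add_distrib]
        refine sum_congr rfl fun v _ => ?_
        simp only [← mul_sum]
        rw [← mul_add, e', ← sum_add_distrib]
        congr 1
        refine sum_congr rfl fun q _ => ?_
        rw [← sum_add_distrib]
        refine sum_congr rfl fun t _ => ?_
        simp only [← mul_sum]
        rw [mul_add]
        congr 3
        have e3 : ∑ i : Fin M1 × Fin M2, (if i.1 = k.1 then α u q else 0) = M2 * α u q := by
          rw [Fintype.sum_prod_type, sum_comm]; simp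
        have e4 : ∑ i : Fin M1 × Fin M2, (if i = k then α u q else 0) = α u q := by simp
        rw [sum_comm]
        simp only [sum_sub_distrib, sum_add_distrib, e3, e4]
        simp [hN]
        ring
    _ ≤ _ := by
        refine sum_le_sum fun u _ => sum_le_sum fun v _ => mul_le_mul_of_nonneg_left
          (sum_le_sum fun q _ => sum_le_sum fun t _ => mul_le_mul_of_nonneg_left
          ?_ (mul_nonneg (hQ.1 q) ((hT q).1 t))) (mul_nonneg (hU.1 u) ((hV u).1 v))
        have e5 : (1 - χ u v q t) * (kb v b * ky t y) + χ u v q t * N u q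
            = min (kb v b * ky t y) (N u q) := by
          rw [hχ]; dsimp only
          split_ifs with h
          · rw [min_eq_right h]; ring
          · rw [min_eq_left (not_le.1 h).le]; ring
        rw [e5]
        refine (min_le_rpow (hρ v t) (add_nonneg hN2 (hN1 u q)) hs hs1).trans ?_
        refine mul_le_mul_of_nonneg_left ?_ (Real.rpow_nonneg (hρ v t) _)
        exact Real.rpow_add_le_add_rpow hN2 (hN1 u q) hs.le hs1.le

/-- Eve's conditional output distribution given the index. -/
noncomputable def Rz (kz : T → Z → ℝ) (c2 : (Fin M1 → Q) × ((Fin M1 × Fin M2) × Fin L → T))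
    (k : Fin M1 × Fin M2) (z : Z) : ℝ := (L : ℝ)⁻¹ * ∑ l, kz (c2.2 (k, l)) z

lemma leak_fixed {pQ : Q → ℝ} {kT : Q → T → ℝ}
    (hQ : IsPMF pQ) (hT : IsKernel kT) {kz : T → Z → ℝ} (hz : IsKernel kz)
    (k : Fin M1 × Fin M2) (l : Fin L) (z : Z) {s : ℝ} (hs : 0 < s) (hs1 : s ≤ 1) :
    ∑ c2, bw pQ kT pr2 c2 * (kz (c2.2 (k, l)) z * Real.log (Rz kz c2 k z)) ≤
    ∑ q, ∑ t, pQ q * kT q t * (kz t z * (- Real.log L + Real.log (kz t z) +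
      (((L : ℝ) - 1) * (kc kT kz q z / kz t z)) ^ s / s)) := by
  have hL : (1 : ℝ) ≤ L := by
    have := l.pos
    exact_mod_cast this
  have hw2 : ∀ c, 0 ≤ bw pQ kT (pr2 : (Fin M1 × Fin M2) × Fin L → Fin M1) c := bw_nonneg hQ hT _
  set x : Q → T → ℝ := fun q t => (L : ℝ)⁻¹ * (kz t z + ((L : ℝ) - 1) * kc kT kz q z) with hx
  have hq0 : ∀ q, 0 ≤ ((L : ℝ) - 1) * kc kT kz q z := fun q =>
    mul_nonneg (by linarith) ((kc_kernel hT hz q).1 z)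
  have hL0 : (0 : ℝ) < L := by linarith
  have hxpos : ∀ q t, 0 < kz t z → 0 < x q t := fun q t h => by
    have := hq0 q
    rw [hx]
    dsimp only
    positivity
  have pt : ∀ c2 : (Fin M1 → Q) × ((Fin M1 × Fin M2) × Fin L → T),
      kz (c2.2 (k, l)) z * Real.log (Rz kz c2 k z) ≤
      kz (c2.2 (k, l)) z * (Real.log (x (c2.1 k.1) (c2.2 (k, l))) - 1) +
      (L : ℝ)⁻¹ * ∑ l', kz (c2.2 (k, l)) z / x (c2.1 k.1) (c2.2 (k, l)) * kz (c2.2 (k, l')) z := by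
    intro c2
    rcases ((hz (c2.2 (k, l))).1 z).eq_or_lt with h0 | h0
    · rw [← h0]; simp
    have hS : 0 < ∑ l', kz (c2.2 (k, l')) z :=
      sum_pos' (fun k' _ => (hz _).1 z) ⟨l, mem_univ _, h0⟩
    have hP : 0 < Rz kz c2 k z := mul_pos (by positivity) hS
    have := mul_le_mul_of_nonneg_left (log_tangent hP (hxpos (c2.1 k.1) _ h0)) h0.le
    refine this.trans (le_of_eq ?_)
    rw [← mul_sum]
    unfold Rz
    ring
  have comp : ∀ l' : Fin L, ∑ c2, bw pQ kT pr2 c2 *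
      (kz (c2.2 (k, l)) z / x (c2.1 k.1) (c2.2 (k, l)) * kz (c2.2 (k, l')) z) =
      ∑ q, ∑ t, pQ q * kT q t * (kz t z / x q t *
        (kc kT kz q z + if l' = l then kz t z - kc kT kz q z else 0)) := by
    intro l'
    by_cases h : l' = l
    · subst h
      simp only [if_true]
      refine (bw_one hQ hT pr2 (k, l') (fun q t => kz t z / x q t * kz t z)).trans ?_
      refine sum_congr rfl fun q _ => sum_congr rfl fun t _ => ?_
      ring
    · simp only [if_neg h, add_zero]
      refine (bw_same hQ hT pr2 (k, l) (k, l') (fun h' => h (by rw [Prod.mk.injEq] at h'; exact h'.2.symm)) rfl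
        (fun q t t' => kz t z / x q t * kz t' z)).trans ?_
      refine sum_congr rfl fun q _ => sum_congr rfl fun t _ => ?_
      congr 1
      unfold kc
      rw [mul_sum]
      exact sum_congr rfl fun t' _ => by ring
  calc _ ≤ ∑ c2, bw pQ kT pr2 c2 *
      (kz (c2.2 (k, l)) z * (Real.log (x (c2.1 k.1) (c2.2 (k, l))) - 1) +
      (L : ℝ)⁻¹ * ∑ l', kz (c2.2 (k, l)) z / x (c2.1 k.1) (c2.2 (k, l)) * kz (c2.2 (k, l')) z) :=
        sum_le_sum fun c2 _ => mul_le_mul_of_nonneg_left (pt c2) (hw2 c2)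
    _ = ∑ q, ∑ t, pQ q * kT q t * (kz t z * (Real.log (x q t) - 1)) +
        (L : ℝ)⁻¹ * ∑ l' : Fin L, ∑ q, ∑ t, pQ q * kT q t * (kz t z / x q t *
        (kc kT kz q z + if l' = l then kz t z - kc kT kz q z else 0)) := by
        simp only [← comp]
        rw [← bw_one hQ hT pr2 (k, l) (fun q t => kz t z * (Real.log (x q t) - 1)), sum_comm, mul_sum,
          ← sum_add_distrib]
        refine sum_congr rfl fun c2 _ => ?_
        have : ∀ (p r w : ℝ) (S : Fin L → ℝ), w * (p + r * ∑ l', S l') = w * p + r * ∑ l', w * S l' :=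
          fun p r w S => by rw [← mul_sum]; ring
        exact this _ _ _ _
    _ = ∑ q, ∑ t, pQ q * kT q t * (kz t z * Real.log (x q t)) := by
        have e : ∀ F : Fin L → Q → T → ℝ, ∑ l', ∑ q, ∑ t, F l' q t = ∑ q, ∑ t, ∑ l', F l' q t := by
          intro F
          rw [sum_comm]
          exact sum_congr rfl fun _ _ => sum_comm
        rw [e, mul_sum, ← sum_add_distrib]
        refine sum_congr rfl fun q _ => ?_
        rw [mul_sum, ← sum_add_distrib]
        refine sum_congr rfl fun t _ => ?_
        simp only [← mul_sum, sum_add_distrib]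
        simp only [sum_const, card_univ, Fintype.card_fin, nsmul_eq_mul, sum_ite_eq', mem_univ, if_true]
        rcases ((hz t).1 z).eq_or_lt with h0 | h0
        · rw [← h0]; simp
        have h1 := hxpos q t h0
        have h2 : (L : ℝ) * kc kT kz q z + (kz t z - kc kT kz q z) = L * x q t := by
          rw [hx]; field_simp; ring
        rw [h2]
        field_simp
        ring
    _ ≤ _ := by
        refine sum_le_sum fun q _ => sum_le_sum fun t _ => mul_le_mul_of_nonneg_left
          ?_ (mul_nonneg (hQ.1 q) ((hT q).1 t))
        rcases ((hz t).1 z).eq_or_lt with h0 | h0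
        · rw [← h0]; simp
        refine mul_le_mul_of_nonneg_left ?_ h0.le
        have h3 : x q t = (L : ℝ)⁻¹ * (kz t z * (1 + ((L : ℝ) - 1) * (kc kT kz q z / kz t z))) := by
          rw [hx]; field_simp
        have h4 : 0 ≤ ((L : ℝ) - 1) * (kc kT kz q z / kz t z) := by
          rw [← mul_div_assoc]; exact div_nonneg (hq0 q) h0.le
        rw [h3, Real.log_mul (by positivity) (by positivity), Real.log_mul (by positivity) (by positivity),
          Real.log_inv]
        have := log_one_add_le_rpow h4 hs hs1
        linarith
end
end part3

section part4
/-! ### One-shot code: structure -/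

lemma pushf_sum {γ α : Type} [Fintype γ] [Fintype α] (q : γ → ℝ) (f : γ → α) (g : α → ℝ) :
    ∑ a, pushf q f a * g a = ∑ c, q c * g (f c) := by
  classical
  unfold pushf
  simp only [sum_mul]
  rw [sum_comm]
  refine sum_congr rfl fun c _ => ?_
  rw [sum_eq_single (f c)]
  · simp
  · intro b _ hb
    rw [if_neg (Ne.symm hb), zero_mul]
  · simp

lemma pushf_eq {γ α : Type} [Fintype γ] [Fintype α] (q : γ → ℝ) (f : γ → α) (r : α → ℝ)
    (h : ∀ g : α → ℝ, ∑ a, r a * g a = ∑ c, q c * g (f c)) : pushf q f = r := by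
  classical
  funext a
  have h1 := pushf_sum q f (fun x => if x = a then 1 else 0)
  have h2 := h (fun x => if x = a then 1 else 0)
  rw [← h2] at h1
  simpa using h1

lemma sum_rot3 {α β γ : Type} [Fintype α] [Fintype β] [Fintype γ] (G : α → β → γ → ℝ) :
    ∑ b, ∑ y, ∑ z, G b y z = ∑ z, ∑ y, ∑ b, G b y z := by
  have : ∀ y, ∑ b, ∑ z, G b y z = ∑ z, ∑ b, G b y z := fun y => sum_comm
  rw [sum_comm]
  simp only [this]
  rw [sum_comm]

lemma entropy_log {γ : Type} [Fintype γ] (q : γ → ℝ) :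
    entropy q * Real.log 2 = -∑ c, q c * Real.log (q c) := by
  have h2 : Real.log 2 ≠ 0 := (Real.log_pos (by norm_num)).ne'
  unfold entropy Real.logb
  rw [neg_mul, sum_mul]
  congr 1
  refine sum_congr rfl fun c _ => ?_
  field_simp

/-- first output marginal of a kernel -/
noncomputable def m1 {α β γ : Type} [Fintype γ] (k : α → β × γ → ℝ) (a : α) (b : β) : ℝ := ∑ c, k a (b, c)

/-- second output marginal of a kernel -/
noncomputable def m2 {α β γ : Type} [Fintype β] (k : α → β × γ → ℝ) (a : α) (c : γ) : ℝ := ∑ b, k a (b, c)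

lemma m1_kernel {α β γ : Type} [Fintype β] [Fintype γ] {k : α → β × γ → ℝ} (h : IsKernel k) :
    IsKernel (m1 k) := fun a => ⟨fun b => sum_nonneg fun c _ => (h a).1 _, by
  rw [← (h a).2, Fintype.sum_prod_type]; rfl⟩

lemma m2_kernel {α β γ : Type} [Fintype β] [Fintype γ] {k : α → β × γ → ℝ} (h : IsKernel k) :
    IsKernel (m2 k) := fun a => ⟨fun b => sum_nonneg fun c _ => (h a).1 _, by
  rw [← (h a).2, Fintype.sum_prod_type_right]; rfl⟩

section
variable {A B E X Y Z : Type} [Fintype A] [Fintype B] [Fintype E]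
  [Fintype X] [Fintype Y] [Fintype Z]

/-- one-shot joint law -/
noncomputable def osJoint (pS : A × B × E → ℝ) (W : X → Y × Z → ℝ) (F : A → X → ℝ) :
    A × B × E × X × Y × Z → ℝ := fun w =>
  pS (w.1, w.2.1, w.2.2.1) * F w.1 w.2.2.2.1 * W w.2.2.2.1 (w.2.2.2.2.1, w.2.2.2.2.2)

lemma os_sum1 (pA : A → ℝ) (kBE : A → B × E → ℝ) (W : X → Y × Z → ℝ) (F : A → X → ℝ)
    (φ : A → B → Y → ℝ) :
    ∑ w, osJoint (fun w => pA w.1 * kBE w.1 w.2) W F w * φ w.1 w.2.1 w.2.2.2.2.1 =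
    ∑ a, pA a * ∑ b, m1 kBE a b * ∑ x, F a x * ∑ y, m1 W x y * φ a b y := by
  simp only [Fintype.sum_prod_type, osJoint, m1, mul_sum, sum_mul]
  refine sum_congr rfl fun a _ => sum_congr rfl fun b _ => ?_
  rw [sum_comm]
  refine sum_congr rfl fun x _ => ?_
  rw [sum_comm]
  refine sum_congr rfl fun y _ => ?_
  rw [sum_comm]
  refine sum_congr rfl fun z _ => sum_congr rfl fun e _ => ?_
  ring

lemma os_sum2 (pA : A → ℝ) (kBE : A → B × E → ℝ) (W : X → Y × Z → ℝ) (F : A → X → ℝ)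
    (φ : A → E → Z → ℝ) :
    ∑ w, osJoint (fun w => pA w.1 * kBE w.1 w.2) W F w * φ w.1 w.2.2.1 w.2.2.2.2.2 =
    ∑ a, pA a * ∑ e, m2 kBE a e * ∑ x, F a x * ∑ z, m2 W x z * φ a e z := by
  simp only [Fintype.sum_prod_type, osJoint, m2, mul_sum, sum_mul]
  refine sum_congr rfl fun a _ => ?_
  rw [sum_comm]
  refine sum_congr rfl fun e _ => ?_
  rw [sum_comm]
  refine sum_congr rfl fun x _ => ?_
  rw [sum_rot3]
  refine sum_congr rfl fun z _ => sum_congr rfl fun y _ => sum_congr rfl fun b _ => ?_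
  ring

variable {M1 M2 L : ℕ} {U V Q T : Type} [Fintype U] [Fintype V] [Fintype Q] [Fintype T]

/-- likelihood encoder -/
noncomputable def Kenc (kA : V → A → ℝ) (c : (Fin M1 → U) × (Fin M1 × Fin M2 → V)) (a : A)
    (k : Fin M1 × Fin M2) : ℝ :=
  if ∑ k', kA (c.2 k') a = 0 then ((M1 : ℝ) * M2)⁻¹ else kA (c.2 k) a / ∑ k', kA (c.2 k') a

lemma Kenc_kernel {kA : V → A → ℝ} (hA : IsKernel kA) (h1 : 0 < M1) (h2 : 0 < M2)
    (c : (Fin M1 → U) × (Fin M1 × Fin M2 → V)) : IsKernel (Kenc kA c) := by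
  intro a
  have h1' : (0 : ℝ) < M1 := by exact_mod_cast h1
  have h2' : (0 : ℝ) < M2 := by exact_mod_cast h2
  constructor
  · intro k
    unfold Kenc
    split_ifs
    · positivity
    · exact div_nonneg ((hA _).1 _) (sum_nonneg fun _ _ => (hA _).1 _)
  · unfold Kenc
    split_ifs with h
    · rw [sum_const, card_univ, Fintype.card_prod, Fintype.card_fin, Fintype.card_fin, nsmul_eq_mul]
      push_cast
      exact mul_inv_cancel₀ (by positivity)
    · rw [← sum_div, div_self h]

lemma Phat_Kenc {kA : V → A → ℝ} (hA : IsKernel kA)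
    (c : (Fin M1 → U) × (Fin M1 × Fin M2 → V)) (a : A) (k : Fin M1 × Fin M2) :
    Phat kA c a * Kenc kA c a k = ((M1 : ℝ) * M2)⁻¹ * kA (c.2 k) a := by
  unfold Phat Kenc
  split_ifs with h
  · have := (sum_eq_zero_iff_of_nonneg (fun k _ => (hA (c.2 k)).1 a)).1 h k (mem_univ k)
    rw [h, this]; ring
  · field_simp

/-- encoder of the one-shot code -/
noncomputable def Fenc (kA : V → A → ℝ) (kX : T → X → ℝ) (c1 : (Fin M1 → U) × (Fin M1 × Fin M2 → V))
    (c2 : (Fin M1 → Q) × ((Fin M1 × Fin M2) × Fin L → T)) (a : A) (x : X) : ℝ :=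
  ∑ k, Kenc kA c1 a k * Rz kX c2 k x

lemma Rz_kernel {kz : T → Z → ℝ} (hz : IsKernel kz) (hL : 0 < L)
    (c2 : (Fin M1 → Q) × ((Fin M1 × Fin M2) × Fin L → T)) : IsKernel (Rz kz c2) := by
  intro k
  have hL' : (0 : ℝ) < L := by exact_mod_cast hL
  constructor
  · intro z
    exact mul_nonneg (by positivity) (sum_nonneg fun l _ => (hz _).1 z)
  · unfold Rz
    rw [← mul_sum, sum_comm]
    simp only [(hz _).2]
    rw [sum_const, card_univ, Fintype.card_fin, nsmul_eq_mul, mul_one, inv_mul_cancel₀ hL'.ne']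

lemma Fenc_kernel {kA : V → A → ℝ} (hA : IsKernel kA) {kX : T → X → ℝ} (hX : IsKernel kX)
    (h1 : 0 < M1) (h2 : 0 < M2) (hL : 0 < L)
    (c1 : (Fin M1 → U) × (Fin M1 × Fin M2 → V))
    (c2 : (Fin M1 → Q) × ((Fin M1 × Fin M2) × Fin L → T)) : IsKernel (Fenc kA kX c1 c2) :=
  kc_kernel (Kenc_kernel hA h1 h2 c1) (Rz_kernel hX hL c2)

lemma Fenc_sum (kA : V → A → ℝ) (kX : T → X → ℝ) (w : X → Y → ℝ)
    (c1 : (Fin M1 → U) × (Fin M1 × Fin M2 → V))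
    (c2 : (Fin M1 → Q) × ((Fin M1 × Fin M2) × Fin L → T)) (a : A) (φ : Y → ℝ) :
    ∑ x, Fenc kA kX c1 c2 a x * ∑ y, w x y * φ y =
    ∑ k, Kenc kA c1 a k * ∑ y, Rz (kc kX w) c2 k y * φ y := by
  have inner : ∀ k, ∑ x, Rz kX c2 k x * ∑ y, w x y * φ y = ∑ y, Rz (kc kX w) c2 k y * φ y := by
    intro k
    unfold Rz kc
    simp only [sum_mul, mul_sum]
    rw [sum_rot3, sum_comm]
    refine sum_congr rfl fun l _ => sum_congr rfl fun y _ => sum_congr rfl fun x _ => ?_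
    ring
  simp only [← inner]
  unfold Fenc
  simp only [sum_mul]
  rw [sum_comm]
  refine sum_congr rfl fun k _ => ?_
  rw [mul_sum]
  exact sum_congr rfl fun x _ => by ring

/-- change of measure -/
lemma real_le_ideal {kA : V → A → ℝ} {pA : A → ℝ} (hp : IsPMF pA) (hA : IsKernel kA)
    (c : (Fin M1 → U) × (Fin M1 × Fin M2 → V)) (G : A → Fin M1 × Fin M2 → ℝ) (C : ℝ)
    (h1 : 0 < M1) (h2 : 0 < M2) (hG0 : ∀ a k, 0 ≤ G a k) (hG : ∀ a k, G a k ≤ C) :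
    ∑ a, pA a * ∑ k, Kenc kA c a k * G a k ≤
    ∑ k, ((M1 : ℝ) * M2)⁻¹ * ∑ a, kA (c.2 k) a * G a k +
      C * ∑ a, pA a * |1 - Phat kA c a / pA a| := by
  have hK := Kenc_kernel hA h1 h2 c
  have hP0 : ∀ a, 0 ≤ Phat kA c a := fun a =>
    mul_nonneg (by positivity) (sum_nonneg fun k _ => (hA _).1 a)
  have e1 : ∑ k, ((M1 : ℝ) * M2)⁻¹ * ∑ a, kA (c.2 k) a * G a k =
      ∑ a, Phat kA c a * ∑ k, Kenc kA c a k * G a k := by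
    simp only [mul_sum]
    rw [sum_comm]
    refine sum_congr rfl fun a _ => sum_congr rfl fun k _ => ?_
    rw [← mul_assoc, ← mul_assoc, Phat_Kenc hA]
  rw [e1, mul_sum, ← sum_add_distrib]
  refine sum_le_sum fun a _ => ?_
  set g := ∑ k, Kenc kA c a k * G a k with hg
  have hg0 : 0 ≤ g := sum_nonneg fun k _ => mul_nonneg ((hK a).1 k) (hG0 a k)
  have hgC : g ≤ C := by
    calc g ≤ ∑ k, Kenc kA c a k * C := sum_le_sum fun k _ =>
          mul_le_mul_of_nonneg_left (hG a k) ((hK a).1 k)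
      _ = C := by rw [← sum_mul, (hK a).2, one_mul]
  rcases (hp.1 a).eq_or_lt with h0 | h0
  · rw [← h0]
    simp only [zero_mul, mul_zero, add_zero]
    exact mul_nonneg (hP0 a) hg0
  · have h3 : pA a - Phat kA c a ≤ pA a * |1 - Phat kA c a / pA a| := by
      calc pA a - Phat kA c a = pA a * (1 - Phat kA c a / pA a) := by field_simp
        _ ≤ _ := mul_le_mul_of_nonneg_left (le_abs_self _) h0.le
    have h4 : 0 ≤ pA a * |1 - Phat kA c a / pA a| := by positivity
    nlinarith
end
end part4

section part5
/-! ### One-shot code: averages over the codebook -/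

section
variable {S ι : Type} [Fintype S] [Fintype ι]
lemma expVal_add (w f g : S → ℝ) : expVal w (fun s => f s + g s) = expVal w f + expVal w g := by
  unfold expVal; rw [← sum_add_distrib]; exact sum_congr rfl fun s _ => by ring
lemma expVal_sub (w f g : S → ℝ) : expVal w (fun s => f s - g s) = expVal w f - expVal w g := by
  unfold expVal; rw [← sum_sub_distrib]; exact sum_congr rfl fun s _ => by ring
lemma expVal_smul (w : S → ℝ) (r : ℝ) (f : S → ℝ) : expVal w (fun s => r * f s) = r * expVal w f := by
  unfold expVal; rw [mul_sum]; exact sum_congr rfl fun s _ => by ring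
lemma expVal_sum (w : S → ℝ) (f : ι → S → ℝ) : expVal w (fun s => ∑ i, f i s) = ∑ i, expVal w (f i) := by
  unfold expVal; simp only [mul_sum]; rw [sum_comm]
lemma expVal_mono {w : S → ℝ} (hw : ∀ s, 0 ≤ w s) {f g : S → ℝ} (h : ∀ s, f s ≤ g s) :
    expVal w f ≤ expVal w g :=
  sum_le_sum fun s _ => mul_le_mul_of_nonneg_left (h s) (hw s)
lemma expVal_const {w : S → ℝ} (hw : IsPMF w) (r : ℝ) : expVal w (fun _ => r) = r := by
  unfold expVal; rw [← sum_mul, hw.2, one_mul]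
end

section
variable {S S' : Type} [Fintype S] [Fintype S']
/-- product weight -/
noncomputable def pw (w : S → ℝ) (w' : S' → ℝ) (c : S × S') : ℝ := w c.1 * w' c.2

lemma pw_pmf {w : S → ℝ} {w' : S' → ℝ} (hw : IsPMF w) (hw' : IsPMF w') : IsPMF (pw w w') := by
  refine ⟨fun c => mul_nonneg (hw.1 _) (hw'.1 _), ?_⟩
  refine (Fintype.sum_prod_type _).trans ?_
  unfold pw
  simp only [← mul_sum, hw'.2, mul_one, hw.2]

lemma expVal_pw (w : S → ℝ) (w' : S' → ℝ) (f : S × S' → ℝ) :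
    expVal (pw w w') f = ∑ s, w s * ∑ s', w' s' * f (s, s') := by
  refine (Fintype.sum_prod_type _).trans ?_
  refine sum_congr rfl fun s _ => ?_
  rw [mul_sum]
  exact sum_congr rfl fun s' _ => mul_assoc _ _ _

lemma expVal_pw_fst (w : S → ℝ) {w' : S' → ℝ} (hw' : IsPMF w') (f : S → ℝ) :
    expVal (pw w w') (fun c => f c.1) = expVal w f := by
  rw [expVal_pw]
  refine sum_congr rfl fun s _ => ?_
  simp only [← sum_mul, hw'.2, one_mul]
end

section
variable {A B E X Y Z : Type} [Fintype A] [Fintype B] [Fintype E]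
  [Fintype X] [Fintype Y] [Fintype Z]
variable {M1 M2 L : ℕ} {U V Q T : Type} [Fintype U] [Fintype V] [Fintype Q] [Fintype T]

/-- decoding bound for one pair of outputs -/
noncomputable def DECt (pU : U → ℝ) (kV : U → V → ℝ) (pQ : Q → ℝ) (kT : Q → T → ℝ)
    (kb : V → B → ℝ) (ky : T → Y → ℝ) (s : ℝ) (M1 M2 L : ℕ) : ℝ :=
  ∑ b, ∑ y, ∑ u, ∑ v, pU u * kV u v * ∑ q, ∑ t, pQ q * kT q t *
      ((kb v b * ky t y) ^ (1 - s) *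
        (((M1 * M2 * L) * (pc pU (kc kV kb) b * pc pQ (kc kT ky) y)) ^ s +
          (((M2 : ℝ) - 1) * L * (kc kV kb u b * kc kT ky q y)) ^ s))

/-- weights of the pair of codebooks -/
noncomputable def cw (pU : U → ℝ) (kV : U → V → ℝ) (pQ : Q → ℝ) (kT : Q → T → ℝ) (M1 M2 L : ℕ) :
    ((Fin M1 → U) × (Fin M1 × Fin M2 → V)) × ((Fin M1 → Q) × ((Fin M1 × Fin M2) × Fin L → T)) → ℝ :=
  pw (bw pU kV Prod.fst) (bw pQ kT pr2)

lemma bw_pmf {I K : Type} [Fintype I] [DecidableEq I] [Fintype K] [DecidableEq K]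
    {pU : U → ℝ} {kV : U → V → ℝ} (hU : IsPMF pU) (hV : IsKernel kV) (π : K → I) : IsPMF (bw pU kV π) :=
  ⟨bw_nonneg hU hV π, bw_sum hU hV π⟩

lemma cw_pmf {pU : U → ℝ} {kV : U → V → ℝ} {pQ : Q → ℝ} {kT : Q → T → ℝ}
    (hU : IsPMF pU) (hV : IsKernel kV) (hQ : IsPMF pQ) (hT : IsKernel kT) :
    IsPMF (cw pU kV pQ kT M1 M2 L) := pw_pmf (bw_pmf hU hV _) (bw_pmf hQ hT _)

lemma sum_inv_const {M1 M2 : ℕ} (h1 : 0 < M1) (h2 : 0 < M2) (r : ℝ) :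
    ∑ _k : Fin M1 × Fin M2, ((M1 : ℝ) * M2)⁻¹ * r = r := by
  have h1' : (0 : ℝ) < M1 := by exact_mod_cast h1
  have h2' : (0 : ℝ) < M2 := by exact_mod_cast h2
  rw [sum_const, card_univ, Fintype.card_prod, Fintype.card_fin, Fintype.card_fin, nsmul_eq_mul]
  push_cast
  field_simp

theorem oneshot_dist {pU : U → ℝ} {kV : U → V → ℝ} {kA : V → A → ℝ} {pQ : Q → ℝ} {kT : Q → T → ℝ}
    {kX : T → X → ℝ} {kBE : A → B × E → ℝ} {W : X → Y × Z → ℝ}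
    (hU : IsPMF pU) (hV : IsKernel kV) (hA : IsKernel kA) (hQ : IsPMF pQ) (hT : IsKernel kT)
    (hX : IsKernel kX) (hBE : IsKernel kBE) (hW : IsKernel W)
    (h1 : 0 < M1) (h2 : 0 < M2) (hL : 0 < L) {s : ℝ} (hs : 0 < s) (hs1 : s < 1)
    (φ : A → V → B → ℝ) (C : ℝ) (hφ0 : ∀ a v b, 0 ≤ φ a v b) (hφ : ∀ a v b, φ a v b ≤ C)
    (dec : (Fin M1 → U) × (Fin M1 × Fin M2 → V) →
      (Fin M1 → Q) × ((Fin M1 × Fin M2) × Fin L → T) → B → Y → Fin M1 × Fin M2)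
    (hdec : ∀ c1 c2 b y k', score (kc kA (m1 kBE)) (kc kX (m1 W)) c1 c2 b y k' ≤
      score (kc kA (m1 kBE)) (kc kX (m1 W)) c1 c2 b y (dec c1 c2 b y)) :
    expVal (cw pU kV pQ kT M1 M2 L) (fun c => 
      ∑ w, osJoint (fun w : A × B × E => pc pU (kc kV kA) w.1 * kBE w.1 w.2) W (Fenc kA kX c.1 c.2) w *
        φ w.1 (c.1.2 (dec c.1 c.2 w.2.1 w.2.2.2.2.1)) w.2.1) ≤
    ∑ u, ∑ v, pU u * kV u v * ∑ a, kA v a * ∑ b, m1 kBE a b * φ a v b +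
      C * (2 * √(SCterm pU kV kA s M1 (M1 * M2)) +
        DECt pU kV pQ kT (kc kA (m1 kBE)) (kc kX (m1 W)) s M1 M2 L) := by
  classical
  set kb := kc kA (m1 kBE) with hkb
  set ky := kc kX (m1 W) with hky
  set pA := pc pU (kc kV kA) with hpA
  have hp : IsPMF pA := pc_pmf hU (kc_kernel hV hA)
  have hb : IsKernel kb := kc_kernel hA (m1_kernel hBE)
  have hy : IsKernel ky := kc_kernel hX (m1_kernel hW)
  have hB := m1_kernel hBE
  have hcw : IsPMF (cw pU kV pQ kT M1 M2 L) := cw_pmf hU hV hQ hT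
  have hL' : (0 : ℝ) < L := by exact_mod_cast hL
  have hC : 0 ≤ C := by
    obtain ⟨a⟩ : Nonempty A := by
      by_contra h
      rw [not_nonempty_iff] at h
      have := hp.2
      simp at this
    obtain ⟨v⟩ : Nonempty V := by
      by_contra h
      rw [not_nonempty_iff] at h
      have := hp.2
      simp [hpA, pc, kc] at this
    obtain ⟨b⟩ : Nonempty B := by
      by_contra h
      rw [not_nonempty_iff] at h
      have := (hB a).2
      simp at this
    exact (hφ0 a v b).trans (hφ a v b)
  let ψ : V → ℝ := fun v => ∑ a, kA v a * ∑ b, m1 kBE a b * φ a v b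
  have pt : ∀ c : ((Fin M1 → U) × (Fin M1 × Fin M2 → V)) × ((Fin M1 → Q) × ((Fin M1 × Fin M2) × Fin L → T)),
      ∑ w, osJoint (fun w : A × B × E => pA w.1 * kBE w.1 w.2) W (Fenc kA kX c.1 c.2) w *
        φ w.1 (c.1.2 (dec c.1 c.2 w.2.1 w.2.2.2.2.1)) w.2.1 ≤
      (∑ k, ((M1 : ℝ) * M2)⁻¹ * ψ (c.1.2 k) + C * ∑ a, pA a * |1 - Phat kA c.1 a / pA a|) +
      C * ∑ k, ((M1 : ℝ) * M2)⁻¹ * ∑ b, ∑ y, (L : ℝ)⁻¹ * ∑ l,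
        (if dec c.1 c.2 b y = k then 0 else kb (c.1.2 k) b * ky (c.2.2 (k, l)) y) := by
    intro c
    have hR := Rz_kernel hy hL c.2
    rw [os_sum1 pA kBE W (Fenc kA kX c.1 c.2) (fun a b y => φ a (c.1.2 (dec c.1 c.2 b y)) b)]
    let G : A → Fin M1 × Fin M2 → ℝ := fun a k =>
      ∑ b, m1 kBE a b * ∑ y, Rz ky c.2 k y * φ a (c.1.2 (dec c.1 c.2 b y)) b
    have e1 : ∀ a, ∑ b, m1 kBE a b * ∑ x, Fenc kA kX c.1 c.2 a x * ∑ y, m1 W x y *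
        φ a (c.1.2 (dec c.1 c.2 b y)) b = ∑ k, Kenc kA c.1 a k * G a k := by
      intro a
      have e0 : ∀ b, ∑ x, Fenc kA kX c.1 c.2 a x * ∑ y, m1 W x y *
          φ a (c.1.2 (dec c.1 c.2 b y)) b = ∑ k, Kenc kA c.1 a k * ∑ y, Rz ky c.2 k y *
          φ a (c.1.2 (dec c.1 c.2 b y)) b := fun b =>
        Fenc_sum kA kX (m1 W) c.1 c.2 a (fun y => φ a (c.1.2 (dec c.1 c.2 b y)) b)
      simp only [e0]
      simp only [G, mul_sum]
      rw [sum_comm]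
      refine sum_congr rfl fun k _ => sum_congr rfl fun b _ => sum_congr rfl fun y _ => by ring
    simp only [e1]
    have hG0 : ∀ a k, 0 ≤ G a k := fun a k => sum_nonneg fun b _ => mul_nonneg ((hB a).1 b)
      (sum_nonneg fun y _ => mul_nonneg ((hR k).1 y) (hφ0 _ _ _))
    have hGC : ∀ a k, G a k ≤ C := by
      intro a k
      calc G a k ≤ ∑ b, m1 kBE a b * ∑ y, Rz ky c.2 k y * C := sum_le_sum fun b _ =>
            mul_le_mul_of_nonneg_left (sum_le_sum fun y _ =>
              mul_le_mul_of_nonneg_left (hφ _ _ _) ((hR k).1 y)) ((hB a).1 b)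
        _ = C := by simp only [← sum_mul, (hR k).2, (hB a).2, one_mul]
    refine (real_le_ideal hp hA c.1 G C h1 h2 hG0 hGC).trans ?_
    have e2 : ∀ k, ∑ a, kA (c.1.2 k) a * G a k ≤ ψ (c.1.2 k) + C * ∑ b, ∑ y, (L : ℝ)⁻¹ * ∑ l,
        (if dec c.1 c.2 b y = k then 0 else kb (c.1.2 k) b * ky (c.2.2 (k, l)) y) := by
      intro k
      have e3 : ∑ b, ∑ y, (L : ℝ)⁻¹ * ∑ l,
        (if dec c.1 c.2 b y = k then 0 else kb (c.1.2 k) b * ky (c.2.2 (k, l)) y) =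
          ∑ a, kA (c.1.2 k) a * ∑ b, m1 kBE a b * ∑ y, Rz ky c.2 k y *
            (if dec c.1 c.2 b y = k then 0 else 1) := by
        have : ∀ b y, (L : ℝ)⁻¹ * ∑ l,
          (if dec c.1 c.2 b y = k then 0 else kb (c.1.2 k) b * ky (c.2.2 (k, l)) y) =
          kb (c.1.2 k) b * (Rz ky c.2 k y * (if dec c.1 c.2 b y = k then 0 else 1)) := by
          intro b y
          split_ifs
          · simp
          · rw [← mul_sum, Rz]; ring
        simp only [this, ← mul_sum]
        simp only [hkb, kc]
        simp only [sum_mul]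
        rw [sum_comm]
        refine sum_congr rfl fun a _ => ?_
        rw [mul_sum]
        refine sum_congr rfl fun b _ => by ring
      rw [e3, mul_sum, ← sum_add_distrib]
      refine sum_le_sum fun a _ => ?_
      rw [mul_left_comm, ← mul_add]
      refine mul_le_mul_of_nonneg_left ?_ ((hA _).1 a)
      rw [mul_sum, ← sum_add_distrib]
      refine sum_le_sum fun b _ => ?_
      rw [mul_left_comm, ← mul_add]
      refine mul_le_mul_of_nonneg_left ?_ ((hB _).1 b)
      have e4 : φ a (c.1.2 k) b = ∑ y, Rz ky c.2 k y * φ a (c.1.2 k) b := by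
        rw [← sum_mul, (hR k).2, one_mul]
      rw [e4, mul_sum, ← sum_add_distrib]
      refine sum_le_sum fun y _ => ?_
      rw [mul_left_comm, ← mul_add]
      refine mul_le_mul_of_nonneg_left ?_ ((hR _).1 y)
      split_ifs with h
      · rw [h, mul_zero, add_zero]
      · linarith [hφ a (c.1.2 (dec c.1 c.2 b y)) b, hφ0 a (c.1.2 k) b]
    have e5 : ∑ k, ((M1 : ℝ) * M2)⁻¹ * ∑ a, kA (c.1.2 k) a * G a k ≤
        ∑ k, ((M1 : ℝ) * M2)⁻¹ * ψ (c.1.2 k) +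
        C * ∑ k, ((M1 : ℝ) * M2)⁻¹ * ∑ b, ∑ y, (L : ℝ)⁻¹ * ∑ l,
        (if dec c.1 c.2 b y = k then 0 else kb (c.1.2 k) b * ky (c.2.2 (k, l)) y) := by
      rw [mul_sum, ← sum_add_distrib]
      refine sum_le_sum fun k _ => ?_
      rw [mul_left_comm, ← mul_add]
      exact mul_le_mul_of_nonneg_left (e2 k) (by positivity)
    linarith
  refine (expVal_mono hcw.1 pt).trans ?_
  rw [expVal_add, expVal_add, expVal_smul, expVal_smul]
  have f1 : expVal (cw pU kV pQ kT M1 M2 L) (fun c => ∑ k, ((M1 : ℝ) * M2)⁻¹ * ψ (c.1.2 k)) =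
      ∑ u, ∑ v, pU u * kV u v * ψ v := by
    rw [expVal_sum]
    simp only [expVal_smul]
    have : ∀ k, expVal (cw pU kV pQ kT M1 M2 L) (fun c => ψ (c.1.2 k)) = ∑ u, ∑ v, pU u * kV u v * ψ v := by
      intro k
      refine (expVal_pw_fst _ (bw_pmf hQ hT _) (fun c1 : (Fin M1 → U) × (Fin M1 × Fin M2 → V) => ψ (c1.2 k))).trans ?_
      exact bw_one hU hV Prod.fst k (fun _ v => ψ v)
    simp only [this]
    exact sum_inv_const h1 h2 _
  have f2 : expVal (cw pU kV pQ kT M1 M2 L) (fun c => ∑ a, pA a * |1 - Phat kA c.1 a / pA a|) ≤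
      2 * √(SCterm pU kV kA s M1 (M1 * M2)) := by
    refine (expVal_pw_fst _ (bw_pmf hQ hT _) (fun c1 : (Fin M1 → U) × (Fin M1 × Fin M2 → V) =>
      ∑ a, pA a * |1 - Phat kA c1 a / pA a|)).le.trans ?_
    exact soft_cover hU hV hA h1 h2 hs hs1.le
  have f3 : expVal (cw pU kV pQ kT M1 M2 L) (fun c => ∑ k, ((M1 : ℝ) * M2)⁻¹ * ∑ b, ∑ y, (L : ℝ)⁻¹ * ∑ l,
        (if dec c.1 c.2 b y = k then 0 else kb (c.1.2 k) b * ky (c.2.2 (k, l)) y)) ≤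
      DECt pU kV pQ kT kb ky s M1 M2 L := by
    rw [expVal_sum]
    simp only [expVal_smul]
    have hMp : (0 : ℝ) ≤ ((M1 : ℝ) * M2)⁻¹ := by positivity
    refine le_trans (sum_le_sum fun k _ => mul_le_mul_of_nonneg_left (c := DECt pU kV pQ kT kb ky s M1 M2 L) ?_ hMp)
      (sum_inv_const h1 h2 _).le
    rw [expVal_sum]
    refine sum_le_sum fun b _ => ?_
    rw [expVal_sum]
    refine sum_le_sum fun y _ => ?_
    rw [expVal_smul, expVal_sum]
    rw [inv_mul_le_iff₀ hL']
    have key : ∀ l : Fin L, expVal (cw pU kV pQ kT M1 M2 L) (fun c =>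
        (if dec c.1 c.2 b y = k then 0 else kb (c.1.2 k) b * ky (c.2.2 (k, l)) y)) ≤
        ∑ u, ∑ v, pU u * kV u v * ∑ q, ∑ t, pQ q * kT q t *
      ((kb v b * ky t y) ^ (1 - s) *
        (((M1 * M2 * L) * (pc pU (kc kV kb) b * pc pQ (kc kT ky) y)) ^ s +
          (((M2 : ℝ) - 1) * L * (kc kV kb u b * kc kT ky q y)) ^ s)) := by
      intro l
      have h5 := decode_fixed hU hV hQ hT hb hy b y k l hs hs1 (fun c1 c2 => dec c1 c2 b y)
        (fun c1 c2 k' => hdec c1 c2 b y k')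
      refine le_trans (le_of_eq ?_) h5
      exact expVal_pw _ _ (fun c : ((Fin M1 → U) × (Fin M1 × Fin M2 → V)) × ((Fin M1 → Q) × ((Fin M1 × Fin M2) × Fin L → T)) =>
        (if dec c.1 c.2 b y = k then 0 else kb (c.1.2 k) b * ky (c.2.2 (k, l)) y))
    refine (sum_le_sum fun l _ => key l).trans (le_of_eq ?_)
    rw [sum_const, card_univ, Fintype.card_fin, nsmul_eq_mul]
  rw [f1]
  have := mul_le_mul_of_nonneg_left f2 hC
  have := mul_le_mul_of_nonneg_left f3 hC
  linarith
end
end part5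

section part6
/-! ### One-shot code: equivocation -/

lemma sum_cyc {α β γ : Type} [Fintype α] [Fintype β] [Fintype γ] (G : α → β → γ → ℝ) :
    ∑ e, ∑ z, ∑ a, G e z a = ∑ a, ∑ e, ∑ z, G e z a := by
  have : ∀ e, ∑ z, ∑ a, G e z a = ∑ a, ∑ z, G e z a := fun y => sum_comm
  simp only [this]
  rw [sum_comm]

lemma gibbs {A E Z K I : Type} [Fintype A] [Fintype E] [Fintype Z] [Fintype K] [Fintype I]
    {pAE : A → E → ℝ} {κ : A → K → ℝ} {R : K → Z → ℝ} (π : K → I) {q : I → E → Z → ℝ}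
    (hp : ∀ a e, 0 ≤ pAE a e) (hp1 : ∑ a, ∑ e, pAE a e = 1) (hκ : IsKernel κ) (hR : IsKernel R)
    (hq : ∀ i e z, 0 < q i e z) (hq1 : ∑ e, ∑ z, ∑ i, q i e z ≤ 1)
    (P2 : A → E → Z → ℝ) (hP2 : ∀ a e z, P2 a e z = pAE a e * ∑ k, κ a k * R k z)
    (PEZ : E → Z → ℝ) (hPEZ : ∀ e z, PEZ e z = ∑ a, P2 a e z) :
    ∑ a, ∑ e, ∑ z, ∑ k, pAE a e * κ a k * R k z *
      (Real.log (q (π k) e z) - Real.log (pAE a e) - Real.log (R k z)) ≤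
    ∑ a, ∑ e, ∑ z, P2 a e z * (Real.log (PEZ e z) - Real.log (P2 a e z)) := by
  classical
  have hP20 : ∀ a e z, 0 ≤ P2 a e z := fun a e z => by
    rw [hP2]; exact mul_nonneg (hp _ _) (sum_nonneg fun k _ => mul_nonneg ((hκ a).1 k) ((hR k).1 z))
  have hPEZ0 : ∀ e z, 0 ≤ PEZ e z := fun e z => by
    rw [hPEZ]; exact sum_nonneg fun a _ => hP20 a e z
  have hP2' : ∀ a e z, P2 a e z = ∑ k, pAE a e * κ a k * R k z := fun a e z => by
    rw [hP2, mul_sum]; exact sum_congr rfl fun k _ => by ring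
  have pt : ∀ a e z k, pAE a e * κ a k * R k z *
      (Real.log (q (π k) e z) - Real.log (pAE a e) - Real.log (R k z)) ≤
      pAE a e * κ a k * R k z * (Real.log (PEZ e z) - Real.log (P2 a e z)) +
      (κ a k * q (π k) e z * (P2 a e z / PEZ e z) - pAE a e * κ a k * R k z) := by
    intro a e z k
    have hj : 0 ≤ pAE a e * κ a k * R k z := mul_nonneg (mul_nonneg (hp _ _) ((hκ a).1 k)) ((hR k).1 z)
    rcases hj.eq_or_lt with h0 | h0
    · rw [← h0]
      have : 0 ≤ κ a k * q (π k) e z * (P2 a e z / PEZ e z) :=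
        mul_nonneg (mul_nonneg ((hκ a).1 k) (hq _ _ _).le) (div_nonneg (hP20 _ _ _) (hPEZ0 _ _))
      linarith
    · have h1 : 0 < P2 a e z := by
        refine h0.trans_le ?_
        rw [hP2']
        exact single_le_sum (f := fun k => pAE a e * κ a k * R k z)
          (fun k _ => mul_nonneg (mul_nonneg (hp _ _) ((hκ a).1 k)) ((hR k).1 z)) (mem_univ k)
      have h2 : 0 < PEZ e z := by
        refine h1.trans_le ?_
        rw [hPEZ]
        exact single_le_sum (f := fun a => P2 a e z) (fun a _ => hP20 a e z) (mem_univ a)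
      have ha : 0 < pAE a e := (hp a e).lt_of_ne (fun h => by rw [← h] at h0; simp at h0)
      have hk : 0 < κ a k := ((hκ a).1 k).lt_of_ne (fun h => by rw [← h] at h0; simp at h0)
      have hr : 0 < R k z := ((hR k).1 z).lt_of_ne (fun h => by rw [← h] at h0; simp at h0)
      have hqq := hq (π k) e z
      have h3 := Real.log_le_sub_one_of_pos
        (show 0 < q (π k) e z * P2 a e z / (pAE a e * R k z * PEZ e z) by positivity)
      rw [Real.log_div (by positivity) (by positivity), Real.log_mul hqq.ne' h1.ne',
        Real.log_mul (by positivity) h2.ne', Real.log_mul ha.ne' hr.ne'] at h3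
      have h4 := mul_le_mul_of_nonneg_left h3 h0.le
      have h5 : pAE a e * κ a k * R k z * (q (π k) e z * P2 a e z / (pAE a e * R k z * PEZ e z) - 1) =
          κ a k * q (π k) e z * (P2 a e z / PEZ e z) - pAE a e * κ a k * R k z := by
        field_simp
      rw [h5] at h4
      linarith
  have step : ∀ a e z, ∑ k, pAE a e * κ a k * R k z *
      (Real.log (q (π k) e z) - Real.log (pAE a e) - Real.log (R k z)) ≤
      P2 a e z * (Real.log (PEZ e z) - Real.log (P2 a e z)) +
      ((∑ i, q i e z) * (P2 a e z / PEZ e z) - P2 a e z) := by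
    intro a e z
    refine (sum_le_sum fun k _ => pt a e z k).trans ?_
    rw [sum_add_distrib, sum_sub_distrib, ← sum_mul, ← sum_mul, ← hP2']
    have : ∑ k, κ a k * q (π k) e z ≤ ∑ i, q i e z := by
      calc _ ≤ ∑ k, κ a k * ∑ i, q i e z := sum_le_sum fun k _ => mul_le_mul_of_nonneg_left
            (single_le_sum (f := fun i => q i e z) (fun i _ => (hq i e z).le) (mem_univ (π k))) ((hκ a).1 k)
        _ = _ := by rw [← sum_mul, (hκ a).2, one_mul]
    have := mul_le_mul_of_nonneg_right this (div_nonneg (hP20 a e z) (hPEZ0 e z))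
    linarith
  have tot : ∑ a, ∑ e, ∑ z, ((∑ i, q i e z) * (P2 a e z / PEZ e z) - P2 a e z) ≤ 0 := by
    simp only [sum_sub_distrib]
    have t1 : ∑ a, ∑ e, ∑ z, P2 a e z = 1 := by
      rw [← hp1]
      refine sum_congr rfl fun a _ => sum_congr rfl fun e _ => ?_
      simp only [hP2, ← mul_sum]
      rw [sum_comm]
      simp only [← mul_sum, (hR _).2, mul_one, (hκ a).2]
    have t2 : ∑ a, ∑ e, ∑ z, (∑ i, q i e z) * (P2 a e z / PEZ e z) ≤ ∑ e, ∑ z, ∑ i, q i e z := by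
      rw [sum_comm]
      refine sum_le_sum fun e _ => ?_
      rw [sum_comm]
      refine sum_le_sum fun z _ => ?_
      rw [← mul_sum, ← sum_div, ← hPEZ]
      exact mul_le_of_le_one_right (sum_nonneg fun i _ => (hq i e z).le) (div_self_le_one _)
    linarith
  have := sum_le_sum fun a (_ : a ∈ univ) => sum_le_sum fun e (_ : e ∈ univ) =>
    sum_le_sum fun z (_ : z ∈ univ) => step a e z
  simp only [sum_add_distrib] at this
  linarith

section
variable {A B E X Y Z : Type} [Fintype A] [Fintype B] [Fintype E]
  [Fintype X] [Fintype Y] [Fintype Z]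
variable {M1 M2 L : ℕ} {U V Q T : Type} [Fintype U] [Fintype V] [Fintype Q] [Fintype T]

lemma os_condH (pA : A → ℝ) (kBE : A → B × E → ℝ) (W : X → Y × Z → ℝ) (F : A → X → ℝ)
    (P2 : A → E → Z → ℝ) (hP2 : ∀ a e z, P2 a e z = pA a * m2 kBE a e * ∑ x, F a x * m2 W x z) :
    condH (osJoint (fun w : A × B × E => pA w.1 * kBE w.1 w.2) W F) (fun w => w.1)
      (fun w => (w.2.2.1, w.2.2.2.2.2)) * Real.log 2 =
    ∑ a, ∑ e, ∑ z, P2 a e z * (Real.log (∑ a, P2 a e z) - Real.log (P2 a e z)) := by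
  have s2 : ∀ φ : A → E → Z → ℝ,
      ∑ w, osJoint (fun w : A × B × E => pA w.1 * kBE w.1 w.2) W F w * φ w.1 w.2.2.1 w.2.2.2.2.2 =
      ∑ a, ∑ e, ∑ z, P2 a e z * φ a e z := by
    intro φ
    rw [os_sum2]
    simp only [hP2, mul_sum, sum_mul]
    refine sum_congr rfl fun a _ => sum_congr rfl fun e _ => ?_
    rw [sum_comm]
    refine sum_congr rfl fun z _ => sum_congr rfl fun x _ => by ring
  have e1 : pushf (osJoint (fun w : A × B × E => pA w.1 * kBE w.1 w.2) W F)
      (fun w => (w.1, (w.2.2.1, w.2.2.2.2.2))) = fun x : A × E × Z => P2 x.1 x.2.1 x.2.2 := by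
    refine pushf_eq _ _ _ fun g => ?_
    refine Eq.trans ?_ (s2 (fun a e z => g (a, (e, z)))).symm
    simp only [Fintype.sum_prod_type]
  have e2 : pushf (osJoint (fun w : A × B × E => pA w.1 * kBE w.1 w.2) W F)
      (fun w => (w.2.2.1, w.2.2.2.2.2)) = fun x : E × Z => ∑ a, P2 a x.1 x.2 := by
    refine pushf_eq _ _ _ fun g => ?_
    refine Eq.trans ?_ (s2 (fun a e z => g (e, z))).symm
    simp only [Fintype.sum_prod_type, sum_mul]
    exact sum_cyc _
  unfold condH Hof
  rw [sub_mul, entropy_log, entropy_log, e1, e2]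
  simp only [Fintype.sum_prod_type, mul_sub, sum_sub_distrib, sum_mul]
  have : ∑ e, ∑ z, ∑ a, P2 a e z * Real.log (∑ a, P2 a e z) =
      ∑ a, ∑ e, ∑ z, P2 a e z * Real.log (∑ a, P2 a e z) := by
    exact sum_cyc _
  rw [this]
  ring

/-- leakage term -/
noncomputable def LKt (pQ : Q → ℝ) (kT : Q → T → ℝ) (kz : T → Z → ℝ) (s : ℝ) (L : ℕ) : ℝ :=
  ∑ z, ∑ q, ∑ t, pQ q * kT q t * (kz t z * (- Real.log L + Real.log (kz t z) +
      (((L : ℝ) - 1) * (kc kT kz q z / kz t z)) ^ s / s))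

lemma four_sum {K : Type} [Fintype K] (pA : A → ℝ) (kE : A → E → ℝ) (κ : A → K → ℝ) (R : K → Z → ℝ)
    (f : A → E → K → Z → ℝ) :
    ∑ a, ∑ e, ∑ z, ∑ k, pA a * kE a e * κ a k * R k z * f a e k z =
    ∑ a, pA a * ∑ k, κ a k * ∑ e, kE a e * ∑ z, R k z * f a e k z := by
  simp only [mul_sum]
  refine sum_congr rfl fun a _ => ?_
  rw [sum_cyc]
  exact sum_congr rfl fun k _ => sum_congr rfl fun e _ => sum_congr rfl fun z _ => by ring

lemma avg_c2 {pU : U → ℝ} {kV : U → V → ℝ} {kA : V → A → ℝ} {pQ : Q → ℝ} {kT : Q → T → ℝ} {pA : A → ℝ}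
    (hU : IsPMF pU) (hV : IsKernel kV) (hA : IsKernel kA) (hpA : IsPMF pA)
    (h1 : 0 < M1) (h2 : 0 < M2)
    (H : (Fin M1 → Q) × ((Fin M1 × Fin M2) × Fin L → T) → Fin M1 × Fin M2 → ℝ) (r : ℝ)
    (hH : ∀ k, ∑ c2, bw pQ kT pr2 c2 * H c2 k ≤ r) :
    expVal (cw pU kV pQ kT M1 M2 L) (fun c => ∑ a, pA a * ∑ k, Kenc kA c.1 a k * H c.2 k) ≤ r := by
  have hb := bw_pmf (K := Fin M1 × Fin M2) (I := Fin M1) hU hV Prod.fst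
  have hin : ∀ c1 : (Fin M1 → U) × (Fin M1 × Fin M2 → V),
      ∑ c2, bw pQ kT pr2 c2 * ∑ a, pA a * ∑ k, Kenc kA c1 a k * H c2 k ≤ r := by
    intro c1
    have hK := Kenc_kernel hA h1 h2 c1
    have e : ∑ c2, bw pQ kT pr2 c2 * ∑ a, pA a * ∑ k, Kenc kA c1 a k * H c2 k =
        ∑ a, pA a * ∑ k, Kenc kA c1 a k * ∑ c2, bw pQ kT pr2 c2 * H c2 k := by
      simp only [mul_sum]
      rw [← sum_cyc]
      refine sum_congr rfl fun a _ => sum_congr rfl fun k _ => sum_congr rfl fun c _ => by ring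
    rw [e]
    calc _ ≤ ∑ a, pA a * ∑ k, Kenc kA c1 a k * r := sum_le_sum fun a _ =>
          mul_le_mul_of_nonneg_left (sum_le_sum fun k _ => mul_le_mul_of_nonneg_left (hH k) ((hK a).1 k))
            (hpA.1 a)
      _ = r := by simp only [← sum_mul, (hK _).2, hpA.2, one_mul]
  refine (expVal_pw _ _ _).le.trans ?_
  calc _ ≤ ∑ c1, bw pU kV (Prod.fst : Fin M1 × Fin M2 → Fin M1) c1 * r :=
        sum_le_sum fun c1 _ => mul_le_mul_of_nonneg_left (hin c1) (hb.1 c1)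
    _ = r := by rw [← sum_mul, hb.2, one_mul]

theorem oneshot_equiv {pU : U → ℝ} {kV : U → V → ℝ} {kA : V → A → ℝ} {pQ : Q → ℝ} {kT : Q → T → ℝ}
    {kX : T → X → ℝ} {kBE : A → B × E → ℝ} {W : X → Y × Z → ℝ}
    (hU : IsPMF pU) (hV : IsKernel kV) (hA : IsKernel kA) (hQ : IsPMF pQ) (hT : IsKernel kT)
    (hX : IsKernel kX) (hBE : IsKernel kBE) (hW : IsKernel W)
    (h1 : 0 < M1) (h2 : 0 < M2) (hL : 0 < L) {s : ℝ} (hs : 0 < s) (hs1 : s < 1)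
    (pe : U → E → ℝ) (pz : Q → Z → ℝ) (hpe : ∀ u e, 0 < pe u e) (hpe1 : ∀ u, ∑ e, pe u e ≤ 1)
    (hpz : ∀ q z, 0 < pz q z) (hpz1 : ∀ q, ∑ z, pz q z ≤ 1) (CE : ℝ)
    (hCE : ∀ u e, - Real.log (pe u e) ≤ CE) (hCE0 : 0 ≤ CE) :
    - ∑ a, ∑ e, (pc pU (kc kV kA) a * m2 kBE a e) * Real.log (pc pU (kc kV kA) a * m2 kBE a e)
      - Real.log M1 - ∑ u, ∑ v, pU u * kV u v * ∑ a, kA v a * ∑ e, m2 kBE a e * (- Real.log (pe u e))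
      - CE * (2 * √(SCterm pU kV kA s M1 (M1 * M2)))
      - ∑ q, ∑ t, pQ q * kT q t * ∑ z, kc kX (m2 W) t z * (- Real.log (pz q z))
      - LKt pQ kT (kc kX (m2 W)) s L ≤
    expVal (cw pU kV pQ kT M1 M2 L) (fun c => 
      condH (osJoint (fun w : A × B × E => pc pU (kc kV kA) w.1 * kBE w.1 w.2) W (Fenc kA kX c.1 c.2))
       (fun w => w.1) (fun w => (w.2.2.1, w.2.2.2.2.2)) * Real.log 2) := by
  classical
  set kz := kc kX (m2 W) with hkz
  set pA := pc pU (kc kV kA) with hpA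
  have hp : IsPMF pA := pc_pmf hU (kc_kernel hV hA)
  have hz : IsKernel kz := kc_kernel hX (m2_kernel hW)
  have hE := m2_kernel hBE
  have hcw : IsPMF (cw pU kV pQ kT M1 M2 L) := cw_pmf hU hV hQ hT
  have hL' : (0 : ℝ) < L := by exact_mod_cast hL
  have hM1 : (0 : ℝ) < M1 := by exact_mod_cast h1
  have hnl : ∀ u e, 0 ≤ - Real.log (pe u e) := fun u e => by
    have : pe u e ≤ 1 := (single_le_sum (f := fun e => pe u e) (fun e _ => (hpe u e).le) (mem_univ e)).trans (hpe1 u)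
    linarith [Real.log_nonpos (hpe u e).le this]
  set HAE := - ∑ a, ∑ e, (pA a * m2 kBE a e) * Real.log (pA a * m2 kBE a e) with hHAE
  have pt : ∀ c : ((Fin M1 → U) × (Fin M1 × Fin M2 → V)) × ((Fin M1 → Q) × ((Fin M1 × Fin M2) × Fin L → T)),
      HAE - Real.log M1 - (∑ k, ((M1 : ℝ) * M2)⁻¹ * ∑ a, kA (c.1.2 k) a * ∑ e, m2 kBE a e * (- Real.log (pe (c.1.1 k.1) e)))
      - CE * (∑ a, pA a * |1 - Phat kA c.1 a / pA a|)
      - (∑ a, pA a * ∑ k, Kenc kA c.1 a k * ∑ z, Rz kz c.2 k z * (- Real.log (pz (c.2.1 k.1) z)))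
      - (∑ a, pA a * ∑ k, Kenc kA c.1 a k * ∑ z, Rz kz c.2 k z * Real.log (Rz kz c.2 k z)) ≤
      condH (osJoint (fun w : A × B × E => pA w.1 * kBE w.1 w.2) W (Fenc kA kX c.1 c.2))
       (fun w => w.1) (fun w => (w.2.2.1, w.2.2.2.2.2)) * Real.log 2 := by
    intro c
    have hR := Rz_kernel hz hL c.2
    have hK := Kenc_kernel hA h1 h2 c.1
    rw [os_condH pA kBE W (Fenc kA kX c.1 c.2)
      (fun a e z => pA a * m2 kBE a e * ∑ k, Kenc kA c.1 a k * Rz kz c.2 k z) (by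
        intro a e z
        congr 1
        have := Fenc_sum kA kX (m2 W) c.1 c.2 a (fun z' => if z' = z then 1 else 0)
        simp only [mul_ite, mul_one, mul_zero, sum_ite_eq', mem_univ, if_true] at this
        exact this.symm)]
    refine le_trans ?_ (gibbs (pAE := fun a e => pA a * m2 kBE a e) (κ := Kenc kA c.1) (R := Rz kz c.2) Prod.fst
      (q := fun i e z => (M1 : ℝ)⁻¹ * (pe (c.1.1 i) e * pz (c.2.1 i) z))
      (fun a e => mul_nonneg (hp.1 a) ((hE a).1 e)) ?_ hK hR
      (fun i e z => mul_pos (by positivity) (mul_pos (hpe _ _) (hpz _ _))) ?_ _ (fun _ _ _ => rfl) _ (fun _ _ => rfl))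
    · have e1 : ∀ k e z, Real.log ((M1 : ℝ)⁻¹ * (pe (c.1.1 k) e * pz (c.2.1 k) z)) =
          - Real.log M1 + Real.log (pe (c.1.1 k) e) + Real.log (pz (c.2.1 k) z) := by
        intro k e z
        rw [Real.log_mul (by positivity) (mul_pos (hpe _ _) (hpz _ _)).ne',
          Real.log_mul (hpe _ _).ne' (hpz _ _).ne', Real.log_inv]; ring
      simp only [e1]
      rw [four_sum pA (m2 kBE) (Kenc kA c.1) (Rz kz c.2) (fun a e k z =>
        - Real.log M1 + Real.log (pe (c.1.1 k.1) e) + Real.log (pz (c.2.1 k.1) z)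
        - Real.log (pA a * m2 kBE a e) - Real.log (Rz kz c.2 k z))]
      have e2 : ∀ a, pA a * ∑ k, Kenc kA c.1 a k * ∑ e, m2 kBE a e * ∑ z, Rz kz c.2 k z *
          (- Real.log M1 + Real.log (pe (c.1.1 k.1) e) + Real.log (pz (c.2.1 k.1) z)
        - Real.log (pA a * m2 kBE a e) - Real.log (Rz kz c.2 k z)) =
          pA a * (- Real.log M1) - ∑ e, (pA a * m2 kBE a e) * Real.log (pA a * m2 kBE a e)
          - pA a * (∑ k, Kenc kA c.1 a k * ∑ e, m2 kBE a e * (- Real.log (pe (c.1.1 k.1) e)))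
          - pA a * (∑ k, Kenc kA c.1 a k * ∑ z, Rz kz c.2 k z * (- Real.log (pz (c.2.1 k.1) z)))
          - pA a * (∑ k, Kenc kA c.1 a k * ∑ z, Rz kz c.2 k z * Real.log (Rz kz c.2 k z)) := by
        intro a
        have e3 : ∀ k e, ∑ z, Rz kz c.2 k z *
          (- Real.log M1 + Real.log (pe (c.1.1 k.1) e) + Real.log (pz (c.2.1 k.1) z)
            - Real.log (pA a * m2 kBE a e) - Real.log (Rz kz c.2 k z)) =
            - Real.log M1 - (- Real.log (pe (c.1.1 k.1) e)) - Real.log (pA a * m2 kBE a e)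
            - ((∑ z, Rz kz c.2 k z * (- Real.log (pz (c.2.1 k.1) z))) +
             ∑ z, Rz kz c.2 k z * Real.log (Rz kz c.2 k z)) := by
          intro k e
          simp only [mul_sub, mul_add, sum_sub_distrib, sum_add_distrib, ← sum_mul, (hR k).2, mul_neg,
            sum_neg_distrib, one_mul]
          ring
        simp only [e3]
        have e4 : ∀ k, ∑ e, m2 kBE a e * (- Real.log M1 - (- Real.log (pe (c.1.1 k.1) e)) - Real.log (pA a * m2 kBE a e)
            - ((∑ z, Rz kz c.2 k z * (- Real.log (pz (c.2.1 k.1) z))) +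
             ∑ z, Rz kz c.2 k z * Real.log (Rz kz c.2 k z))) =
            - Real.log M1 - ∑ e, m2 kBE a e * Real.log (pA a * m2 kBE a e)
            - ∑ e, m2 kBE a e * (- Real.log (pe (c.1.1 k.1) e))
            - ((∑ z, Rz kz c.2 k z * (- Real.log (pz (c.2.1 k.1) z))) +
             ∑ z, Rz kz c.2 k z * Real.log (Rz kz c.2 k z)) := by
          intro k
          generalize (∑ z, Rz kz c.2 k z * (- Real.log (pz (c.2.1 k.1) z))) = g1
          generalize (∑ z, Rz kz c.2 k z * Real.log (Rz kz c.2 k z)) = g2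
          simp only [mul_sub, sum_sub_distrib, ← sum_mul, (hE a).2, one_mul]
          ring
        simp only [e4]
        have e5 : ∑ e, (pA a * m2 kBE a e) * Real.log (pA a * m2 kBE a e) =
          pA a * ∑ e, m2 kBE a e * Real.log (pA a * m2 kBE a e) := by
          rw [mul_sum]; exact sum_congr rfl fun e _ => by ring
        rw [e5]
        generalize ∑ e, m2 kBE a e * Real.log (pA a * m2 kBE a e) = g0
        simp only [mul_sub, mul_add, sum_sub_distrib, sum_add_distrib, ← sum_mul, (hK a).2, one_mul]
        ring
      simp only [e2, sum_sub_distrib, ← sum_mul, hp.2, one_mul]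
      have e6 := real_le_ideal hp hA c.1 (fun a k => ∑ e, m2 kBE a e * (- Real.log (pe (c.1.1 k.1) e))) CE h1 h2
        (fun a k => sum_nonneg fun e _ => mul_nonneg ((hE a).1 e) (hnl _ _))
        (fun a k => by
          calc _ ≤ ∑ e, m2 kBE a e * CE := sum_le_sum fun e _ => mul_le_mul_of_nonneg_left (hCE _ _) ((hE a).1 e)
            _ = CE := by rw [← sum_mul, (hE a).2, one_mul])
      linarith
    · simp only [← mul_sum, (hE _).2, mul_one, hp.2]
    · calc ∑ e, ∑ z, ∑ i, (M1 : ℝ)⁻¹ * (pe (c.1.1 i) e * pz (c.2.1 i) z) =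
          ∑ i, (M1 : ℝ)⁻¹ * ((∑ e, pe (c.1.1 i) e) * ∑ z, pz (c.2.1 i) z) := by
            rw [sum_cyc]
            refine sum_congr rfl fun i _ => ?_
            simp only [← mul_sum, ← sum_mul]
        _ ≤ ∑ i : Fin M1, (M1 : ℝ)⁻¹ * 1 := sum_le_sum fun i _ => mul_le_mul_of_nonneg_left
            (mul_le_one₀ (hpe1 _) (sum_nonneg fun z _ => (hpz _ z).le) (hpz1 _)) (by positivity)
        _ = 1 := by
            rw [sum_const, card_univ, Fintype.card_fin, nsmul_eq_mul, mul_one, mul_inv_cancel₀ hM1.ne']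
  refine le_trans ?_ (expVal_mono hcw.1 pt)
  rw [expVal_sub, expVal_sub, expVal_sub, expVal_sub, expVal_const hcw, expVal_smul]
  have f1 : expVal (cw pU kV pQ kT M1 M2 L) (fun c => ∑ k, ((M1 : ℝ) * M2)⁻¹ *
        ∑ a, kA (c.1.2 k) a * ∑ e, m2 kBE a e * (- Real.log (pe (c.1.1 k.1) e))) =
      ∑ u, ∑ v, pU u * kV u v * ∑ a, kA v a * ∑ e, m2 kBE a e * (- Real.log (pe u e)) := by
    rw [expVal_sum]
    simp only [expVal_smul]
    have : ∀ k, expVal (cw pU kV pQ kT M1 M2 L) (fun c => 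
        ∑ a, kA (c.1.2 k) a * ∑ e, m2 kBE a e * (- Real.log (pe (c.1.1 k.1) e))) =
        ∑ u, ∑ v, pU u * kV u v * ∑ a, kA v a * ∑ e, m2 kBE a e * (- Real.log (pe u e)) := by
      intro k
      refine (expVal_pw_fst _ (bw_pmf hQ hT _) (fun c1 : (Fin M1 → U) × (Fin M1 × Fin M2 → V) =>
        ∑ a, kA (c1.2 k) a * ∑ e, m2 kBE a e * (- Real.log (pe (c1.1 k.1) e)))).trans ?_
      exact bw_one hU hV Prod.fst k (fun u v => ∑ a, kA v a * ∑ e, m2 kBE a e * (- Real.log (pe u e)))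
    simp only [this]
    exact sum_inv_const h1 h2 _
  have f2 : expVal (cw pU kV pQ kT M1 M2 L) (fun c => ∑ a, pA a * |1 - Phat kA c.1 a / pA a|) ≤
      2 * √(SCterm pU kV kA s M1 (M1 * M2)) := by
    refine (expVal_pw_fst _ (bw_pmf hQ hT _) (fun c1 : (Fin M1 → U) × (Fin M1 × Fin M2 → V) =>
      ∑ a, pA a * |1 - Phat kA c1 a / pA a|)).le.trans ?_
    exact soft_cover hU hV hA h1 h2 hs hs1.le
  have lavg : ∀ r : ℝ, (L : ℝ)⁻¹ * ∑ _l : Fin L, r = r := fun r => by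
    rw [sum_const, card_univ, Fintype.card_fin, nsmul_eq_mul, inv_mul_cancel_left₀ hL'.ne']
  have f3 : expVal (cw pU kV pQ kT M1 M2 L) (fun c => ∑ a, pA a * ∑ k, Kenc kA c.1 a k *
        ∑ z, Rz kz c.2 k z * (- Real.log (pz (c.2.1 k.1) z))) ≤
      ∑ q, ∑ t, pQ q * kT q t * ∑ z, kz t z * (- Real.log (pz q z)) := by
    refine avg_c2 hU hV hA hp h1 h2 (fun c2 k => ∑ z, Rz kz c2 k z * (- Real.log (pz (c2.1 k.1) z))) _ fun k => ?_
    have e : ∀ c2 : (Fin M1 → Q) × ((Fin M1 × Fin M2) × Fin L → T),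
      bw pQ kT pr2 c2 * ∑ z, Rz kz c2 k z * (- Real.log (pz (c2.1 k.1) z)) =
      (L : ℝ)⁻¹ * ∑ l, bw pQ kT pr2 c2 * ∑ z, kz (c2.2 (k, l)) z * (- Real.log (pz (c2.1 k.1) z)) := by
      intro c2
      rw [← mul_sum, mul_left_comm]
      congr 1
      rw [sum_comm, mul_sum]
      refine sum_congr rfl fun z _ => ?_
      rw [← sum_mul, Rz]; ring
    simp only [e]
    rw [← mul_sum, sum_comm]
    have e' : ∀ l : Fin L, ∑ c2, bw pQ kT pr2 c2 * ∑ z, kz (c2.2 (k, l)) z * (- Real.log (pz (c2.1 k.1) z)) =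
        ∑ q, ∑ t, pQ q * kT q t * ∑ z, kz t z * (- Real.log (pz q z)) := fun l =>
      bw_one hQ hT pr2 (k, l) (fun q t => ∑ z, kz t z * (- Real.log (pz q z)))
    simp only [e']
    exact (lavg _).le
  have f4 : expVal (cw pU kV pQ kT M1 M2 L) (fun c => ∑ a, pA a * ∑ k, Kenc kA c.1 a k *
        ∑ z, Rz kz c.2 k z * Real.log (Rz kz c.2 k z)) ≤ LKt pQ kT kz s L := by
    refine avg_c2 hU hV hA hp h1 h2 (fun c2 k => ∑ z, Rz kz c2 k z * Real.log (Rz kz c2 k z)) _ fun k => ?_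
    have e : ∀ c2 : (Fin M1 → Q) × ((Fin M1 × Fin M2) × Fin L → T),
      bw pQ kT pr2 c2 * ∑ z, Rz kz c2 k z * Real.log (Rz kz c2 k z) =
      (L : ℝ)⁻¹ * ∑ l, ∑ z, bw pQ kT pr2 c2 * (kz (c2.2 (k, l)) z * Real.log (Rz kz c2 k z)) := by
      intro c2
      simp only [← mul_sum]
      rw [mul_left_comm]
      congr 1
      rw [sum_comm, mul_sum]
      refine sum_congr rfl fun z _ => ?_
      generalize Real.log (Rz kz c2 k z) = g
      rw [← sum_mul, Rz]; ring
    simp only [e]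
    rw [← mul_sum, sum_comm]
    rw [← lavg (LKt pQ kT kz s L)]
    refine mul_le_mul_of_nonneg_left (sum_le_sum fun l _ => ?_) (by positivity)
    rw [sum_comm]
    exact sum_le_sum fun z _ => leak_fixed hQ hT hz k l z hs hs1.le
  rw [f1]
  have := mul_le_mul_of_nonneg_left f2 hCE0
  linarith
end
end part6

section part7
/-! ### Product distributions -/

section
variable {α β γ δ : Type} [Fintype α] [Fintype β] [Fintype γ] [Fintype δ] {n : ℕ}

/-- product distribution -/
noncomputable def tp (n : ℕ) (p : α → ℝ) (f : Fin n → α) : ℝ := ∏ i, p (f i)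

/-- product kernel -/
noncomputable def tk (n : ℕ) (k : α → β → ℝ) (f : Fin n → α) (g : Fin n → β) : ℝ := ∏ i, k (f i) (g i)

/-- product kernel with two outputs -/
noncomputable def tk2 (n : ℕ) (k : α → β × γ → ℝ) (f : Fin n → α) (g : (Fin n → β) × (Fin n → γ)) : ℝ :=
  ∏ i, k (f i) (g.1 i, g.2 i)

lemma sum_pair (H : (Fin n → α × β) → ℝ) :
    ∑ u : Fin n → α, ∑ v : Fin n → β, H (fun i => (u i, v i)) = ∑ w, H w := by
  rw [← Fintype.sum_prod_type' (f := fun (u : Fin n → α) (v : Fin n → β) => H (fun i => (u i, v i)))]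
  exact Fintype.sum_equiv (Equiv.arrowProdEquivProdArrow (Fin n) (fun _ => α) (fun _ => β)).symm _ _ (fun x => rfl)

lemma mom2 (f : α → β → ℝ) : ∑ u : Fin n → α, ∑ v : Fin n → β, ∏ i, f (u i) (v i) =
    (∑ a, ∑ b, f a b) ^ n := by
  rw [sum_pair (fun w => ∏ i, f (w i).1 (w i).2), sum_prod_fun (fun _ (x : α × β) => f x.1 x.2)]
  simp [Fintype.sum_prod_type]

lemma mom3 (f : α → β → γ → ℝ) : ∑ u : Fin n → α, ∑ v : Fin n → β, ∑ w : Fin n → γ,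
    ∏ i, f (u i) (v i) (w i) = (∑ a, ∑ b, ∑ c, f a b c) ^ n := by
  have : ∀ u : Fin n → α, ∑ v : Fin n → β, ∑ w : Fin n → γ, ∏ i, f (u i) (v i) (w i) =
      ∑ v : Fin n → β × γ, ∏ i, f (u i) (v i).1 (v i).2 := fun u =>
    sum_pair (fun v => ∏ i, f (u i) (v i).1 (v i).2)
  simp only [this]
  rw [mom2 (fun a (b : β × γ) => f a b.1 b.2)]
  simp only [Fintype.sum_prod_type]

lemma add1 (f g : α → ℝ) (hf : ∑ a, f a = 1) :
    ∑ u : Fin n → α, (∏ i, f (u i)) * ∑ i, g (u i) = n * ∑ a, f a * g a := by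
  simp only [mul_sum]
  rw [sum_comm]
  have : ∀ i : Fin n, ∑ u : Fin n → α, (∏ i, f (u i)) * g (u i) = ∑ a, f a * g a := fun i =>
    sum_prod_one (fun _ => f) (fun _ => hf) i g
  simp only [this]
  rw [sum_const, card_univ, Fintype.card_fin, nsmul_eq_mul, mul_sum]

lemma add2 (f g : α → β → ℝ) (hf : ∑ a, ∑ b, f a b = 1) :
    ∑ u : Fin n → α, ∑ v : Fin n → β, (∏ i, f (u i) (v i)) * ∑ i, g (u i) (v i) =
      n * ∑ a, ∑ b, f a b * g a b := by
  rw [sum_pair (fun w => (∏ i, f (w i).1 (w i).2) * ∑ i, g (w i).1 (w i).2)]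
  rw [add1 (fun x : α × β => f x.1 x.2) (fun x => g x.1 x.2) (by rw [← hf, Fintype.sum_prod_type])]
  simp only [Fintype.sum_prod_type]

lemma add3 (f g : α → β → γ → ℝ) (hf : ∑ a, ∑ b, ∑ c, f a b c = 1) :
    ∑ u : Fin n → α, ∑ v : Fin n → β, ∑ w : Fin n → γ,
      (∏ i, f (u i) (v i) (w i)) * ∑ i, g (u i) (v i) (w i) =
      n * ∑ a, ∑ b, ∑ c, f a b c * g a b c := by
  have : ∀ u : Fin n → α, ∑ v : Fin n → β, ∑ w : Fin n → γ,
      (∏ i, f (u i) (v i) (w i)) * ∑ i, g (u i) (v i) (w i) =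
      ∑ v : Fin n → β × γ, (∏ i, f (u i) (v i).1 (v i).2) * ∑ i, g (u i) (v i).1 (v i).2 := fun u =>
    sum_pair (fun v => (∏ i, f (u i) (v i).1 (v i).2) * ∑ i, g (u i) (v i).1 (v i).2)
  simp only [this]
  rw [add2 (fun a (b : β × γ) => f a b.1 b.2) (fun a (b : β × γ) => g a b.1 b.2)
    (by simpa only [Fintype.sum_prod_type] using hf)]
  simp only [Fintype.sum_prod_type]

lemma add4 (f g : α → β → γ → δ → ℝ) (hf : ∑ a, ∑ b, ∑ c, ∑ d, f a b c d = 1) :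
    ∑ u : Fin n → α, ∑ v : Fin n → β, ∑ w : Fin n → γ, ∑ x : Fin n → δ,
      (∏ i, f (u i) (v i) (w i) (x i)) * ∑ i, g (u i) (v i) (w i) (x i) =
      n * ∑ a, ∑ b, ∑ c, ∑ d, f a b c d * g a b c d := by
  have : ∀ (u : Fin n → α) (v : Fin n → β), ∑ w : Fin n → γ, ∑ x : Fin n → δ,
      (∏ i, f (u i) (v i) (w i) (x i)) * ∑ i, g (u i) (v i) (w i) (x i) =
      ∑ w : Fin n → γ × δ, (∏ i, f (u i) (v i) (w i).1 (w i).2) * ∑ i, g (u i) (v i) (w i).1 (w i).2 := fun u v =>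
    sum_pair (fun w => (∏ i, f (u i) (v i) (w i).1 (w i).2) * ∑ i, g (u i) (v i) (w i).1 (w i).2)
  simp only [this]
  rw [add3 (fun a b (c : γ × δ) => f a b c.1 c.2) (fun a b (c : γ × δ) => g a b c.1 c.2)
    (by simpa only [Fintype.sum_prod_type] using hf)]
  simp only [Fintype.sum_prod_type]

lemma tp_pmf {p : α → ℝ} (h : IsPMF p) : IsPMF (tp n p) :=
  ⟨fun f => prod_nonneg fun i _ => h.1 _, by
    unfold tp; rw [sum_prod_fun (fun _ => p)]; exact prod_eq_one fun _ _ => h.2⟩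

lemma tk_kernel {k : α → β → ℝ} (h : IsKernel k) : IsKernel (tk n k) := fun f =>
  ⟨fun g => prod_nonneg fun i _ => (h _).1 _, by
    unfold tk; rw [sum_prod_fun (fun i => k (f i))]; exact prod_eq_one fun _ _ => (h _).2⟩

lemma tk2_kernel {k : α → β × γ → ℝ} (h : IsKernel k) : IsKernel (tk2 n k) := fun f =>
  ⟨fun g => prod_nonneg fun i _ => (h _).1 _, by
    unfold tk2
    rw [Fintype.sum_prod_type]
    rw [sum_pair (fun w : Fin n → β × γ => ∏ i, k (f i) ((w i).1, (w i).2)), sum_prod_fun (fun i => k (f i))]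
    exact prod_eq_one fun _ _ => (h _).2⟩

lemma pc_tp (p : α → ℝ) (k : α → β → ℝ) : pc (tp n p) (tk n k) = tp n (pc p k) := by
  funext b
  unfold pc tp tk
  simp only [← prod_mul_distrib]
  exact sum_prod_fun (fun i a => p a * k a (b i))

lemma kc_tk (k : α → β → ℝ) (l : β → γ → ℝ) : kc (tk n k) (tk n l) = tk n (kc k l) := by
  funext a c
  unfold kc tk
  simp only [← prod_mul_distrib]
  exact sum_prod_fun (fun i b => k (a i) b * l b (c i))

lemma m1_tk2 (k : α → β × γ → ℝ) : m1 (tk2 n k) = tk n (m1 k) := by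
  funext a b
  unfold m1 tk2 tk
  exact sum_prod_fun (fun i c => k (a i) (b i, c))

lemma m2_tk2 (k : α → β × γ → ℝ) : m2 (tk2 n k) = tk n (m2 k) := by
  funext a c
  unfold m2 tk2 tk
  exact sum_prod_fun (fun i b => k (a i) (b, c i))

/-- triple law -/
noncomputable def tri (p : α → ℝ) (k : α → β → ℝ) (l : β → γ → ℝ) (c : γ) (a : α) (b : β) : ℝ :=
  p a * k a b * l b c

/-- moment -/
noncomputable def Mo (p : α → ℝ) (k : α → β → ℝ) (l : β → γ → ℝ) (r : γ → α → β → ℝ) (s : ℝ) : ℝ :=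
  ∑ c, ∑ a, ∑ b, tri p k l c a b * r c a b ^ s

/-- log moment -/
noncomputable def Lo (p : α → ℝ) (k : α → β → ℝ) (l : β → γ → ℝ) (r : γ → α → β → ℝ) : ℝ :=
  ∑ c, ∑ a, ∑ b, tri p k l c a b * Real.log (r c a b)

lemma tri_nonneg {p : α → ℝ} {k : α → β → ℝ} {l : β → γ → ℝ} (hp : IsPMF p) (hk : IsKernel k)
    (hl : IsKernel l) (c : γ) (a : α) (b : β) : 0 ≤ tri p k l c a b :=
  mul_nonneg (mul_nonneg (hp.1 _) ((hk _).1 _)) ((hl _).1 _)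

lemma tri_sum {p : α → ℝ} {k : α → β → ℝ} {l : β → γ → ℝ} (hp : IsPMF p) (hk : IsKernel k)
    (hl : IsKernel l) : ∑ c, ∑ a, ∑ b, tri p k l c a b = 1 := by
  rw [← sum_cyc]
  unfold tri
  simp only [← mul_sum, (hl _).2, mul_one, (hk _).2, hp.2]

lemma Mo_tp (p : α → ℝ) (k : α → β → ℝ) (l : β → γ → ℝ) (r : γ → α → β → ℝ) (hr : ∀ c a b, 0 ≤ r c a b)
    (s : ℝ) : Mo (tp n p) (tk n k) (tk n l) (fun c a b => ∏ i, r (c i) (a i) (b i)) s = Mo p k l r s ^ n := by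
  unfold Mo
  rw [← mom3]
  refine sum_congr rfl fun c _ => sum_congr rfl fun a _ => sum_congr rfl fun b _ => ?_
  rw [prod_mul_distrib, Real.finsetProd_rpow _ _ (fun i _ => hr _ _ _)]
  unfold tri tp tk
  simp only [prod_mul_distrib]

lemma mo_bound_aux {x : ℝ} (hx : |x| ≤ 1) : Real.exp x ≤ 1 + x + x ^ 2 := by
  have := Real.abs_exp_sub_one_sub_id_le hx
  linarith [(abs_le.1 this).2]

lemma mo_bound {ι : Type} [Fintype ι] (p r : ι → ℝ) (hp : IsPMF p) (hr : ∀ i, p i ≠ 0 → 0 < r i)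
    {δ : ℝ} (hδ : 0 < δ) : ∃ s0 : ℝ, 0 < s0 ∧ ∀ s, 0 < s → s ≤ s0 →
      ∑ i, p i * r i ^ s ≤ Real.exp (s * (∑ i, p i * Real.log (r i) + δ)) := by
  set Λ : ℝ := 1 + ∑ i, |Real.log (r i)| with hΛ
  have hΛ1 : 1 ≤ Λ := by
    have : 0 ≤ ∑ i, |Real.log (r i)| := sum_nonneg fun i _ => abs_nonneg _
    linarith
  have hΛi : ∀ i, |Real.log (r i)| ≤ Λ := fun i => by
    have := single_le_sum (f := fun i => |Real.log (r i)|) (fun i _ => abs_nonneg _) (mem_univ i)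
    linarith
  refine ⟨min (1 / Λ) (δ / Λ ^ 2), by positivity, fun s hs hs0 => ?_⟩
  have hs1 : s * Λ ≤ 1 := by
    have := hs0.trans (min_le_left _ _)
    rwa [le_div_iff₀ (by positivity)] at this
  have hs2 : s * Λ ^ 2 ≤ δ := by
    have := hs0.trans (min_le_right _ _)
    rwa [le_div_iff₀ (by positivity)] at this
  have pt : ∀ i, p i * r i ^ s ≤ p i * (1 + s * Real.log (r i) + s * δ) := by
    intro i
    rcases (hp.1 i).eq_or_lt with h0 | h0
    · rw [← h0]; simp
    refine mul_le_mul_of_nonneg_left ?_ h0.le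
    rw [Real.rpow_def_of_pos (hr i h0.ne')]
    have hx : |Real.log (r i) * s| ≤ 1 := by
      rw [abs_mul, abs_of_pos hs]
      nlinarith [hΛi i]
    refine (mo_bound_aux hx).trans ?_
    have h3 : Real.log (r i) ^ 2 ≤ Λ ^ 2 := by
      rw [← sq_abs]; exact pow_le_pow_left₀ (abs_nonneg _) (hΛi i) 2
    have h4 : (Real.log (r i) * s) ^ 2 ≤ s * δ := by
      calc (Real.log (r i) * s) ^ 2 = s * (s * Real.log (r i) ^ 2) := by ring
        _ ≤ s * (s * Λ ^ 2) := by gcongr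
        _ ≤ s * δ := by gcongr
    linarith
  refine (sum_le_sum fun i _ => pt i).trans ?_
  have : ∑ i, p i * (1 + s * Real.log (r i) + s * δ) = s * (∑ i, p i * Real.log (r i) + δ) + 1 := by
    have e : ∀ i, p i * (1 + s * Real.log (r i) + s * δ) = p i * (1 + s * δ) + s * (p i * Real.log (r i)) :=
      fun i => by ring
    simp only [e, sum_add_distrib, ← sum_mul, ← mul_sum, hp.2]
    ring
  rw [this]
  exact Real.add_one_le_exp _

lemma Mo_bound {p : α → ℝ} {k : α → β → ℝ} {l : β → γ → ℝ} (hp : IsPMF p) (hk : IsKernel k)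
    (hl : IsKernel l) (r : γ → α → β → ℝ) (hr : ∀ c a b, tri p k l c a b ≠ 0 → 0 < r c a b)
    {δ : ℝ} (hδ : 0 < δ) : ∃ s0 : ℝ, 0 < s0 ∧ ∀ s, 0 < s → s ≤ s0 →
      Mo p k l r s ≤ Real.exp (s * (Lo p k l r + δ)) := by
  obtain ⟨s0, h0, h⟩ := mo_bound (fun x : γ × α × β => tri p k l x.1 x.2.1 x.2.2)
    (fun x => r x.1 x.2.1 x.2.2) ⟨fun x => tri_nonneg hp hk hl _ _ _, by
      simp only [Fintype.sum_prod_type]; exact tri_sum hp hk hl⟩ (fun x hx => hr _ _ _ hx) hδ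
  refine ⟨s0, h0, fun s hs hs' => ?_⟩
  have := h s hs hs'
  simp only [Fintype.sum_prod_type] at this
  exact this
end
end part7

section part8
/-! ### Exponential bounds -/

section
variable {α β γ : Type} [Fintype α] [Fintype β] [Fintype γ] {n : ℕ}

/-- ratio `l / p` -/
noncomputable def rlp (p : α → ℝ) (k : α → β → ℝ) (l : β → γ → ℝ) (c : γ) (_a : α) (b : β) : ℝ :=
  l b c / pc p (kc k l) c
/-- ratio `kl / p` -/
noncomputable def rkp (p : α → ℝ) (k : α → β → ℝ) (l : β → γ → ℝ) (c : γ) (a : α) (_b : β) : ℝ :=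
  kc k l a c / pc p (kc k l) c
/-- ratio `p / l` -/
noncomputable def rpl (p : α → ℝ) (k : α → β → ℝ) (l : β → γ → ℝ) (c : γ) (_a : α) (b : β) : ℝ :=
  pc p (kc k l) c / l b c
/-- ratio `kl / l` -/
noncomputable def rkl (k : α → β → ℝ) (l : β → γ → ℝ) (c : γ) (a : α) (b : β) : ℝ :=
  kc k l a c / l b c

lemma rlp_tp (p : α → ℝ) (k : α → β → ℝ) (l : β → γ → ℝ) :
    rlp (tp n p) (tk n k) (tk n l) = fun c a b => ∏ i, rlp p k l (c i) (a i) (b i) := by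
  funext c a b
  unfold rlp
  rw [kc_tk, pc_tp, prod_div_distrib]
  rfl
lemma rkp_tp (p : α → ℝ) (k : α → β → ℝ) (l : β → γ → ℝ) :
    rkp (tp n p) (tk n k) (tk n l) = fun c a b => ∏ i, rkp p k l (c i) (a i) (b i) := by
  funext c a b
  unfold rkp
  rw [kc_tk, pc_tp, prod_div_distrib]
  rfl
lemma rpl_tp (p : α → ℝ) (k : α → β → ℝ) (l : β → γ → ℝ) :
    rpl (tp n p) (tk n k) (tk n l) = fun c a b => ∏ i, rpl p k l (c i) (a i) (b i) := by
  funext c a b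
  unfold rpl
  rw [kc_tk, pc_tp, prod_div_distrib]
  rfl
lemma rkl_tp (k : α → β → ℝ) (l : β → γ → ℝ) :
    rkl (tk n k) (tk n l) = fun c a b => ∏ i, rkl k l (c i) (a i) (b i) := by
  funext c a b
  unfold rkl
  rw [kc_tk, prod_div_distrib]
  rfl

variable {p : α → ℝ} {k : α → β → ℝ} {l : β → γ → ℝ}

lemma rlp_nn (hp : IsPMF p) (hk : IsKernel k) (hl : IsKernel l) (c a b) : 0 ≤ rlp p k l c a b := div_nonneg ((hl _).1 _) ((pc_pmf hp (kc_kernel hk hl)).1 _)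
lemma rkp_nn (hp : IsPMF p) (hk : IsKernel k) (hl : IsKernel l) (c a b) : 0 ≤ rkp p k l c a b := div_nonneg ((kc_kernel hk hl _).1 _) ((pc_pmf hp (kc_kernel hk hl)).1 _)
lemma rpl_nn (hp : IsPMF p) (hk : IsKernel k) (hl : IsKernel l) (c a b) : 0 ≤ rpl p k l c a b := div_nonneg ((pc_pmf hp (kc_kernel hk hl)).1 _) ((hl _).1 _)
lemma rkl_nn (hk : IsKernel k) (hl : IsKernel l) (c a b) : 0 ≤ rkl k l c a b := div_nonneg ((kc_kernel hk hl _).1 _) ((hl _).1 _)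

lemma tri_pos (hp : IsPMF p) (hk : IsKernel k) (hl : IsKernel l) {c a b} (h : tri p k l c a b ≠ 0) : 0 < l b c ∧ 0 < kc k l a c ∧ 0 < pc p (kc k l) c := by
  unfold tri at h
  have h1 : 0 < p a := lt_of_le_of_ne (hp.1 a) (fun h0 => h (by rw [← h0]; ring))
  have h2 : 0 < k a b := lt_of_le_of_ne ((hk a).1 b) (fun h0 => h (by rw [← h0]; ring))
  have h3 : 0 < l b c := lt_of_le_of_ne ((hl b).1 c) (fun h0 => h (by rw [← h0]; ring))
  have h4 : 0 < kc k l a c := lt_of_lt_of_le (mul_pos h2 h3)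
    (single_le_sum (f := fun b => k a b * l b c) (fun b _ => mul_nonneg ((hk a).1 b) ((hl b).1 c)) (mem_univ b))
  have h5 : 0 < pc p (kc k l) c := lt_of_lt_of_le (mul_pos h1 h4)
    (single_le_sum (f := fun a => p a * kc k l a c) (fun a _ => mul_nonneg (hp.1 a) ((kc_kernel hk hl a).1 c)) (mem_univ a))
  exact ⟨h3, h4, h5⟩

lemma rlp_pos (hp : IsPMF p) (hk : IsKernel k) (hl : IsKernel l) {c a b} (h : tri p k l c a b ≠ 0) : 0 < rlp p k l c a b :=
  div_pos (tri_pos hp hk hl h).1 (tri_pos hp hk hl h).2.2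
lemma rkp_pos (hp : IsPMF p) (hk : IsKernel k) (hl : IsKernel l) {c a b} (h : tri p k l c a b ≠ 0) : 0 < rkp p k l c a b :=
  div_pos (tri_pos hp hk hl h).2.1 (tri_pos hp hk hl h).2.2
lemma rpl_pos (hp : IsPMF p) (hk : IsKernel k) (hl : IsKernel l) {c a b} (h : tri p k l c a b ≠ 0) : 0 < rpl p k l c a b :=
  div_pos (tri_pos hp hk hl h).2.2 (tri_pos hp hk hl h).1
lemma rkl_pos (hp : IsPMF p) (hk : IsKernel k) (hl : IsKernel l) {c a b} (h : tri p k l c a b ≠ 0) : 0 < rkl k l c a b :=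
  div_pos (tri_pos hp hk hl h).2.1 (tri_pos hp hk hl h).1

lemma SC_eq (hp : IsPMF p) (hk : IsKernel k) (hl : IsKernel l) {s x y : ℝ} (hx : 0 ≤ x) (hy : 0 ≤ y) : SCterm p k l s x y =
    (x⁻¹ ^ s * Mo p k l (rkp p k l) s + y⁻¹ ^ s * Mo p k l (rlp p k l) s) / s := by
  unfold SCterm Mo
  congr 1
  simp only [mul_sum, ← sum_add_distrib]
  refine sum_congr rfl fun c _ => sum_congr rfl fun a _ => sum_congr rfl fun b _ => ?_
  have e1 : kc k l a c / (x * pc p (kc k l) c) = x⁻¹ * rkp p k l c a b := by unfold rkp; rw [div_mul_eq_div_div_swap]; ring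
  have e2 : l b c / (y * pc p (kc k l) c) = y⁻¹ * rlp p k l c a b := by unfold rlp; rw [div_mul_eq_div_div_swap]; ring
  rw [e1, e2, Real.mul_rpow (inv_nonneg.2 hx) (rkp_nn hp hk hl _ _ _),
    Real.mul_rpow (inv_nonneg.2 hy) (rlp_nn hp hk hl _ _ _)]
  unfold tri
  ring

lemma SC_tp (hp : IsPMF p) (hk : IsKernel k) (hl : IsKernel l) {s x y : ℝ} (hx : 0 ≤ x) (hy : 0 ≤ y) : SCterm (tp n p) (tk n k) (tk n l) s x y =
    (x⁻¹ ^ s * Mo p k l (rkp p k l) s ^ n + y⁻¹ ^ s * Mo p k l (rlp p k l) s ^ n) / s := by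
  rw [SC_eq (tp_pmf hp) (tk_kernel hk) (tk_kernel hl) hx hy, rkp_tp, rlp_tp, Mo_tp, Mo_tp]
  · exact fun c a b => rlp_nn hp hk hl _ _ _
  · exact fun c a b => rkp_nn hp hk hl _ _ _

lemma LK_eq (hp : IsPMF p) (hk : IsKernel k) (hl : IsKernel l) {s : ℝ} {L : ℕ} (hL : 0 < L) : LKt p k l s L =
    -Real.log L + Lo p k l (fun c _ b => l b c) + ((L : ℝ) - 1) ^ s / s * Mo p k l (rkl k l) s := by
  have hL1 : (1 : ℝ) ≤ L := by exact_mod_cast hL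
  have h1 : -Real.log L = ∑ c, ∑ a, ∑ b, tri p k l c a b * (-Real.log L) := by
    simp only [← sum_mul]; rw [tri_sum hp hk hl, one_mul]
  rw [h1]
  unfold LKt Mo Lo
  simp only [mul_sum, ← sum_add_distrib]
  refine sum_congr rfl fun c _ => sum_congr rfl fun a _ => sum_congr rfl fun b _ => ?_
  have e1 : kc k l a c / l b c = rkl k l c a b := rfl
  rw [e1, Real.mul_rpow (by linarith) (rkl_nn hk hl _ _ _)]
  unfold tri
  ring

lemma Lo_tp (hp : IsPMF p) (hk : IsKernel k) (hl : IsKernel l) : Lo (tp n p) (tk n k) (tk n l) (fun c _ b => tk n l b c) = n * Lo p k l (fun c _ b => l b c) := by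
  unfold Lo
  rw [← add3 (n := n) _ _ (tri_sum hp hk hl)]
  refine sum_congr rfl fun c _ => sum_congr rfl fun a _ => sum_congr rfl fun b _ => ?_
  have e : tri (tp n p) (tk n k) (tk n l) c a b = ∏ i, tri p k l (c i) (a i) (b i) := by
    unfold tri tp tk
    simp only [prod_mul_distrib]
  rw [e]
  by_cases h : ∏ i, tri p k l (c i) (a i) (b i) = 0
  · rw [h]; simp
  · unfold tk
    rw [Real.log_prod]
    intro i _
    exact ((tri_pos hp hk hl (prod_ne_zero_iff.1 h i (mem_univ i))).1).ne'

lemma LK_tp (hp : IsPMF p) (hk : IsKernel k) (hl : IsKernel l) {s : ℝ} {L : ℕ} (hL : 0 < L) : LKt (tp n p) (tk n k) (tk n l) s L =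
    -Real.log L + n * Lo p k l (fun c _ b => l b c) + ((L : ℝ) - 1) ^ s / s * Mo p k l (rkl k l) s ^ n := by
  rw [LK_eq (tp_pmf hp) (tk_kernel hk) (tk_kernel hl) hL, Lo_tp hp hk hl, rkl_tp, Mo_tp]
  exact fun c a b => rkl_nn hk hl _ _ _

end

section
variable {U V Q T B Y : Type} [Fintype U] [Fintype V] [Fintype Q] [Fintype T] [Fintype B] [Fintype Y]
variable {pU : U → ℝ} {kV : U → V → ℝ} {pQ : Q → ℝ} {kT : Q → T → ℝ} {kb : V → B → ℝ} {ky : T → Y → ℝ}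

lemma rpow_split {x r s : ℝ} (hx : 0 ≤ x) (hr : 0 ≤ r) (_hs : 0 < s) (hs1 : s < 1) :
    x ^ (1 - s) * r ^ s = x * (r / x) ^ s := by
  rcases hx.eq_or_lt with h | h
  · rw [← h, Real.zero_rpow (by linarith)]; simp
  · rw [Real.div_rpow hr hx, Real.rpow_sub h, Real.rpow_one]; ring

lemma sum_fact (f : B → U → V → ℝ) (g : Y → Q → T → ℝ) :
    ∑ b, ∑ y, ∑ u, ∑ v, ∑ q, ∑ t, f b u v * g y q t = (∑ b, ∑ u, ∑ v, f b u v) * ∑ y, ∑ q, ∑ t, g y q t := by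
  simp only [← mul_sum, ← sum_mul]

lemma DEC_eq (hU : IsPMF pU) (hV : IsKernel kV) (hQ : IsPMF pQ) (hT : IsKernel kT) (hb : IsKernel kb) (hy : IsKernel ky) {s : ℝ} (hs : 0 < s) (hs1 : s < 1) {M1 M2 L : ℕ} (h2 : 0 < M2) :
    DECt pU kV pQ kT kb ky s M1 M2 L =
      ((M1 : ℝ) * M2 * L) ^ s * (Mo pU kV kb (rpl pU kV kb) s * Mo pQ kT ky (rpl pQ kT ky) s) +
      (((M2 : ℝ) - 1) * L) ^ s * (Mo pU kV kb (rkl kV kb) s * Mo pQ kT ky (rkl kT ky) s) := by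
  have h2' : (1 : ℝ) ≤ M2 := by exact_mod_cast h2
  unfold DECt Mo
  rw [← sum_fact, ← sum_fact]
  simp only [mul_sum, ← sum_add_distrib]
  refine sum_congr rfl fun b _ => sum_congr rfl fun y _ => sum_congr rfl fun u _ => sum_congr rfl fun v _ =>
    sum_congr rfl fun q _ => sum_congr rfl fun t _ => ?_
  have hB := (pc_pmf hU (kc_kernel hV hb)).1 b
  have hY := (pc_pmf hQ (kc_kernel hT hy)).1 y
  have hB2 := (kc_kernel hV hb u).1 b
  have hY2 := (kc_kernel hT hy q).1 y
  have hb' := (hb v).1 b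
  have hy' := (hy t).1 y
  have g1 : (kb v b * ky t y) ^ (1 - s) * (((M1 : ℝ) * M2 * L) * (pc pU (kc kV kb) b * pc pQ (kc kT ky) y)) ^ s =
      ((M1 : ℝ) * M2 * L) ^ s * ((kb v b * rpl pU kV kb b u v ^ s) * (ky t y * rpl pQ kT ky y q t ^ s)) := by
    rw [Real.mul_rpow hb' hy', Real.mul_rpow (by positivity) (mul_nonneg hB hY), Real.mul_rpow hB hY]
    unfold rpl
    rw [← rpow_split hb' hB hs hs1, ← rpow_split hy' hY hs hs1]; ring
  have g2 : (kb v b * ky t y) ^ (1 - s) * (((M2 : ℝ) - 1) * L * (kc kV kb u b * kc kT ky q y)) ^ s =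
      (((M2 : ℝ) - 1) * L) ^ s * ((kb v b * rkl kV kb b u v ^ s) * (ky t y * rkl kT ky y q t ^ s)) := by
    rw [Real.mul_rpow hb' hy', Real.mul_rpow (mul_nonneg (by linarith) (by positivity)) (mul_nonneg hB2 hY2), Real.mul_rpow hB2 hY2]
    unfold rkl
    rw [← rpow_split hb' hB2 hs hs1, ← rpow_split hy' hY2 hs hs1]; ring
  rw [mul_add ((kb v b * ky t y) ^ (1 - s)), g1, g2]
  unfold tri
  ring

lemma DEC_tp (hU : IsPMF pU) (hV : IsKernel kV) (hQ : IsPMF pQ) (hT : IsKernel kT) (hb : IsKernel kb) (hy : IsKernel ky) {s : ℝ} (hs : 0 < s) (hs1 : s < 1) {n m M1 M2 L : ℕ} (h2 : 0 < M2) :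
    DECt (tp n pU) (tk n kV) (tp m pQ) (tk m kT) (tk n kb) (tk m ky) s M1 M2 L =
      ((M1 : ℝ) * M2 * L) ^ s * (Mo pU kV kb (rpl pU kV kb) s ^ n * Mo pQ kT ky (rpl pQ kT ky) s ^ m) +
      (((M2 : ℝ) - 1) * L) ^ s * (Mo pU kV kb (rkl kV kb) s ^ n * Mo pQ kT ky (rkl kT ky) s ^ m) := by
  rw [DEC_eq (tp_pmf hU) (tk_kernel hV) (tp_pmf hQ) (tk_kernel hT) (tk_kernel hb) (tk_kernel hy) hs hs1 h2,
    rpl_tp, rpl_tp, rkl_tp, rkl_tp, Mo_tp, Mo_tp, Mo_tp, Mo_tp]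
  · exact fun c a b => rkl_nn hT hy _ _ _
  · exact fun c a b => rkl_nn hV hb _ _ _
  · exact fun c a b => rpl_nn hQ hT hy _ _ _
  · exact fun c a b => rpl_nn hU hV hb _ _ _
end
end part8

section part9
/-! ### Numeric bounds -/

lemma floor_ex (y y' : ℝ) (h : y ≤ y') (h' : 0 ≤ y') : ∃ M : ℕ, 0 < M ∧ Real.exp y ≤ M ∧ (M : ℝ) - 1 ≤ Real.exp y ∧
    (M : ℝ) ≤ 2 * Real.exp y' := by
  refine ⟨⌊Real.exp y⌋₊ + 1, Nat.succ_pos _, ?_, ?_, ?_⟩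
  · push_cast; exact (Nat.lt_floor_add_one _).le
  · push_cast; linarith [Nat.floor_le (Real.exp_pos y).le]
  · push_cast
    have := Nat.floor_le (Real.exp_pos y).le
    have h2 := Real.exp_le_exp.2 h
    have h3 := Real.one_le_exp h'
    linarith

lemma inv_rpow_le {M y s : ℝ} (h : Real.exp y ≤ M) (hs : 0 < s) : M⁻¹ ^ s ≤ Real.exp (-(s * y)) := by
  have h0 : 0 < M := (Real.exp_pos y).trans_le h
  have : M⁻¹ ≤ Real.exp (-y) := by
    rw [Real.exp_neg]; exact inv_anti₀ (Real.exp_pos y) h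
  refine (Real.rpow_le_rpow (by positivity) this hs.le).trans ?_
  rw [← Real.exp_mul]
  apply le_of_eq; congr 1; ring

lemma rpow_le_exp {M y s : ℝ} (h0 : 0 ≤ M) (h : M ≤ Real.exp y) (hs : 0 < s) : M ^ s ≤ Real.exp (s * y) := by
  refine (Real.rpow_le_rpow h0 h hs.le).trans ?_
  rw [← Real.exp_mul]
  apply le_of_eq; congr 1; ring

lemma pow_le_exp {M y : ℝ} (h0 : 0 ≤ M) (h : M ≤ Real.exp y) (n : ℕ) : M ^ n ≤ Real.exp (n * y) := by
  rw [Real.exp_nat_mul]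
  exact pow_le_pow_left₀ h0 h n

lemma sc_num {s m1 m2 μ1 μ0 J2 J0 δ g r1 r2 : ℝ} {n : ℕ} (hs : 0 < s) (hμ1 : 0 ≤ μ1) (hμ0 : 0 ≤ μ0)
    (h1 : μ1 ≤ Real.exp (s * (J2 + δ))) (h0 : μ0 ≤ Real.exp (s * (J0 + δ)))
    (hm1 : Real.exp (n * r1) ≤ m1) (hm2 : Real.exp (n * r2) ≤ m2)
    (ha : J2 - r1 ≤ -g) (hb : J0 - r1 - r2 ≤ -g) (hδ : δ ≤ g / 2) :
    (m1⁻¹ ^ s * μ1 ^ n + (m1 * m2)⁻¹ ^ s * μ0 ^ n) / s ≤ 2 * Real.exp (-(s * g / 2) * n) / s := by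
  have hm12 : Real.exp (n * r1 + n * r2) ≤ m1 * m2 := by
    rw [Real.exp_add]; exact mul_le_mul hm1 hm2 (Real.exp_pos _).le ((Real.exp_pos _).le.trans hm1)
  have hn : (0 : ℝ) ≤ s * n := by positivity
  have t1 : m1⁻¹ ^ s * μ1 ^ n ≤ Real.exp (-(s * g / 2) * n) := by
    refine (mul_le_mul (inv_rpow_le hm1 hs) (pow_le_exp hμ1 h1 n) (by positivity) (Real.exp_pos _).le).trans ?_
    rw [← Real.exp_add, Real.exp_le_exp]
    nlinarith
  have t2 : (m1 * m2)⁻¹ ^ s * μ0 ^ n ≤ Real.exp (-(s * g / 2) * n) := by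
    refine (mul_le_mul (inv_rpow_le hm12 hs) (pow_le_exp hμ0 h0 n) (by positivity) (Real.exp_pos _).le).trans ?_
    rw [← Real.exp_add, Real.exp_le_exp]
    nlinarith
  gcongr
  linarith

lemma dec_num {s M μ ν J K δ g κ c r : ℝ} {n m : ℕ} (hs : 0 < s) (hs1 : s < 1) (hμ : 0 ≤ μ) (hν : 0 ≤ ν)
    (hM0 : 0 ≤ M) (hc : 1 ≤ c) (hm : (m : ℝ) = κ * n)
    (h1 : μ ≤ Real.exp (s * (J + δ))) (h2 : ν ≤ Real.exp (s * (K + δ)))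
    (hM : M ≤ c * Real.exp (n * r)) (hg : J + κ * K + r ≤ -g) (hδ : δ * (1 + κ) ≤ g / 2) :
    M ^ s * (μ ^ n * ν ^ m) ≤ c * Real.exp (-(s * g / 2) * n) := by
  have hn : (0 : ℝ) ≤ s * n := by positivity
  have e1 : M ^ s ≤ c * Real.exp (s * (n * r)) := by
    have hM' : M / c ≤ Real.exp (n * r) := by rw [div_le_iff₀ (by linarith)]; linarith
    have e : M = c * (M / c) := by field_simp
    rw [e, Real.mul_rpow (by linarith) (by positivity)]
    refine mul_le_mul ?_ (rpow_le_exp (by positivity) hM' hs) (by positivity) (by linarith)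
    calc c ^ s ≤ c ^ (1 : ℝ) := Real.rpow_le_rpow_of_exponent_le hc hs1.le
      _ = c := Real.rpow_one c
  have e2 : μ ^ n * ν ^ m ≤ Real.exp (n * (s * (J + δ)) + m * (s * (K + δ))) := by
    rw [Real.exp_add]
    exact mul_le_mul (pow_le_exp hμ h1 n) (pow_le_exp hν h2 m) (by positivity) (Real.exp_pos _).le
  refine (mul_le_mul e1 e2 (by positivity) (by positivity)).trans ?_
  rw [mul_assoc, ← Real.exp_add]
  refine mul_le_mul_of_nonneg_left ?_ (by linarith)
  rw [Real.exp_le_exp, hm]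
  nlinarith

lemma lim_num {x C D s : ℝ} (hx0 : 0 < x) (hs : 0 < s) {ε : ℝ} (hε : 0 < ε) :
    ∃ n0 : ℕ, 0 < n0 ∧ ∀ n : ℕ, n0 ≤ n →
      C * (2 * √(2 * Real.exp (-x * n) / s) + 10 * Real.exp (-x * n)) ≤ ε ∧
      Real.log 2 / n + D * (2 * √(2 * Real.exp (-x * n) / s)) + Real.exp (-x * n) / s / n ≤ ε := by
  have t0 : Filter.Tendsto (fun n : ℕ => Real.exp (-x * n)) Filter.atTop (nhds 0) := by
    refine Real.tendsto_exp_atBot.comp ?_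
    exact Filter.Tendsto.const_mul_atTop_of_neg (by linarith) tendsto_natCast_atTop_atTop
  have tn : Filter.Tendsto (fun n : ℕ => ((n : ℝ))⁻¹) Filter.atTop (nhds 0) :=
    tendsto_inv_atTop_zero.comp tendsto_natCast_atTop_atTop
  have t1 : Filter.Tendsto (fun n : ℕ => √(2 * Real.exp (-x * n) / s)) Filter.atTop (nhds 0) := by
    have := ((t0.const_mul 2).div_const s).sqrt
    simpa using this
  have t2 : Filter.Tendsto (fun n : ℕ => C * (2 * √(2 * Real.exp (-x * n) / s) + 10 * Real.exp (-x * n)))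
      Filter.atTop (nhds 0) := by
    have := ((t1.const_mul 2).add (t0.const_mul 10)).const_mul C
    simpa using this
  have t3 : Filter.Tendsto (fun n : ℕ => Real.log 2 / n + D * (2 * √(2 * Real.exp (-x * n) / s)) + Real.exp (-x * n) / s / n)
      Filter.atTop (nhds 0) := by
    have := ((tn.const_mul (Real.log 2)).add ((t1.const_mul 2).const_mul D)).add ((t0.div_const s).mul tn)
    simpa [div_eq_mul_inv] using this
  obtain ⟨n0, h0⟩ := Filter.eventually_atTop.1
    ((t2.eventually_le_const hε).and (t3.eventually_le_const hε))
  exact ⟨n0 + 1, Nat.succ_pos _, fun n hn => h0 n (by omega)⟩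

/-! ### Additivity -/

section
variable {A B E X Y Z : Type} [Fintype A] [Fintype B] [Fintype E]
  [Fintype X] [Fintype Y] [Fintype Z]
variable {U V Q T : Type} [Fintype U] [Fintype V] [Fintype Q] [Fintype T] {n m : ℕ}

lemma os_code {pA : A → ℝ} {kBE : A → B × E → ℝ} {pS : A × B × E → ℝ} (W : X → Y × Z → ℝ)
    (hS : ∀ w, pS w = pA w.1 * kBE w.1 w.2) (F : (Fin n → A) → (Fin m → X) → ℝ) :
    osJoint (fun w : (Fin n → A) × (Fin n → B) × (Fin n → E) => tp n pA w.1 * tk2 n kBE w.1 w.2) (tk2 m W) F =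
      codeJoint pS W F := by
  funext w
  unfold osJoint codeJoint tp tk2
  simp only [hS, prod_mul_distrib]

lemma dist_add {pU : U → ℝ} {kV : U → V → ℝ} {kA : V → A → ℝ} {kB : A → B → ℝ}
    (hU : IsPMF pU) (hV : IsKernel kV) (hA : IsKernel kA) (hB : IsKernel kB) (hn : 0 < n) (d : A → A → ℝ)
    (Ahat : V → B → A) :
    ∑ u, ∑ v, tp n pU u * tk n kV u v * ∑ a, tk n kA v a * ∑ b, tk n kB a b *
      seqDist d a (fun i => Ahat (v i) (b i)) =
    ∑ u, ∑ v, pU u * kV u v * ∑ a, kA v a * ∑ b, kB a b * d a (Ahat v b) := by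
  have hn' : (n : ℝ) ≠ 0 := by exact_mod_cast hn.ne'
  have h1 : ∑ u, ∑ v, ∑ a, ∑ b, pU u * kV u v * kA v a * kB a b = 1 := by
    simp only [← mul_sum, (hB _).2, mul_one, (hA _).2, (hV _).2, hU.2]
  have := add4 (n := n) (fun u v a b => pU u * kV u v * kA v a * kB a b) (fun u v a b => d a (Ahat v b)) h1
  rw [show (∑ u, ∑ v, pU u * kV u v * ∑ a, kA v a * ∑ b, kB a b * d a (Ahat v b)) =
    (n : ℝ)⁻¹ * (n * ∑ u, ∑ v, ∑ a, ∑ b, pU u * kV u v * kA v a * kB a b * d a (Ahat v b)) by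
      rw [inv_mul_cancel_left₀ hn']; simp only [mul_sum, mul_assoc], ← this]
  unfold seqDist tp tk
  simp only [prod_mul_distrib, mul_sum]
  refine sum_congr rfl fun u _ => sum_congr rfl fun v _ => sum_congr rfl fun a _ => sum_congr rfl fun b _ =>
    sum_congr rfl fun i _ => by ring

lemma LE_add {pU : U → ℝ} {kV : U → V → ℝ} {kA : V → A → ℝ} {kE : A → E → ℝ}
    (hU : IsPMF pU) (hV : IsKernel kV) (hA : IsKernel kA) (hE : IsKernel kE) (pe : U → E → ℝ)
    (hpe : ∀ u e, 0 < pe u e) :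
    ∑ u, ∑ v, tp n pU u * tk n kV u v * ∑ a, tk n kA v a * ∑ e, tk n kE a e * (-Real.log (tk n pe u e)) =
    n * ∑ u, ∑ v, pU u * kV u v * ∑ a, kA v a * ∑ e, kE a e * (-Real.log (pe u e)) := by
  have h1 : ∑ u, ∑ v, ∑ a, ∑ b, pU u * kV u v * kA v a * kE a b = 1 := by
    simp only [← mul_sum, (hE _).2, mul_one, (hA _).2, (hV _).2, hU.2]
  have := add4 (n := n) (fun u v a e => pU u * kV u v * kA v a * kE a e) (fun u v a e => -Real.log (pe u e)) h1
  rw [show (∑ u, ∑ v, pU u * kV u v * ∑ a, kA v a * ∑ b, kE a b * (-Real.log (pe u b))) =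
    ∑ u, ∑ v, ∑ a, ∑ b, pU u * kV u v * kA v a * kE a b * (-Real.log (pe u b)) by
      simp only [mul_sum, mul_assoc], ← this]
  have e : ∀ u e, -Real.log (tk n pe u e) = ∑ i, -Real.log (pe (u i) (e i)) := fun u e => by
    unfold tk; rw [Real.log_prod (fun i _ => (hpe _ _).ne'), sum_neg_distrib]
  simp only [e]
  unfold tp tk
  simp only [prod_mul_distrib, mul_sum]
  refine sum_congr rfl fun u _ => sum_congr rfl fun v _ => sum_congr rfl fun a _ => sum_congr rfl fun b _ =>
    sum_congr rfl fun i _ => by ring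

lemma LZ_add {pQ : Q → ℝ} {kT : Q → T → ℝ} {kz : T → Z → ℝ}
    (hQ : IsPMF pQ) (hT : IsKernel kT) (hz : IsKernel kz) (pz : Q → Z → ℝ)
    (hpz : ∀ u e, 0 < pz u e) :
    ∑ q, ∑ t, tp m pQ q * tk m kT q t * ∑ z, tk m kz t z * (-Real.log (tk m pz q z)) =
    m * ∑ q, ∑ t, pQ q * kT q t * ∑ z, kz t z * (-Real.log (pz q z)) := by
  have h1 : ∑ q, ∑ t, ∑ z, pQ q * kT q t * kz t z = 1 := by
    simp only [← mul_sum, (hz _).2, mul_one, (hT _).2, hQ.2]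
  have := add3 (n := m) (fun q t z => pQ q * kT q t * kz t z) (fun q t z => -Real.log (pz q z)) h1
  rw [show (∑ q, ∑ t, pQ q * kT q t * ∑ z, kz t z * (-Real.log (pz q z))) =
    ∑ q, ∑ t, ∑ z, pQ q * kT q t * kz t z * (-Real.log (pz q z)) by
      simp only [mul_sum, mul_assoc], ← this]
  have e : ∀ u e, -Real.log (tk m pz u e) = ∑ i, -Real.log (pz (u i) (e i)) := fun u e => by
    unfold tk; rw [Real.log_prod (fun i _ => (hpz _ _).ne'), sum_neg_distrib]
  simp only [e]
  unfold tp tk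
  simp only [prod_mul_distrib, mul_sum]
  refine sum_congr rfl fun u _ => sum_congr rfl fun v _ => sum_congr rfl fun a _ => 
    sum_congr rfl fun i _ => by ring

lemma HAE_add {pA : A → ℝ} {kE : A → E → ℝ} (hp : IsPMF pA) (hE : IsKernel kE) :
    -∑ a, ∑ e, (tp n pA a * tk n kE a e) * Real.log (tp n pA a * tk n kE a e) =
      n * -∑ a, ∑ e, (pA a * kE a e) * Real.log (pA a * kE a e) := by
  have h1 : ∑ a, ∑ e, pA a * kE a e = 1 := by
    simp only [← mul_sum, (hE _).2, mul_one, hp.2]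
  have := add2 (n := n) (fun a e => pA a * kE a e) (fun a e => Real.log (pA a * kE a e)) h1
  rw [mul_neg, ← this]
  congr 1
  refine sum_congr rfl fun a _ => sum_congr rfl fun e _ => ?_
  have e1 : tp n pA a * tk n kE a e = ∏ i, pA (a i) * kE (a i) (e i) := by
    unfold tp tk; rw [prod_mul_distrib]
  rw [e1]
  by_cases h : ∏ i, pA (a i) * kE (a i) (e i) = 0
  · rw [h]; simp
  · rw [Real.log_prod (fun i _ => prod_ne_zero_iff.1 h i (mem_univ i))]

end
end part9

section part10
/-! ### Random coding theorem -/

section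
variable {A B E X Y Z : Type} [Fintype A] [Fintype B] [Fintype E]
  [Fintype X] [Fintype Y] [Fintype Z]
variable {U V Q T : Type} [Fintype U] [Fintype V] [Fintype Q] [Fintype T]

lemma Mo_nonneg {α β γ : Type} [Fintype α] [Fintype β] [Fintype γ] {p : α → ℝ} {k : α → β → ℝ} {l : β → γ → ℝ}
    (hp : IsPMF p) (hk : IsKernel k) (hl : IsKernel l) {r : γ → α → β → ℝ} (hr : ∀ c a b, 0 ≤ r c a b) (s : ℝ) :
    0 ≤ Mo p k l r s :=
  sum_nonneg fun _ _ => sum_nonneg fun _ _ => sum_nonneg fun _ _ =>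
    mul_nonneg (tri_nonneg hp hk hl _ _ _) (Real.rpow_nonneg (hr _ _ _) _)

lemma seqDist_bd {d : A → A → ℝ} {dmax : ℝ} (hd : ∀ a a', 0 ≤ d a a' ∧ d a a' ≤ dmax) {n : ℕ} (hn : 0 < n)
    (a a' : Fin n → A) : 0 ≤ seqDist d a a' ∧ seqDist d a a' ≤ dmax := by
  unfold seqDist
  have hn' : (0 : ℝ) < n := by exact_mod_cast hn
  refine ⟨mul_nonneg (by positivity) (sum_nonneg fun i _ => (hd _ _).1), ?_⟩
  rw [inv_mul_le_iff₀ hn']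
  calc ∑ i, d (a i) (a' i) ≤ ∑ _i : Fin n, dmax := sum_le_sum fun i _ => (hd _ _).2
    _ = n * dmax := by simp

set_option maxHeartbeats 1600000 in
theorem core {pU : U → ℝ} {kV : U → V → ℝ} {kA : V → A → ℝ} {pQ : Q → ℝ} {kT : Q → T → ℝ}
    {kX : T → X → ℝ} {kBE : A → B × E → ℝ} {W : X → Y × Z → ℝ} {pS : A × B × E → ℝ}
    (hU : IsPMF pU) (hV : IsKernel kV) (hA : IsKernel kA) (hQ : IsPMF pQ) (hT : IsKernel kT)
    (hX : IsKernel kX) (hBE : IsKernel kBE) (hW : IsKernel W)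
    (hS : ∀ w, pS w = pc pU (kc kV kA) w.1 * kBE w.1 w.2)
    (d : A → A → ℝ) (dmax : ℝ) (hd : ∀ a a', 0 ≤ d a a' ∧ d a a' ≤ dmax) (Ahat : V → B → A)
    (pe : U → E → ℝ) (pz : Q → Z → ℝ) (hpe : ∀ u e, 0 < pe u e) (hpe1 : ∀ u, ∑ e, pe u e ≤ 1)
    (hpz : ∀ q z, 0 < pz q z) (hpz1 : ∀ q, ∑ z, pz q z ≤ 1) (CE : ℝ)
    (hCE : ∀ u e, - Real.log (pe u e) ≤ CE) (hCE0 : 0 ≤ CE)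
    (p' q' : ℕ) (hq : 0 < q') (κ : ℝ) (hκ : (p' : ℝ) = κ * q')
    (r1 r2 r2' rL rL' : ℝ) (hr1 : 0 ≤ r1) (hr2 : r2 ≤ r2') (hr2' : 0 ≤ r2') (hrL : rL ≤ rL') (hrL' : 0 ≤ rL')
    (ha : Lo pU kV kA (rkp pU kV kA) < r1) (hb : Lo pU kV kA (rlp pU kV kA) < r1 + r2)
    (hc : Lo pU kV (kc kA (m1 kBE)) (rpl pU kV (kc kA (m1 kBE))) +
      κ * Lo pQ kT (kc kX (m1 W)) (rpl pQ kT (kc kX (m1 W))) + (r1 + r2' + rL') < 0)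
    (hdd : Lo pU kV (kc kA (m1 kBE)) (rkl kV (kc kA (m1 kBE))) +
      κ * Lo pQ kT (kc kX (m1 W)) (rkl kT (kc kX (m1 W))) + (r2 + rL') < 0)
    (he : κ * Lo pQ kT (kc kX (m2 W)) (rkl kT (kc kX (m2 W))) + rL < 0)
    {ε : ℝ} (hε : 0 < ε) :
    ∃ N : ℕ, 0 < N ∧ ∃ (S : Type) (_ : Fintype S) (w : S → ℝ)
      (F : S → (Fin (q' * N) → A) → (Fin (p' * N) → X) → ℝ)
      (g : S → (Fin (q' * N) → B) → (Fin (p' * N) → Y) → Fin (q' * N) → A),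
      IsPMF w ∧ (∀ s, IsKernel (F s)) ∧
      expVal w (fun s => expVal (codeJoint pS W (F s)) (fun w => seqDist d w.1 (g s w.2.1 w.2.2.2.2.1))) ≤
        ∑ u, ∑ v, pU u * kV u v * ∑ a, kA v a * ∑ b, m1 kBE a b * d a (Ahat v b) + ε ∧
      (- ∑ a, ∑ e, (pc pU (kc kV kA) a * m2 kBE a e) * Real.log (pc pU (kc kV kA) a * m2 kBE a e)) - r1
        - (∑ u, ∑ v, pU u * kV u v * ∑ a, kA v a * ∑ e, m2 kBE a e * (- Real.log (pe u e)))
        - κ * (∑ q, ∑ t, pQ q * kT q t * ∑ z, kc kX (m2 W) t z * (- Real.log (pz q z)))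
        + rL - κ * Lo pQ kT (kc kX (m2 W)) (fun c _ b => kc kX (m2 W) b c) - ε ≤
      expVal w (fun s => ((q' * N : ℕ) : ℝ)⁻¹ * condH (codeJoint pS W (F s)) (fun w => w.1)
            (fun w => (w.2.2.1, w.2.2.2.2.2)) * Real.log 2) := by
  classical
  set kb := kc kA (m1 kBE) with hkb
  set ky := kc kX (m1 W) with hky
  set kz := kc kX (m2 W) with hkz
  have hb' : IsKernel kb := kc_kernel hA (m1_kernel hBE)
  have hy' : IsKernel ky := kc_kernel hX (m1_kernel hW)
  have hz' : IsKernel kz := kc_kernel hX (m2_kernel hW)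
  have hκ0 : 0 ≤ κ := by
    have : 0 ≤ κ * q' := by rw [← hκ]; positivity
    exact nonneg_of_mul_nonneg_left this (by exact_mod_cast hq)
  -- the gap
  obtain ⟨g, hg0, ga, gb, gc, gd, ge⟩ : ∃ g : ℝ, 0 < g ∧ Lo pU kV kA (rkp pU kV kA) - r1 ≤ -g ∧
      Lo pU kV kA (rlp pU kV kA) - r1 - r2 ≤ -g ∧
      Lo pU kV kb (rpl pU kV kb) + κ * Lo pQ kT ky (rpl pQ kT ky) + (r1 + r2' + rL') ≤ -g ∧
      Lo pU kV kb (rkl kV kb) + κ * Lo pQ kT ky (rkl kT ky) + (r2 + rL') ≤ -g ∧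
      κ * Lo pQ kT kz (rkl kT kz) + rL ≤ -g := by
    have hev : ∀ x : ℝ, x < 0 → ∀ᶠ g : ℝ in nhdsWithin 0 (Set.Ioi 0), x ≤ -g := fun x hx => by
      have : ∀ᶠ g : ℝ in nhds 0, g < -x := gt_mem_nhds (by linarith)
      filter_upwards [mem_nhdsWithin_of_mem_nhds this] with g hg
      have : g < -x := hg
      linarith
    obtain ⟨g, h1, h2, h3, h4, h5, h6⟩ := ((hev _ (sub_neg.2 ha)).and ((hev (Lo pU kV kA (rlp pU kV kA) - r1 - r2) (by linarith)).and
      ((hev _ hc).and ((hev _ hdd).and ((hev _ he).and self_mem_nhdsWithin))))).exists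
    exact ⟨g, h6, h1, h2, h3, h4, h5⟩
  set δ := g / (2 * (1 + κ)) with hδ
  have hδ0 : 0 < δ := by positivity
  have hδ1 : δ * (1 + κ) ≤ g / 2 := by rw [hδ]; apply le_of_eq; field_simp
  have hδ2 : δ ≤ g / 2 := by nlinarith
  obtain ⟨s1, s1p, b1⟩ := Mo_bound hU hV hA (rkp pU kV kA) (fun c a b => rkp_pos hU hV hA) hδ0
  obtain ⟨s2, s2p, b2⟩ := Mo_bound hU hV hA (rlp pU kV kA) (fun c a b => rlp_pos hU hV hA) hδ0
  obtain ⟨s3, s3p, b3⟩ := Mo_bound hU hV hb' (rpl pU kV kb) (fun c a b => rpl_pos hU hV hb') hδ0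
  obtain ⟨s4, s4p, b4⟩ := Mo_bound hQ hT hy' (rpl pQ kT ky) (fun c a b => rpl_pos hQ hT hy') hδ0
  obtain ⟨s5, s5p, b5⟩ := Mo_bound hU hV hb' (rkl kV kb) (fun c a b => rkl_pos hU hV hb') hδ0
  obtain ⟨s6, s6p, b6⟩ := Mo_bound hQ hT hy' (rkl kT ky) (fun c a b => rkl_pos hQ hT hy') hδ0
  obtain ⟨s7, s7p, b7⟩ := Mo_bound hQ hT hz' (rkl kT kz) (fun c a b => rkl_pos hQ hT hz') hδ0
  obtain ⟨s, hs, hs1, l1, l2, l3, l4, l5, l6, l7⟩ : ∃ s : ℝ, 0 < s ∧ s < 1 ∧ s ≤ s1 ∧ s ≤ s2 ∧ s ≤ s3 ∧ s ≤ s4 ∧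
      s ≤ s5 ∧ s ≤ s6 ∧ s ≤ s7 := by
    refine ⟨min (1/2) (min s1 (min s2 (min s3 (min s4 (min s5 (min s6 s7)))))), by positivity, ?_, ?_, ?_, ?_, ?_, ?_, ?_, ?_⟩
    · exact (min_le_left _ _).trans_lt (by norm_num)
    all_goals simp only [min_le_iff, le_refl, true_or, or_true]
  replace b1 := b1 s hs l1
  replace b2 := b2 s hs l2
  replace b3 := b3 s hs l3
  replace b4 := b4 s hs l4
  replace b5 := b5 s hs l5
  replace b6 := b6 s hs l6
  replace b7 := b7 s hs l7
  have hx : 0 < s * g / 2 := by positivity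
  obtain ⟨n0, hn0, hlim⟩ := lim_num (C := dmax) (D := CE) hx hs hε
  refine ⟨n0, hn0, ?_⟩
  set n := q' * n0 with hn
  set m := p' * n0 with hm
  have hnn : 0 < n := Nat.mul_pos hq hn0
  have hn' : (0 : ℝ) < n := by exact_mod_cast hnn
  obtain ⟨lim1, lim2⟩ := hlim n (Nat.le_mul_of_pos_left _ hq)
  have hmn : (m : ℝ) = κ * n := by rw [hm, hn]; push_cast; rw [hκ]; ring
  obtain ⟨M1, h1, M1a, M1b, M1c⟩ := floor_ex (n * r1) (n * r1) le_rfl (by positivity)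
  obtain ⟨M2, h2, M2a, M2b, M2c⟩ := floor_ex (n * r2) (n * r2') (by gcongr) (by positivity)
  obtain ⟨L, hL, La, Lb, Lc⟩ := floor_ex (n * rL) (n * rL') (by gcongr) (by positivity)
  have M1pos : (0 : ℝ) < M1 := by exact_mod_cast h1
  have M2pos : (0 : ℝ) < M2 := by exact_mod_cast h2
  have M2one : (1 : ℝ) ≤ M2 := by exact_mod_cast h2
  have Lpos : (0 : ℝ) < L := by exact_mod_cast hL
  have Lone : (1 : ℝ) ≤ L := by exact_mod_cast hL
  set x := Real.exp (-(s * g / 2) * n) with hxdef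
  have SCb : SCterm (tp n pU) (tk n kV) (tk n kA) s M1 (M1 * M2) ≤ 2 * x / s := by
    rw [SC_tp hU hV hA M1pos.le (by positivity)]
    exact sc_num hs (Mo_nonneg hU hV hA (rkp_nn hU hV hA) s) (Mo_nonneg hU hV hA (rlp_nn hU hV hA) s) b1 b2
      M1a M2a ga gb hδ2
  have DECb : DECt (tp n pU) (tk n kV) (tp m pQ) (tk m kT) (tk n kb) (tk m ky) s M1 M2 L ≤ 10 * x := by
    rw [DEC_tp hU hV hQ hT hb' hy' hs hs1 h2]
    have t1 := dec_num (M := (M1 : ℝ) * M2 * L) (c := 8) (r := r1 + r2' + rL') (n := n) (m := m) hs hs1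
      (Mo_nonneg hU hV hb' (rpl_nn hU hV hb') s) (Mo_nonneg hQ hT hy' (rpl_nn hQ hT hy') s)
      (by positivity) (by norm_num) hmn b3 b4 (by
        have : (8 : ℝ) * Real.exp (n * (r1 + r2' + rL')) = (2 * Real.exp (n * r1)) * (2 * Real.exp (n * r2')) * (2 * Real.exp (n * rL')) := by
          rw [mul_add, mul_add, Real.exp_add, Real.exp_add]; ring
        rw [this]; gcongr) gc hδ1
    have t2 := dec_num (M := ((M2 : ℝ) - 1) * L) (c := 2) (r := r2 + rL') (n := n) (m := m) hs hs1
      (Mo_nonneg hU hV hb' (rkl_nn hV hb') s) (Mo_nonneg hQ hT hy' (rkl_nn hT hy') s)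
      (mul_nonneg (by linarith) Lpos.le) (by norm_num) hmn b5 b6 (by
        have : (2 : ℝ) * Real.exp (n * (r2 + rL')) = (Real.exp (n * r2)) * (2 * Real.exp (n * rL')) := by
          rw [mul_add, Real.exp_add]; ring
        rw [this]; gcongr) gd hδ1
    linarith
  have LKb : LKt (tp m pQ) (tk m kT) (tk m kz) s L ≤ - (n * rL) + n * (κ * Lo pQ kT kz (fun c _ b => kz b c)) + x / s := by
    rw [LK_tp hQ hT hz' hL]
    have t1 := dec_num (M := (L : ℝ) - 1) (c := 1) (r := rL) (μ := 1) (J := 0) (n := n) (m := m) hs hs1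
      zero_le_one (Mo_nonneg hQ hT hz' (rkl_nn hT hz') s)
      (by linarith) le_rfl hmn (Real.one_le_exp (by positivity)) b7 (by linarith) (by linarith) hδ1
    rw [one_pow, one_mul, one_mul] at t1
    have t2 : n * rL ≤ Real.log L := by rw [Real.le_log_iff_exp_le Lpos]; exact La
    have t3 : ((L : ℝ) - 1) ^ s / s * Mo pQ kT kz (rkl kT kz) s ^ m ≤ x / s := by
      rw [div_mul_eq_mul_div]; gcongr
    rw [hmn]
    linarith
  have eb : kc (tk n kA) (m1 (tk2 n kBE)) = tk n kb := by rw [m1_tk2, kc_tk]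
  have ey : kc (tk m kX) (m1 (tk2 m W)) = tk m ky := by rw [m1_tk2, kc_tk]
  have ez : kc (tk m kX) (m2 (tk2 m W)) = tk m kz := by rw [m2_tk2, kc_tk]
  have eA : pc (tp n pU) (kc (tk n kV) (tk n kA)) = tp n (pc pU (kc kV kA)) := by rw [kc_tk, pc_tp]
  have : Nonempty (Fin M1 × Fin M2) := ⟨(⟨0, h1⟩, ⟨0, h2⟩)⟩
  have hdec : ∀ (c1 : (Fin M1 → Fin n → U) × (Fin M1 × Fin M2 → Fin n → V))
      (c2 : (Fin M1 → Fin m → Q) × ((Fin M1 × Fin M2) × Fin L → Fin m → T)) (b : Fin n → B) (y : Fin m → Y),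
      ∃ k, ∀ k', score (tk n kb) (tk m ky) c1 c2 b y k' ≤ score (tk n kb) (tk m ky) c1 c2 b y k :=
    fun c1 c2 b y => Finite.exists_max _
  choose dec hdec using hdec
  have D1 := oneshot_dist (φ := fun (a : Fin n → A) (v : Fin n → V) (b : Fin n → B) => seqDist d a (fun i => Ahat (v i) (b i)))
    (tp_pmf (n := n) hU) (tk_kernel (n := n) hV) (tk_kernel (n := n) hA)
    (tp_pmf (n := m) hQ) (tk_kernel (n := m) hT) (tk_kernel (n := m) hX) (tk2_kernel (n := n) hBE)
    (tk2_kernel (n := m) hW) h1 h2 hL hs hs1 (C := dmax) (fun a v b => (seqDist_bd hd hnn _ _).1)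
    (fun a v b => (seqDist_bd hd hnn _ _).2) dec (by rw [eb, ey]; exact hdec)
  have H1 := oneshot_equiv
    (tp_pmf (n := n) hU) (tk_kernel (n := n) hV) (tk_kernel (n := n) hA)
    (tp_pmf (n := m) hQ) (tk_kernel (n := m) hT) (tk_kernel (n := m) hX) (tk2_kernel (n := n) hBE)
    (tk2_kernel (n := m) hW) h1 h2 hL hs hs1 (tk n pe) (tk m pz)
    (fun u e => prod_pos fun i _ => hpe _ _)
    (fun u => by
      unfold tk; rw [sum_prod_fun (fun i => pe (u i))]
      exact prod_le_one (fun i _ => sum_nonneg fun e _ => (hpe _ _).le) (fun i _ => hpe1 _))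
    (fun u e => prod_pos fun i _ => hpz _ _)
    (fun u => by
      unfold tk; rw [sum_prod_fun (fun i => pz (u i))]
      exact prod_le_one (fun i _ => sum_nonneg fun e _ => (hpz _ _).le) (fun i _ => hpz1 _))
    (n * CE) (fun u e => by
      unfold tk; rw [Real.log_prod (fun i _ => (hpe _ _).ne'), ← sum_neg_distrib]
      calc ∑ i, -Real.log (pe (u i) (e i)) ≤ ∑ _i : Fin n, CE := sum_le_sum fun i _ => hCE _ _
        _ = n * CE := by simp) (by positivity)
  rw [eb, ey] at D1
  rw [ez] at H1
  rw [m1_tk2] at D1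
  rw [m2_tk2] at H1
  simp only [eA] at D1 H1
  simp only [os_code W hS] at D1 H1
  rw [dist_add hU hV hA (m1_kernel hBE) hnn d Ahat] at D1
  rw [HAE_add (pc_pmf hU (kc_kernel hV hA)) (m2_kernel hBE), LE_add hU hV hA (m2_kernel hBE) pe hpe,
    LZ_add hQ hT hz' pz hpz] at H1
  refine ⟨_, inferInstance, cw (tp n pU) (tk n kV) (tp m pQ) (tk m kT) M1 M2 L,
    fun c => Fenc (tk n kA) (tk m kX) c.1 c.2,
    fun c b y i => Ahat (c.1.2 (dec c.1 c.2 b y) i) (b i),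
    cw_pmf (tp_pmf hU) (tk_kernel hV) (tp_pmf hQ) (tk_kernel hT),
    fun c => Fenc_kernel (tk_kernel hA) (tk_kernel hX) h1 h2 hL _ _, ?_, ?_⟩
  · refine le_trans D1 ?_
    have hdm : 0 ≤ dmax := by
      by_cases hA0 : Nonempty A
      · obtain ⟨a⟩ := hA0
        exact (hd a a).1.trans (hd a a).2
      · exfalso
        have h := (pc_pmf hU (kc_kernel hV hA)).2
        rw [not_nonempty_iff] at hA0
        simp at h
    have : dmax * (2 * √(SCterm (tp n pU) (tk n kV) (tk n kA) s M1 (M1 * M2)) +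
        DECt (tp n pU) (tk n kV) (tp m pQ) (tk m kT) (tk n kb) (tk m ky) s M1 M2 L) ≤
        dmax * (2 * √(2 * x / s) + 10 * x) := by gcongr
    linarith
  · set SC := SCterm (tp n pU) (tk n kV) (tk n kA) s M1 (M1 * M2) with hSC
    have hlog : Real.log M1 ≤ Real.log 2 + n * r1 := by
      have := Real.log_le_log M1pos M1c
      rwa [Real.log_mul (by norm_num) (Real.exp_pos _).ne', Real.log_exp] at this
    have hsc : n * CE * (2 * √SC) ≤ n * CE * (2 * √(2 * x / s)) := by gcongr
    rw [hmn] at H1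
    have lim3 : Real.log 2 + n * CE * (2 * √(2 * x / s)) + x / s ≤ n * ε := by
      have := mul_le_mul_of_nonneg_left lim2 hn'.le
      have e : (n : ℝ) * (Real.log 2 / n + CE * (2 * √(2 * x / s)) + x / s / n) =
        Real.log 2 + n * CE * (2 * √(2 * x / s)) + x / s := by field_simp
      linarith
    have e3 : expVal (cw (tp n pU) (tk n kV) (tp m pQ) (tk m kT) M1 M2 L) (fun c => (n : ℝ)⁻¹ *
        condH (codeJoint pS W (Fenc (tk n kA) (tk m kX) c.1 c.2)) (fun w => w.1)
            (fun w => (w.2.2.1, w.2.2.2.2.2)) * Real.log 2) =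
        (n : ℝ)⁻¹ * expVal (cw (tp n pU) (tk n kV) (tp m pQ) (tk m kT) M1 M2 L) (fun c => 
        condH (codeJoint pS W (Fenc (tk n kA) (tk m kX) c.1 c.2)) (fun w => w.1)
            (fun w => (w.2.2.1, w.2.2.2.2.2)) * Real.log 2) := by
      unfold expVal
      rw [mul_sum]
      exact sum_congr rfl fun c _ => by ring
    rw [e3, le_inv_mul_iff₀ hn']
    refine le_trans ?_ H1
    linarith
end
end part10

section part11
/-! ### Entropy basics -/

section
variable {γ γ' α α' : Type} [Fintype γ] [Fintype γ'] [Fintype α] [Fintype α']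

lemma Hof_log (q : γ → ℝ) (f : γ → α) :
    Hof q f * Real.log 2 = -∑ c, q c * Real.log (pushf q f (f c)) := by
  unfold Hof
  rw [entropy_log, pushf_sum q f (fun a => Real.log (pushf q f a))]

lemma log2_ne : Real.log 2 ≠ 0 := (Real.log_pos (by norm_num)).ne'

lemma Hof_congr (q : γ → ℝ) (f : γ → α) (f' : γ → α') (h : ∀ x y, f x = f y ↔ f' x = f' y) :
    Hof q f = Hof q f' := by
  classical
  apply mul_right_cancel₀ log2_ne
  rw [Hof_log, Hof_log]
  congr 1
  refine sum_congr rfl fun c _ => ?_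
  congr 2
  unfold pushf
  refine sum_congr rfl fun c' _ => ?_
  by_cases h' : f c' = f c
  · rw [if_pos h', if_pos ((h _ _).1 h')]
  · rw [if_neg h', if_neg (fun h'' => h' ((h _ _).2 h''))]

lemma Hof_equiv (q : γ → ℝ) (f : γ → α) (e : γ' ≃ γ) :
    Hof (fun c => q (e c)) (fun c => f (e c)) = Hof q f := by
  unfold Hof
  congr 1
  funext a
  unfold pushf
  exact Fintype.sum_equiv e _ _ (fun _ => rfl)

lemma pushf_ge {q : γ → ℝ} (hq : ∀ c, 0 ≤ q c) (f : γ → α) (c : γ) : q c ≤ pushf q f (f c) := by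
  classical
  unfold pushf
  have := single_le_sum (f := fun c' => if f c' = f c then q c' else 0) (fun c' _ => by split_ifs; exacts [hq _, le_rfl])
    (mem_univ c)
  simpa using this

lemma Hof_prod {N : ℕ} (q : Fin N → γ → ℝ) (hq : ∀ b, IsPMF (q b)) (f : γ → α) :
    Hof (fun ω : Fin N → γ => ∏ b, q b (ω b)) (fun ω b => f (ω b)) = ∑ b, Hof (q b) f := by
  classical
  apply mul_right_cancel₀ log2_ne
  rw [Hof_log, sum_mul]
  simp only [Hof_log]
  rw [sum_neg_distrib]
  congr 1
  have hp : ∀ a : Fin N → α, pushf (fun ω : Fin N → γ => ∏ b, q b (ω b)) (fun ω b => f (ω b)) a =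
      ∏ b, pushf (q b) f (a b) := by
    intro a
    unfold pushf
    rw [← sum_prod_fun (fun b c => if f c = a b then q b c else 0)]
    refine sum_congr rfl fun ω _ => ?_
    by_cases h : (fun b => f (ω b)) = a
    · rw [if_pos h]
      refine prod_congr rfl fun b _ => ?_
      rw [if_pos (congrFun h b)]
    · rw [if_neg h]
      obtain ⟨b, hb⟩ : ∃ b, f (ω b) ≠ a b := by
        by_contra hcon
        push Not at hcon
        exact h (funext hcon)
      exact (prod_eq_zero (mem_univ b) (if_neg hb)).symm
  have h1 : ∀ ω : Fin N → γ, (∏ b, q b (ω b)) * Real.log (pushf (fun ω : Fin N → γ => ∏ b, q b (ω b)) (fun ω b => f (ω b)) (fun b => f (ω b))) =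
      ∑ b, (∏ b, q b (ω b)) * Real.log (pushf (q b) f (f (ω b))) := by
    intro ω
    rw [hp, ← mul_sum]
    by_cases h : ∏ b, q b (ω b) = 0
    · rw [h]; simp
    · rw [Real.log_prod]
      intro b _
      have h2 := prod_ne_zero_iff.1 h b (mem_univ b)
      have h3 := pushf_ge (hq b).1 f (ω b)
      have h4 := lt_of_le_of_ne ((hq b).1 (ω b)) (Ne.symm h2)
      exact (h4.trans_le h3).ne'
  simp only [h1]
  rw [sum_comm]
  refine sum_congr rfl fun b _ => ?_
  exact sum_prod_one q (fun b => (hq b).2) b (fun c => Real.log (pushf (q b) f (f c)))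

end

/-! ### Concatenation -/
section
variable {A B E X Y Z : Type} [Fintype A] [Fintype B] [Fintype E]
  [Fintype X] [Fintype Y] [Fintype Z] {N n m : ℕ}

/-- splitting into blocks -/
def blk {α : Type} (N n : ℕ) : (Fin (N * n) → α) ≃ (Fin N → Fin n → α) :=
  (Equiv.arrowCongr finProdFinEquiv.symm (Equiv.refl α)).trans (Equiv.curry _ _ _)

lemma blk_apply {α : Type} (a : Fin (N * n) → α) (b : Fin N) (i : Fin n) :
    blk N n a b i = a (finProdFinEquiv (b, i)) := rfl

/-- splitting everything -/
def blkAll (A B E X Y Z : Type) (N n m : ℕ) :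
    ((Fin (N * n) → A) × (Fin (N * n) → B) × (Fin (N * n) → E) × (Fin (N * m) → X) × (Fin (N * m) → Y) × (Fin (N * m) → Z)) ≃
    (Fin N → (Fin n → A) × (Fin n → B) × (Fin n → E) × (Fin m → X) × (Fin m → Y) × (Fin m → Z)) where
  toFun w b := (blk N n w.1 b, blk N n w.2.1 b, blk N n w.2.2.1 b, blk N m w.2.2.2.1 b, blk N m w.2.2.2.2.1 b,
    blk N m w.2.2.2.2.2 b)
  invFun v := ((blk N n).symm fun b => (v b).1, (blk N n).symm fun b => (v b).2.1, (blk N n).symm fun b => (v b).2.2.1,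
    (blk N m).symm fun b => (v b).2.2.2.1, (blk N m).symm fun b => (v b).2.2.2.2.1, (blk N m).symm fun b => (v b).2.2.2.2.2)
  left_inv w := by simp
  right_inv v := by funext b; simp

lemma blk_prod {α : Type} (a : Fin (N * n) → α) (h : α → ℝ) : ∏ i, h (a i) = ∏ b, ∏ i, h (blk N n a b i) := by
  rw [← Fintype.prod_prod_type' (f := fun b i => h (blk N n a b i))]
  exact (Fintype.prod_equiv finProdFinEquiv _ _ (fun _ => rfl)).symm

lemma blk_sum (h : Fin (N * n) → ℝ) : ∑ i, h i = ∑ b : Fin N, ∑ i : Fin n, h (finProdFinEquiv (b, i)) := by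
  rw [← Fintype.sum_prod_type' (f := fun b i => h (finProdFinEquiv (b, i)))]
  exact (Fintype.sum_equiv finProdFinEquiv _ _ (fun _ => rfl)).symm

lemma blk_prod' (h : Fin (N * n) → ℝ) : ∏ i, h i = ∏ b : Fin N, ∏ i : Fin n, h (finProdFinEquiv (b, i)) := by
  rw [← Fintype.prod_prod_type' (f := fun b i => h (finProdFinEquiv (b, i)))]
  exact (Fintype.prod_equiv finProdFinEquiv _ _ (fun _ => rfl)).symm

/-- concatenated encoder -/
noncomputable def Fcat (F : Fin N → (Fin n → A) → (Fin m → X) → ℝ) (a : Fin (N * n) → A) (x : Fin (N * m) → X) : ℝ :=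
  ∏ b, F b (blk N n a b) (blk N m x b)

/-- concatenated decoder -/
def gcat (g : Fin N → (Fin n → B) → (Fin m → Y) → Fin n → A) (b : Fin (N * n) → B) (y : Fin (N * m) → Y) :
    Fin (N * n) → A := (blk N n).symm (fun j => g j (blk N n b j) (blk N m y j))

lemma Fcat_kernel {F : Fin N → (Fin n → A) → (Fin m → X) → ℝ} (hF : ∀ b, IsKernel (F b)) : IsKernel (Fcat F) := by
  intro a
  refine ⟨fun x => prod_nonneg fun b _ => (hF b _).1 _, ?_⟩
  unfold Fcat
  rw [Fintype.sum_equiv (blk N m) _ (fun x : Fin N → Fin m → X => ∏ b, F b (blk N n a b) (x b)) (fun _ => rfl)]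
  rw [sum_prod_fun (fun b x => F b (blk N n a b) x)]
  exact prod_eq_one fun b _ => (hF b _).2

lemma code_cat (pS : A × B × E → ℝ) (W : X → Y × Z → ℝ) (F : Fin N → (Fin n → A) → (Fin m → X) → ℝ) :
    codeJoint pS W (Fcat F) = fun w => ∏ b, codeJoint pS W (F b) (blkAll A B E X Y Z N n m w b) := by
  funext w
  unfold codeJoint Fcat
  rw [blk_prod' (fun i => pS (w.1 i, w.2.1 i, w.2.2.1 i)),
    blk_prod' (fun j => W (w.2.2.2.1 j) (w.2.2.2.2.1 j, w.2.2.2.2.2 j))]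
  simp only [← prod_mul_distrib]
  rfl

lemma code_pmf {pS : A × B × E → ℝ} (hS : IsPMF pS) {W : X → Y × Z → ℝ} (hW : IsKernel W)
    {F : (Fin n → A) → (Fin m → X) → ℝ} (hF : IsKernel F) : IsPMF (codeJoint pS W F) := by
  have h1 : ∀ a : Fin n → A, ∑ b : Fin n → B, ∑ e : Fin n → E, ∏ i, pS (a i, b i, e i) =
      ∏ i, ∑ b, ∑ e, pS (a i, b, e) := by
    intro a
    rw [sum_pair (fun w : Fin n → B × E => ∏ i, pS (a i, (w i).1, (w i).2)),
      sum_prod_fun (fun i (w : B × E) => pS (a i, w.1, w.2))]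
    simp only [Fintype.sum_prod_type]
  have h2 : ∀ x : Fin m → X, ∑ y : Fin m → Y, ∑ z : Fin m → Z, ∏ j, W (x j) (y j, z j) = 1 := by
    intro x
    have := ((tk2_kernel (n := m) hW) x).2
    rw [Fintype.sum_prod_type] at this
    exact this
  refine ⟨fun w => mul_nonneg (mul_nonneg (prod_nonneg fun _ _ => hS.1 _) ((hF _).1 _))
    (prod_nonneg fun _ _ => (hW _).1 _), ?_⟩
  simp only [Fintype.sum_prod_type, codeJoint]
  simp only [← mul_sum, h2, mul_one, (hF _).2, h1]
  rw [sum_prod_fun (fun (_ : Fin n) a => ∑ b, ∑ e, pS (a, b, e))]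
  have := hS.2
  simp only [Fintype.sum_prod_type] at this
  exact prod_eq_one fun _ _ => this

lemma H_cat {pS : A × B × E → ℝ} (hS : IsPMF pS) {W : X → Y × Z → ℝ} (hW : IsKernel W)
    {F : Fin N → (Fin n → A) → (Fin m → X) → ℝ} (hF : ∀ b, IsKernel (F b)) {α α' : Type} [Fintype α] [Fintype α']
    (f : (Fin n → A) × (Fin n → B) × (Fin n → E) × (Fin m → X) × (Fin m → Y) × (Fin m → Z) → α)
    (f' : (Fin (N * n) → A) × (Fin (N * n) → B) × (Fin (N * n) → E) × (Fin (N * m) → X) × (Fin (N * m) → Y) × (Fin (N * m) → Z) → α')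
    (h : ∀ x y, f' x = f' y ↔ ∀ b, f (blkAll A B E X Y Z N n m x b) = f (blkAll A B E X Y Z N n m y b)) :
    Hof (codeJoint pS W (Fcat F)) f' = ∑ b, Hof (codeJoint pS W (F b)) f := by
  rw [← Hof_prod _ (fun b => code_pmf hS hW (hF b)), ← Hof_equiv _ _ (blkAll A B E X Y Z N n m), code_cat]
  apply Hof_congr
  intro x y
  rw [h, funext_iff]

lemma condH_cat {pS : A × B × E → ℝ} (hS : IsPMF pS) {W : X → Y × Z → ℝ} (hW : IsKernel W)
    {F : Fin N → (Fin n → A) → (Fin m → X) → ℝ} (hF : ∀ b, IsKernel (F b)) :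
    condH (codeJoint pS W (Fcat F)) (fun w => w.1) (fun w => (w.2.2.1, w.2.2.2.2.2)) =
      ∑ b, condH (codeJoint pS W (F b)) (fun w => w.1) (fun w => (w.2.2.1, w.2.2.2.2.2)) := by
  unfold condH
  rw [sum_sub_distrib]
  have hb : ∀ {α : Type} {n : ℕ} (x y : Fin (N * n) → α), x = y ↔ ∀ b, blk N n x b = blk N n y b := fun x y => by
    rw [← funext_iff, Equiv.apply_eq_iff_eq]
  congr 1
  · refine H_cat hS hW hF _ _ (fun x y => ?_)
    simp only [Prod.mk.injEq, blkAll, Equiv.coe_fn_mk, forall_and]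
    rw [hb x.1, hb x.2.2.1, hb x.2.2.2.2.2]
  · refine H_cat hS hW hF _ _ (fun x y => ?_)
    simp only [Prod.mk.injEq, blkAll, Equiv.coe_fn_mk, forall_and]
    rw [hb x.2.2.1, hb x.2.2.2.2.2]

lemma dist_cat {pS : A × B × E → ℝ} (hS : IsPMF pS) {W : X → Y × Z → ℝ} (hW : IsKernel W)
    {F : Fin N → (Fin n → A) → (Fin m → X) → ℝ} (hF : ∀ b, IsKernel (F b))
    (g : Fin N → (Fin n → B) → (Fin m → Y) → Fin n → A) (d : A → A → ℝ) :
    expVal (codeJoint pS W (Fcat F)) (fun w => seqDist d w.1 (gcat g w.2.1 w.2.2.2.2.1)) =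
    (N : ℝ)⁻¹ * ∑ j, expVal (codeJoint pS W (F j)) (fun w => seqDist d w.1 (g j w.2.1 w.2.2.2.2.1)) := by
  have h1 : ∀ w : (Fin (N * n) → A) × (Fin (N * n) → B) × (Fin (N * n) → E) × (Fin (N * m) → X) × (Fin (N * m) → Y) × (Fin (N * m) → Z),
      seqDist d w.1 (gcat g w.2.1 w.2.2.2.2.1) = (N : ℝ)⁻¹ * ∑ j, seqDist d (blkAll A B E X Y Z N n m w j).1
        (g j (blkAll A B E X Y Z N n m w j).2.1 (blkAll A B E X Y Z N n m w j).2.2.2.2.1) := by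
    intro w
    unfold seqDist
    rw [blk_sum, ← mul_sum, ← mul_assoc]
    push_cast
    rw [mul_inv]
    congr 1
    refine sum_congr rfl fun j _ => sum_congr rfl fun i _ => ?_
    congr 1
    unfold gcat
    refine (blk_apply _ j i).symm.trans ?_
    rw [Equiv.apply_symm_apply]
    rfl
  unfold expVal
  simp only [h1]
  rw [code_cat]
  rw [Fintype.sum_equiv (blkAll A B E X Y Z N n m) _ (fun ω => (∏ b, codeJoint pS W (F b) (ω b)) * ((N : ℝ)⁻¹ *
    ∑ j, seqDist d (ω j).1 (g j (ω j).2.1 (ω j).2.2.2.2.1))) (fun _ => rfl)]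
  have h2 : ∀ ω : (Fin N → (Fin n → A) × (Fin n → B) × (Fin n → E) × (Fin m → X) × (Fin m → Y) × (Fin m → Z)),
      (∏ b, codeJoint pS W (F b) (ω b)) * ((N : ℝ)⁻¹ * ∑ j, seqDist d (ω j).1 (g j (ω j).2.1 (ω j).2.2.2.2.1)) =
      (N : ℝ)⁻¹ * ∑ j, (∏ b, codeJoint pS W (F b) (ω b)) * seqDist d (ω j).1 (g j (ω j).2.1 (ω j).2.2.2.2.1) := fun ω => by
    rw [← mul_sum]; ring
  simp only [h2]
  rw [← mul_sum, sum_comm]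
  congr 1
  refine sum_congr rfl fun j _ => ?_
  exact sum_prod_one (fun b => codeJoint pS W (F b)) (fun b => (code_pmf hS hW (hF b)).2) j
    (fun c => seqDist d c.1 (g j c.2.1 c.2.2.2.2.1))

end

lemma pick_seq {S : Type} [Fintype S] {w : S → ℝ} (hw : IsPMF w) (f1 f2 : S → ℝ) {ε : ℝ} (hε : 0 < ε) :
    ∃ (N : ℕ) (σ : Fin N → S), 0 < N ∧ expVal w f1 ≤ (N : ℝ)⁻¹ * ∑ b, f1 (σ b) + ε ∧
      expVal w f2 ≤ (N : ℝ)⁻¹ * ∑ b, f2 (σ b) + ε := by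
  classical
  have hne : Nonempty S := by
    by_contra h
    rw [not_nonempty_iff] at h
    have := hw.2
    simp at this
  set C := ∑ s, (|f1 s| + |f2 s|) with hC
  have hC0 : 0 ≤ C := sum_nonneg fun s _ => by positivity
  have hC1 : ∀ s, |f1 s| + |f2 s| ≤ C := fun s =>
    single_le_sum (f := fun s => |f1 s| + |f2 s|) (fun s _ => by positivity) (mem_univ s)
  obtain ⟨N, hN⟩ := exists_nat_gt ((2 * C * Fintype.card S) / ε)
  have hN0 : (0 : ℝ) < N := lt_of_le_of_lt (by positivity) hN
  have hNpos : 0 < N := by exact_mod_cast hN0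
  have hcard : Fintype.card (Σ s : S, Fin ⌊N * w s⌋₊) ≤ Fintype.card (Fin N) := by
    rw [Fintype.card_sigma, Fintype.card_fin]
    simp only [Fintype.card_fin]
    have : ((∑ s, ⌊N * w s⌋₊ : ℕ) : ℝ) ≤ N := by
      push_cast
      calc ∑ s, (⌊N * w s⌋₊ : ℝ) ≤ ∑ s, N * w s := sum_le_sum fun s _ => Nat.floor_le (mul_nonneg hN0.le (hw.1 s))
        _ = N := by rw [← mul_sum, hw.2, mul_one]
    exact_mod_cast this
  obtain ⟨j⟩ := Function.Embedding.nonempty_of_card_le hcard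
  set σ : Fin N → S := fun b => if h : ∃ x, j x = b then (Classical.choose h).1 else Classical.arbitrary S with hσ
  have hσj : ∀ x, σ (j x) = x.1 := fun x => by
    have h : ∃ y, j y = j x := ⟨x, rfl⟩
    simp only [hσ, dif_pos h]
    rw [j.injective (Classical.choose_spec h)]
  have key : ∀ f : S → ℝ, (∀ s, |f s| ≤ C) → expVal w f ≤ (N : ℝ)⁻¹ * ∑ b, f (σ b) + ε := by
    intro f hf
    have h1 : ∑ s, (⌊N * w s⌋₊ : ℝ) * (f s + C) ≤ ∑ b, (f (σ b) + C) := by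
      have : ∑ x : (Σ s : S, Fin ⌊N * w s⌋₊), (f (σ (j x)) + C) ≤ ∑ b, (f (σ b) + C) := by
        rw [← sum_map univ j (fun b => f (σ b) + C)]
        exact sum_le_sum_of_subset_of_nonneg (subset_univ _) (fun b _ _ => by linarith [(abs_le.1 (hf (σ b))).1])
      refine le_trans (le_of_eq ?_) this
      simp only [hσj]
      rw [Fintype.sum_sigma]
      refine sum_congr rfl fun s _ => ?_
      exact (by rw [sum_const, card_univ, Fintype.card_fin, nsmul_eq_mul] : ∑ _y : Fin ⌊N * w s⌋₊, (f s + C) = (⌊N * w s⌋₊ : ℝ) * (f s + C)).symm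
    have h2 : ∑ s, (N * w s - 1) * (f s + C) ≤ ∑ s, (⌊N * w s⌋₊ : ℝ) * (f s + C) :=
      sum_le_sum fun s _ => mul_le_mul_of_nonneg_right (by linarith [Nat.lt_floor_add_one (N * w s)])
        (by linarith [(abs_le.1 (hf s)).1])
    have h3 : ∑ s, (N * w s - 1) * (f s + C) = N * expVal w f + N * C - ∑ s, (f s + C) := by
      have e : ∀ s, (N * w s - 1) * (f s + C) = N * (w s * f s) + N * C * w s - (f s + C) := fun s => by ring
      simp only [e, sum_sub_distrib, sum_add_distrib, ← mul_sum, hw.2, expVal]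
      ring
    have h4 : ∑ s, (f s + C) ≤ 2 * C * Fintype.card S := by
      calc ∑ s, (f s + C) ≤ ∑ _s : S, (2 * C) := sum_le_sum fun s _ => by linarith [(abs_le.1 (hf s)).2]
        _ = _ := by simp; ring
    have h5 : ∑ b, (f (σ b) + C) = ∑ b, f (σ b) + N * C := by
      rw [sum_add_distrib]; simp
    have h6 : 2 * C * Fintype.card S ≤ N * ε := by
      rw [div_lt_iff₀ hε] at hN; linarith
    have h7 : N * expVal w f ≤ ∑ b, f (σ b) + N * ε := by linarith
    have h8 : expVal w f = (N : ℝ)⁻¹ * (N * expVal w f) := by field_simp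
    rw [h8]
    calc (N : ℝ)⁻¹ * (N * expVal w f) ≤ (N : ℝ)⁻¹ * (∑ b, f (σ b) + N * ε) := by gcongr
      _ = _ := by field_simp
  exact ⟨N, σ, hNpos, key f1 (fun s => by linarith [hC1 s, abs_nonneg (f2 s)]),
    key f2 (fun s => by linarith [hC1 s, abs_nonneg (f1 s)])⟩

section
variable {A B E X Y Z : Type} [Fintype A] [Fintype B] [Fintype E]
  [Fintype X] [Fintype Y] [Fintype Z] {n m : ℕ}

theorem derand {pS : A × B × E → ℝ} (hS : IsPMF pS) {W : X → Y × Z → ℝ} (hW : IsKernel W) (d : A → A → ℝ)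
    {S : Type} [Fintype S] {w : S → ℝ} (hw : IsPMF w) {F : S → (Fin n → A) → (Fin m → X) → ℝ}
    (hF : ∀ s, IsKernel (F s)) (g : S → (Fin n → B) → (Fin m → Y) → Fin n → A) (hn : 0 < n) {ε : ℝ} (hε : 0 < ε) :
    ∃ (N : ℕ) (F' : (Fin (N * n) → A) → (Fin (N * m) → X) → ℝ) 
      (g' : (Fin (N * n) → B) → (Fin (N * m) → Y) → Fin (N * n) → A), 0 < N ∧ IsKernel F' ∧
      expVal (codeJoint pS W F') (fun w => seqDist d w.1 (g' w.2.1 w.2.2.2.2.1)) ≤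
        expVal w (fun s => expVal (codeJoint pS W (F s)) (fun w => seqDist d w.1 (g s w.2.1 w.2.2.2.2.1))) + ε ∧
      expVal w (fun s => (n : ℝ)⁻¹ * condH (codeJoint pS W (F s)) (fun w => w.1)
            (fun w => (w.2.2.1, w.2.2.2.2.2))) - ε ≤
        ((N * n : ℕ) : ℝ)⁻¹ * condH (codeJoint pS W F') (fun w => w.1) (fun w => (w.2.2.1, w.2.2.2.2.2)) := by
  obtain ⟨N, σ, hN, h1, h2⟩ := pick_seq hw
    (fun s => - expVal (codeJoint pS W (F s)) (fun w => seqDist d w.1 (g s w.2.1 w.2.2.2.2.1)))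
    (fun s => (n : ℝ)⁻¹ * condH (codeJoint pS W (F s)) (fun w => w.1) (fun w => (w.2.2.1, w.2.2.2.2.2))) hε
  refine ⟨N, Fcat (fun b => F (σ b)), gcat (fun b => g (σ b)), hN, Fcat_kernel (fun b => hF _), ?_, ?_⟩
  · rw [dist_cat hS hW (fun b => hF (σ b))]
    have e : ∀ f : S → ℝ, expVal w (fun s => - f s) = - expVal w f := fun f => by
      unfold expVal; simp
    rw [e, sum_neg_distrib] at h1
    linarith
  · rw [condH_cat hS hW (fun b => hF (σ b))]
    rw [← mul_sum] at h2
    push_cast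
    rw [mul_inv, mul_assoc]
    linarith
end
end part11

section part12
lemma bayes {α β : Type} [Fintype α] [Fintype β] (j : α → β → ℝ) (h0 : ∀ a b, 0 ≤ j a b)
    (h1 : ∑ a, ∑ b, j a b = 1) : ∃ k : α → β → ℝ, IsKernel k ∧ ∀ a b, j a b = (∑ b, j a b) * k a b := by
  have hp : IsPMF (fun b => ∑ a, j a b) := ⟨fun b => sum_nonneg fun a _ => h0 a b, by rw [sum_comm]; exact h1⟩
  refine ⟨fun a b => if ∑ b, j a b = 0 then ∑ a, j a b else j a b / ∑ b, j a b, ?_, ?_⟩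
  · intro a
    by_cases h : ∑ b, j a b = 0
    · simp only [h, if_true]; exact hp
    · simp only [h, if_false]
      exact ⟨fun b => div_nonneg (h0 a b) (sum_nonneg fun b _ => h0 a b), by rw [← sum_div, div_self h]⟩
  · intro a b
    by_cases h : ∑ b, j a b = 0
    · simp only [h, if_true, zero_mul]
      exact (sum_eq_zero_iff_of_nonneg (fun b _ => h0 a b)).1 h b (mem_univ b)
    · simp only [h, if_false]; field_simp

section tri
variable {Ω α β γ : Type} [Fintype Ω] [Fintype α] [Fintype β] [Fintype γ]

/-- sums against the Markov chain `p k l` -/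
noncomputable def S3 (p : α → ℝ) (k : α → β → ℝ) (l : β → γ → ℝ) (G : α → β → γ → ℝ) : ℝ :=
  ∑ a, ∑ b, ∑ c, p a * k a b * l b c * G a b c

/-- `(fa, fb, fc)` is a Markov chain with law `p k l` under `P` -/
def TriH (P : Ω → ℝ) (fa : Ω → α) (fb : Ω → β) (fc : Ω → γ) (p : α → ℝ) (k : α → β → ℝ) (l : β → γ → ℝ) : Prop :=
  ∀ G : α → β → γ → ℝ, ∑ w, P w * G (fa w) (fb w) (fc w) = S3 p k l G

lemma S3_congr {p : α → ℝ} {k : α → β → ℝ} {l : β → γ → ℝ} {G G' : α → β → γ → ℝ}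
    (h : ∀ a b c, p a * k a b * l b c ≠ 0 → G a b c = G' a b c) : S3 p k l G = S3 p k l G' := by
  unfold S3
  refine sum_congr rfl fun a _ => sum_congr rfl fun b _ => sum_congr rfl fun c _ => ?_
  by_cases h0 : p a * k a b * l b c = 0
  · simp [h0]
  · rw [h a b c h0]

lemma S3_add (p : α → ℝ) (k : α → β → ℝ) (l : β → γ → ℝ) (G G' : α → β → γ → ℝ) :
    S3 p k l (fun a b c => G a b c + G' a b c) = S3 p k l G + S3 p k l G' := by
  simp only [S3, mul_add, sum_add_distrib]

lemma S3_sub (p : α → ℝ) (k : α → β → ℝ) (l : β → γ → ℝ) (G G' : α → β → γ → ℝ) :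
    S3 p k l (fun a b c => G a b c - G' a b c) = S3 p k l G - S3 p k l G' := by
  simp only [S3, mul_sub, sum_sub_distrib]

lemma Lo_S3 (p : α → ℝ) (k : α → β → ℝ) (l : β → γ → ℝ) (r : γ → α → β → ℝ) :
    Lo p k l r = S3 p k l (fun a b c => Real.log (r c a b)) := by
  unfold Lo S3 tri
  rw [sum_comm]
  refine sum_congr rfl fun a _ => ?_
  rw [sum_comm]

variable {P : Ω → ℝ} {fa : Ω → α} {fb : Ω → β} {fc : Ω → γ} {p : α → ℝ} {k : α → β → ℝ} {l : β → γ → ℝ}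

lemma S3_l (hl : IsKernel l) (g : α → β → ℝ) : S3 p k l (fun a b _ => g a b) = ∑ a, ∑ b, p a * k a b * g a b := by
  unfold S3
  refine sum_congr rfl fun a _ => sum_congr rfl fun b _ => ?_
  rw [← sum_mul, ← mul_sum, (hl b).2, mul_one]

lemma S3_ac (g : α → γ → ℝ) : S3 p k l (fun a _ c => g a c) = ∑ a, ∑ c, p a * kc k l a c * g a c := by
  unfold S3 kc
  refine sum_congr rfl fun a _ => ?_
  rw [sum_comm]
  refine sum_congr rfl fun c _ => ?_
  rw [mul_sum, sum_mul]
  exact sum_congr rfl fun b _ => by ring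

lemma S3_bc (g : β → γ → ℝ) : S3 p k l (fun _ b c => g b c) = ∑ b, ∑ c, pc p k b * l b c * g b c := by
  unfold S3 pc
  rw [sum_comm]
  refine sum_congr rfl fun b _ => ?_
  rw [sum_comm]
  refine sum_congr rfl fun c _ => ?_
  rw [sum_mul, sum_mul]

lemma S3_tri (h : TriH P fa fb fc p k l) (hp : IsPMF p) (hk : IsKernel k) (hl : IsKernel l) :
    Hof P fa * Real.log 2 = -S3 p k l (fun a _ _ => Real.log (p a)) ∧
    Hof P fb * Real.log 2 = -S3 p k l (fun _ b _ => Real.log (pc p k b)) ∧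
    Hof P fc * Real.log 2 = -S3 p k l (fun _ _ c => Real.log (pc p (kc k l) c)) ∧
    Hof P (fun w => (fa w, fb w)) * Real.log 2 = -S3 p k l (fun a b _ => Real.log (p a * k a b)) ∧
    Hof P (fun w => (fb w, fc w)) * Real.log 2 = -S3 p k l (fun _ b c => Real.log (pc p k b * l b c)) ∧
    Hof P (fun w => (fa w, fc w)) * Real.log 2 = -S3 p k l (fun a _ c => Real.log (p a * kc k l a c)) ∧
    Hof P (fun w => (fa w, fb w, fc w)) * Real.log 2 = -S3 p k l (fun a b c => Real.log (p a * k a b * l b c)) := by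
  have e1 : pushf P fa = p := pushf_eq _ _ _ fun g => by
    rw [h (fun a _ _ => g a), S3_l hl (fun a _ => g a)]
    refine sum_congr rfl fun a _ => ?_
    rw [← sum_mul, ← mul_sum, (hk a).2, mul_one]
  have e2 : pushf P fb = pc p k := pushf_eq _ _ _ fun g => by
    rw [h (fun _ b _ => g b), S3_bc (fun b _ => g b)]
    refine sum_congr rfl fun b _ => ?_
    rw [← sum_mul, ← mul_sum, (hl b).2, mul_one]
  have e3 : pushf P fc = pc p (kc k l) := pushf_eq _ _ _ fun g => by
    rw [h (fun _ _ c => g c), S3_ac (fun _ c => g c), sum_comm]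
    refine sum_congr rfl fun c _ => ?_
    rw [← sum_mul]; rfl
  have e4 : pushf P (fun w => (fa w, fb w)) = fun x => p x.1 * k x.1 x.2 := pushf_eq _ _ _ fun g => by
    rw [h (fun a b _ => g (a, b)), S3_l hl (fun a b => g (a, b)), Fintype.sum_prod_type]
  have e5 : pushf P (fun w => (fb w, fc w)) = fun x => pc p k x.1 * l x.1 x.2 := pushf_eq _ _ _ fun g => by
    rw [h (fun _ b c => g (b, c)), S3_bc (fun a b => g (a, b)), Fintype.sum_prod_type]
  have e6 : pushf P (fun w => (fa w, fc w)) = fun x => p x.1 * kc k l x.1 x.2 := pushf_eq _ _ _ fun g => by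
    rw [h (fun b _ c => g (b, c)), S3_ac (fun a b => g (a, b)), Fintype.sum_prod_type]
  have e7 : pushf P (fun w => (fa w, fb w, fc w)) = fun x => p x.1 * k x.1 x.2.1 * l x.2.1 x.2.2 := pushf_eq _ _ _ fun g => by
    rw [h (fun a b c => g (a, b, c)), S3, Fintype.sum_prod_type]
    exact sum_congr rfl fun a _ => by rw [Fintype.sum_prod_type]
  simp only [Hof_log, e1, e2, e3, e4, e5, e6, e7]
  exact ⟨by rw [← h], by rw [← h], by rw [← h], by rw [← h], by rw [← h], by rw [← h], by rw [← h]⟩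

lemma tri_facts (h : TriH P fa fb fc p k l) (hp : IsPMF p) (hk : IsKernel k) (hl : IsKernel l) :
    Lo p k l (rlp p k l) = (Hof P fc + Hof P fb - Hof P (fun w => (fb w, fc w))) * Real.log 2 ∧
    Lo p k l (rpl p k l) = -((Hof P fc + Hof P fb - Hof P (fun w => (fb w, fc w))) * Real.log 2) ∧
    Lo p k l (rkp p k l) = (Hof P fc + Hof P fa - Hof P (fun w => (fa w, fc w))) * Real.log 2 ∧
    Lo p k l (rkl k l) = (Hof P (fun w => (fb w, fc w)) - Hof P fb - Hof P (fun w => (fa w, fc w)) + Hof P fa) * Real.log 2 ∧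
    Lo p k l (fun c _ b => l b c) = -((Hof P (fun w => (fb w, fc w)) - Hof P fb) * Real.log 2) ∧
    S3 p k l (fun a _ c => Real.log (kc k l a c)) = -((Hof P (fun w => (fa w, fc w)) - Hof P fa) * Real.log 2) ∧
    Hof P (fun w => (fa w, fb w, fc w)) = Hof P (fun w => (fa w, fb w)) + Hof P (fun w => (fb w, fc w)) - Hof P fb := by
  obtain ⟨f1, f2, f3, f4, f5, f6, f7⟩ := S3_tri h hp hk hl
  have pos : ∀ a b c, p a * k a b * l b c ≠ 0 → 0 < l b c ∧ 0 < kc k l a c ∧ 0 < pc p (kc k l) c := fun a b c h0 =>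
    tri_pos hp hk hl h0
  have pp : ∀ a b c, p a * k a b * l b c ≠ 0 → p a ≠ 0 ∧ k a b ≠ 0 ∧ pc p k b ≠ 0 := fun a b c h0 => by
    have h1 : p a ≠ 0 := fun e => h0 (by rw [e]; ring)
    have h2 : k a b ≠ 0 := fun e => h0 (by rw [e]; ring)
    refine ⟨h1, h2, fun e => ?_⟩
    have := (sum_eq_zero_iff_of_nonneg (fun a _ => mul_nonneg (hp.1 a) ((hk a).1 b))).1 e a (mem_univ a)
    exact (mul_ne_zero h1 h2) this
  rw [S3_congr (G' := fun a b c => Real.log (p a) + Real.log (k a b))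
    (fun a b c h0 => Real.log_mul (pp a b c h0).1 (pp a b c h0).2.1), S3_add p k l (fun a _ _ => Real.log (p a)) (fun a b _ => Real.log (k a b))] at f4
  rw [S3_congr (G' := fun a b c => Real.log (pc p k b) + Real.log (l b c))
    (fun a b c h0 => Real.log_mul (pp a b c h0).2.2 (pos a b c h0).1.ne'), S3_add p k l (fun _ b _ => Real.log (pc p k b)) (fun _ b c => Real.log (l b c))] at f5
  rw [S3_congr (G' := fun a b c => Real.log (p a) + Real.log (kc k l a c))
    (fun a b c h0 => Real.log_mul (pp a b c h0).1 (pos a b c h0).2.1.ne'), S3_add p k l (fun a _ _ => Real.log (p a)) (fun a _ c => Real.log (kc k l a c))] at f6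
  rw [S3_congr (G' := fun a b c => Real.log (p a) + Real.log (k a b) + Real.log (l b c))
    (fun a b c h0 => by
      show Real.log _ = _
      rw [Real.log_mul (mul_ne_zero (pp a b c h0).1 (pp a b c h0).2.1) (pos a b c h0).1.ne', Real.log_mul (pp a b c h0).1 (pp a b c h0).2.1]),
    S3_add p k l (fun a b _ => Real.log (p a) + Real.log (k a b)) (fun _ b c => Real.log (l b c)),
    S3_add p k l (fun a _ _ => Real.log (p a)) (fun a b _ => Real.log (k a b))] at f7
  refine ⟨?_, ?_, ?_, ?_, ?_, ?_, ?_⟩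
  · rw [Lo_S3]
    simp only [rlp]
    rw [S3_congr (G' := fun a b c => Real.log (l b c) - Real.log (pc p (kc k l) c))
      (fun a b c h0 => Real.log_div (pos a b c h0).1.ne' (pos a b c h0).2.2.ne'), S3_sub p k l (fun _ b c => Real.log (l b c)) (fun _ _ c => Real.log (pc p (kc k l) c))]
    linarith
  · rw [Lo_S3]
    simp only [rpl]
    rw [S3_congr (G' := fun a b c => Real.log (pc p (kc k l) c) - Real.log (l b c))
      (fun a b c h0 => Real.log_div (pos a b c h0).2.2.ne' (pos a b c h0).1.ne'), S3_sub p k l (fun _ _ c => Real.log (pc p (kc k l) c)) (fun _ b c => Real.log (l b c))]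
    linarith
  · rw [Lo_S3]
    simp only [rkp]
    rw [S3_congr (G' := fun a b c => Real.log (kc k l a c) - Real.log (pc p (kc k l) c))
      (fun a b c h0 => Real.log_div (pos a b c h0).2.1.ne' (pos a b c h0).2.2.ne'), S3_sub p k l (fun a _ c => Real.log (kc k l a c)) (fun _ _ c => Real.log (pc p (kc k l) c))]
    linarith
  · rw [Lo_S3]
    simp only [rkl]
    rw [S3_congr (G' := fun a b c => Real.log (kc k l a c) - Real.log (l b c))
      (fun a b c h0 => Real.log_div (pos a b c h0).2.1.ne' (pos a b c h0).1.ne'), S3_sub p k l (fun a _ c => Real.log (kc k l a c)) (fun _ b c => Real.log (l b c))]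
    linarith
  · rw [Lo_S3]; linarith
  · linarith
  · have : Real.log 2 * (Hof P (fun w => (fa w, fb w, fc w)) - (Hof P (fun w => (fa w, fb w)) + Hof P (fun w => (fb w, fc w)) - Hof P fb)) = 0 := by linarith
    rcases mul_eq_zero.1 this with h | h
    · exact absurd h log2_ne
    · linarith

end tri

section cmi
variable {Ω α β γ : Type} [Fintype Ω] [Fintype α] [Fintype β] [Fintype γ]

/-- Conditional mutual information is nonnegative, quantitatively. -/
lemma cmi_l1 {P : Ω → ℝ} (hP : IsPMF P) (f : Ω → α) (g : Ω → β) (h : Ω → γ) (t : ℝ)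
    (ht : (Hof P (fun w => (f w, h w)) + Hof P (fun w => (g w, h w)) - Hof P h - Hof P (fun w => (f w, g w, h w))) * Real.log 2 ≤ t) :
    0 ≤ t ∧ ∑ x : α × β × γ, |pushf P (fun w => (f w, g w, h w)) x -
      pushf P (fun w => (f w, h w)) (x.1, x.2.2) * (pushf P (fun w => (g w, h w)) x.2 / pushf P h x.2.2)| ≤ 2 * √t := by
  set J := pushf P (fun w => (f w, g w, h w)) with hJ
  set p1 := pushf P (fun w => (f w, h w)) with hp1
  set p2 := pushf P (fun w => (g w, h w)) with hp2
  set p0 := pushf P h with hp0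
  have nn : ∀ {δ : Type} (φ : Ω → δ) x, 0 ≤ pushf P φ x := fun φ x => sum_nonneg fun c _ => by
    split_ifs
    · exact hP.1 c
    · exact le_rfl
  have mg2 : ∀ c, ∑ b, p2 (b, c) = p0 c := by
    have : pushf P h = fun c => ∑ b, p2 (b, c) := pushf_eq _ _ _ fun G => by
      rw [← pushf_sum P (fun w => (g w, h w)) (fun x => G x.2), Fintype.sum_prod_type_right]
      exact sum_congr rfl fun c _ => by rw [sum_mul]
    intro c; rw [hp0, this]
  have mg1 : ∀ c, ∑ a, p1 (a, c) = p0 c := by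
    have : pushf P h = fun c => ∑ a, p1 (a, c) := pushf_eq _ _ _ fun G => by
      rw [← pushf_sum P (fun w => (f w, h w)) (fun x => G x.2), Fintype.sum_prod_type_right]
      exact sum_congr rfl fun c _ => by rw [sum_mul]
    intro c; rw [hp0, this]
  have s0 : ∑ c, p0 c = 1 := by
    have := pushf_sum P h (fun _ => 1)
    simpa [hP.2] using this
  have sJ : ∑ x, J x = 1 := by
    have := pushf_sum P (fun w => (f w, g w, h w)) (fun _ => 1)
    simpa [hP.2] using this
  set μ : α × β × γ → ℝ := fun x => p1 (x.1, x.2.2) * (p2 x.2 / p0 x.2.2) with hμd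
  have μ0 : ∀ x, 0 ≤ μ x := fun x => mul_nonneg (nn _ _) (div_nonneg (nn _ _) (nn _ _))
  have hμ : IsPMF μ := by
    refine ⟨μ0, ?_⟩
    rw [Fintype.sum_prod_type_right, Fintype.sum_prod_type_right]
    rw [← s0]
    refine sum_congr rfl fun c _ => ?_
    simp only [hμd]
    simp only [← sum_mul, mg1, ← mul_sum, ← sum_div, mg2]
    by_cases hc : p0 c = 0
    · simp [hc]
    · field_simp
  have ac : ∀ x, J x ≠ 0 → 0 < J x ∧ 0 < p1 (x.1, x.2.2) ∧ 0 < p2 x.2 ∧ 0 < p0 x.2.2 := by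
    intro x hx
    have hJx : 0 < J x := lt_of_le_of_ne (nn _ _) (Ne.symm hx)
    have le : ∀ {δ : Type} (φ : α × β × γ → δ), J x ≤ pushf P (fun w => φ (f w, g w, h w)) (φ x) := by
      intro δ φ
      refine sum_le_sum fun c _ => ?_
      by_cases h1 : (f c, g c, h c) = x
      · simp [h1]
      · rw [if_neg h1]
        split_ifs
        · exact hP.1 c
        · exact le_rfl
    exact ⟨hJx, hJx.trans_le (le (fun y => (y.1, y.2.2))), hJx.trans_le (le (fun y => y.2)), hJx.trans_le (le (fun y => y.2.2))⟩
  have μx : ∀ x, μ x * (J x / μ x) = J x := by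
    intro x
    by_cases hx : J x = 0
    · simp [hx]
    · obtain ⟨a1, a2, a3, a4⟩ := ac x hx
      have : μ x ≠ 0 := (mul_pos a2 (div_pos a3 a4)).ne'
      field_simp
  have h1 : ∑ o, μ o * (J o / μ o) = 1 := by simp only [μx]; exact sJ
  have kl : ∑ o, μ o * (J o / μ o * Real.log (J o / μ o)) ≤ t := by
    refine le_trans (le_of_eq ?_) ht
    have e1 : ∀ o, μ o * (J o / μ o * Real.log (J o / μ o)) =
        J o * (Real.log (J o) - Real.log (p1 (o.1, o.2.2)) - Real.log (p2 o.2) + Real.log (p0 o.2.2)) := by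
      intro x
      rw [← mul_assoc, μx]
      by_cases hx : J x = 0
      · simp [hx]
      · obtain ⟨a1, a2, a3, a4⟩ := ac x hx
        have : μ x ≠ 0 := (mul_pos a2 (div_pos a3 a4)).ne'
        rw [Real.log_div a1.ne' this, hμd, Real.log_mul a2.ne' (div_pos a3 a4).ne', Real.log_div a3.ne' a4.ne']
        ring
    simp only [e1]
    rw [hJ, pushf_sum P (fun w => (f w, g w, h w)) (fun o => Real.log (J o) - Real.log (p1 (o.1, o.2.2)) - Real.log (p2 o.2) + Real.log (p0 o.2.2))]
    have := Hof_log P (fun w => (f w, g w, h w))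
    have := Hof_log P (fun w => (f w, h w))
    have := Hof_log P (fun w => (g w, h w))
    have := Hof_log P h
    simp only [mul_add, mul_sub, sum_add_distrib, sum_sub_distrib]
    simp only [← hJ, ← hp1, ← hp2, ← hp0] at *
    linarith
  refine ⟨?_, ?_⟩
  · refine le_trans ?_ kl
    have : ∑ o, (μ o * (J o / μ o) - μ o) ≤ ∑ o, μ o * (J o / μ o * Real.log (J o / μ o)) := by
      refine sum_le_sum fun o _ => ?_
      have hx : 0 ≤ J o / μ o := div_nonneg (nn _ _) (μ0 o)
      have : J o / μ o - 1 ≤ J o / μ o * Real.log (J o / μ o) := by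
        rcases hx.eq_or_lt with h | h
        · rw [← h]; norm_num
        · have := Real.one_sub_inv_le_log_of_pos h
          have := mul_le_mul_of_nonneg_left this h.le
          rw [mul_sub, mul_one, mul_inv_cancel₀ h.ne'] at this
          exact this
      have := mul_le_mul_of_nonneg_left this (μ0 o)
      linarith
    rw [sum_sub_distrib, h1, hμ.2] at this
    linarith
  · have := l1_of_kl μ (fun o => J o / μ o) hμ (fun o => div_nonneg (nn _ _) (μ0 o)) h1 t kl
    refine le_trans (le_of_eq (sum_congr rfl fun x _ => ?_)) this
    have : J x - μ x = μ x * (J x / μ x) - μ x := by rw [μx]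
    show |J x - μ x| = _
    rw [this, show μ x * (J x / μ x) - μ x = -(μ x * (1 - J x / μ x)) by ring, abs_neg, abs_mul, abs_of_nonneg (μ0 x)]

lemma cmi_nonneg {P : Ω → ℝ} (hP : IsPMF P) (f : Ω → α) (g : Ω → β) (h : Ω → γ) :
    0 ≤ Hof P (fun w => (f w, h w)) + Hof P (fun w => (g w, h w)) - Hof P h - Hof P (fun w => (f w, g w, h w)) := by
  have := (cmi_l1 hP f g h _ le_rfl).1
  exact nonneg_of_mul_nonneg_left this (Real.log_pos (by norm_num))

lemma Hof_unit {P : Ω → ℝ} (hP : IsPMF P) : Hof P (fun _ => ()) = 0 := by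
  have := Hof_log P (fun _ => ())
  have e : pushf P (fun _ => ()) () = 1 := by simp [pushf, hP.2]
  simp only [e, Real.log_one, mul_zero, sum_const_zero, neg_zero] at this
  exact (mul_eq_zero.1 this).resolve_right log2_ne

lemma mi_nonneg {P : Ω → ℝ} (hP : IsPMF P) (f : Ω → α) (g : Ω → β) :
    0 ≤ Hof P f + Hof P g - Hof P (fun w => (f w, g w)) := by
  have := cmi_nonneg hP f g (fun _ => ())
  rw [Hof_unit hP, Hof_congr P (fun w => (f w, ())) f (by simp), Hof_congr P (fun w => (g w, ())) g (by simp),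
    Hof_congr P (fun w => (f w, g w, ())) (fun w => (f w, g w)) (by simp)] at this
  linarith

end cmi
end part12

section part13
section chain
variable {α β γ δ η : Type} [Fintype α] [Fintype β] [Fintype γ] [Fintype δ] [Fintype η]

/-- law of a Markov chain whose last letter is a pair -/
noncomputable def ch (p : α → ℝ) (k : α → β → ℝ) (l : β → γ → ℝ) (m : γ → δ × η → ℝ) (w : α × β × γ × δ × η) : ℝ :=
  p w.1 * k w.1 w.2.1 * l w.2.1 w.2.2.1 * m w.2.2.1 (w.2.2.2.1, w.2.2.2.2)

variable (p : α → ℝ) (k : α → β → ℝ) (l : β → γ → ℝ) (m : γ → δ × η → ℝ)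

lemma ch_sum (G : α × β × γ × δ × η → ℝ) : ∑ w, ch p k l m w * G w =
    ∑ a, ∑ b, ∑ c, ∑ d, ∑ e, p a * k a b * l b c * m c (d, e) * G (a, b, c, d, e) := by
  simp only [Fintype.sum_prod_type, ch]

lemma ch_sumd (g : α → β → γ → δ → ℝ) : ∑ w, ch p k l m w * g w.1 w.2.1 w.2.2.1 w.2.2.2.1 =
    ∑ a, ∑ b, ∑ c, ∑ d, p a * k a b * l b c * m1 m c d * g a b c d := by
  rw [ch_sum p k l m (fun w => g w.1 w.2.1 w.2.2.1 w.2.2.2.1)]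
  refine sum_congr rfl fun a _ => sum_congr rfl fun b _ => sum_congr rfl fun c _ => sum_congr rfl fun d _ => ?_
  rw [m1, mul_sum, sum_mul]

lemma ch_sume (g : α → β → γ → η → ℝ) : ∑ w, ch p k l m w * g w.1 w.2.1 w.2.2.1 w.2.2.2.2 =
    ∑ a, ∑ b, ∑ c, ∑ d, p a * k a b * l b c * m2 m c d * g a b c d := by
  rw [ch_sum p k l m (fun w => g w.1 w.2.1 w.2.2.1 w.2.2.2.2)]
  refine sum_congr rfl fun a _ => sum_congr rfl fun b _ => sum_congr rfl fun c _ => ?_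
  rw [sum_comm]
  refine sum_congr rfl fun d _ => ?_
  rw [m2, mul_sum, sum_mul]

/-- auxiliary regrouping -/
lemma reg_b {ζ : Type} [Fintype ζ] (n : γ → ζ → ℝ) (g : α → β → ζ → ℝ) :
    ∑ a, ∑ b, ∑ c, ∑ d, p a * k a b * l b c * n c d * g a b d = S3 p k (kc l n) g := by
  unfold S3 kc
  refine sum_congr rfl fun a _ => sum_congr rfl fun b _ => ?_
  rw [sum_comm]
  refine sum_congr rfl fun d _ => ?_
  rw [mul_sum, sum_mul]
  exact sum_congr rfl fun c _ => by ring

lemma reg_c {ζ : Type} [Fintype ζ] (n : γ → ζ → ℝ) (g : α → γ → ζ → ℝ) :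
    ∑ a, ∑ b, ∑ c, ∑ d, p a * k a b * l b c * n c d * g a c d = S3 p (kc k l) n g := by
  unfold S3 kc
  refine sum_congr rfl fun a _ => ?_
  rw [sum_comm]
  refine sum_congr rfl fun c _ => ?_
  rw [sum_comm]
  refine sum_congr rfl fun d _ => ?_
  rw [mul_sum, sum_mul, sum_mul]
  exact sum_congr rfl fun b _ => by ring

lemma reg_a {ζ : Type} [Fintype ζ] (n : γ → ζ → ℝ) (g : β → γ → ζ → ℝ) :
    ∑ a, ∑ b, ∑ c, ∑ d, p a * k a b * l b c * n c d * g b c d = S3 (pc p k) l n g := by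
  unfold S3 pc
  rw [sum_comm]
  refine sum_congr rfl fun b _ => ?_
  rw [sum_comm]
  refine sum_congr rfl fun c _ => ?_
  rw [sum_comm]
  refine sum_congr rfl fun d _ => ?_
  rw [sum_mul, sum_mul, sum_mul]

variable {m}
lemma triA (hm : IsKernel m) : TriH (ch p k l m) (fun w => w.1) (fun w => w.2.1) (fun w => w.2.2.1) p k l := fun G => by
  rw [ch_sumd p k l m (fun a b c _ => G a b c)]
  unfold S3
  refine sum_congr rfl fun a _ => sum_congr rfl fun b _ => sum_congr rfl fun c _ => ?_
  rw [← sum_mul, ← mul_sum, (m1_kernel hm c).2, mul_one]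
variable (m)

lemma triB : TriH (ch p k l m) (fun w => w.1) (fun w => w.2.1) (fun w => w.2.2.2.1) p k (kc l (m1 m)) := fun G => by
  rw [ch_sumd p k l m (fun a b _ d => G a b d), reg_b]

lemma triB2 : TriH (ch p k l m) (fun w => w.1) (fun w => w.2.1) (fun w => w.2.2.2.2) p k (kc l (m2 m)) := fun G => by
  rw [ch_sume p k l m (fun a b _ d => G a b d), reg_b]

lemma triC : TriH (ch p k l m) (fun w => w.1) (fun w => w.2.2.1) (fun w => w.2.2.2.1) p (kc k l) (m1 m) := fun G => by
  rw [ch_sumd p k l m (fun a _ c d => G a c d), reg_c]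

lemma triC2 : TriH (ch p k l m) (fun w => w.1) (fun w => w.2.2.1) (fun w => w.2.2.2.2) p (kc k l) (m2 m) := fun G => by
  rw [ch_sume p k l m (fun a _ c d => G a c d), reg_c]

lemma triD : TriH (ch p k l m) (fun w => w.2.1) (fun w => w.2.2.1) (fun w => w.2.2.2.1) (pc p k) l (m1 m) := fun G => by
  rw [ch_sumd p k l m (fun _ b c d => G b c d), reg_a]

lemma triE : TriH (ch p k l m) (fun w => (w.1, w.2.1)) (fun w => w.2.2.1) (fun w => w.2.2.2.1)
    (fun x : α × β => p x.1 * k x.1 x.2) (fun x => l x.2) (m1 m) := fun G => by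
  rw [ch_sumd p k l m (fun a b c d => G (a, b) c d)]
  unfold S3
  rw [Fintype.sum_prod_type]

variable {p k l m}
lemma ch_pmf (hp : IsPMF p) (hk : IsKernel k) (hl : IsKernel l) (hm : IsKernel m) : IsPMF (ch p k l m) := by
  refine ⟨fun w => mul_nonneg (mul_nonneg (mul_nonneg (hp.1 _) ((hk _).1 _)) ((hl _).1 _)) ((hm _).1 _), ?_⟩
  have := triA p k l hm (fun _ _ _ => 1)
  simp only [mul_one] at this
  rw [this, S3_l hl (fun _ _ => 1)]
  simp only [mul_one, ← mul_sum, (hk _).2, hp.2]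

/-- All the entropy identities used, for a Markov chain law. -/
lemma ch_facts (hp : IsPMF p) (hk : IsKernel k) (hl : IsKernel l) (hm : IsKernel m)
    (P : α × β × γ × δ × η → ℝ) (hP : P = ch p k l m) :
    -- conditional informations
    condMutInf P (fun w => w.1) (fun w => w.2.2.1) (fun w => w.2.2.2.1) =
      Hof P (fun w => (w.1, w.2.2.2.1)) - Hof P (fun w => w.2.2.2.1) - Hof P (fun w => (w.1, w.2.2.1)) + Hof P (fun w => w.2.2.1) ∧
    condMutInf P (fun w => w.2.1) (fun w => w.2.2.1) (fun w => w.2.2.2.1) =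
      Hof P (fun w => (w.2.1, w.2.2.2.1)) - Hof P (fun w => w.2.2.2.1) - Hof P (fun w => (w.2.1, w.2.2.1)) + Hof P (fun w => w.2.2.1) ∧
    condMutInf P (fun w => w.2.1) (fun w => w.2.2.1) (fun w => (w.1, w.2.2.2.1)) =
      Hof P (fun w => (w.2.1, w.2.2.2.1)) - Hof P (fun w => (w.1, w.2.2.2.1)) - Hof P (fun w => (w.2.1, w.2.2.1)) + Hof P (fun w => (w.1, w.2.2.1)) ∧
    condH P (fun w => w.2.2.1) (fun w => (w.1, w.2.2.2.2)) =
      Hof P (fun w => (w.1, w.2.2.1)) + Hof P (fun w => (w.2.2.1, w.2.2.2.2)) - Hof P (fun w => w.2.2.1) - Hof P (fun w => (w.1, w.2.2.2.2)) ∧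
    condMutInf P (fun w => w.2.1) (fun w => w.2.2.2.1) (fun w => w.1) =
      Hof P (fun w => w.2.1) - Hof P (fun w => w.1) - Hof P (fun w => (w.2.1, w.2.2.2.1)) + Hof P (fun w => (w.1, w.2.2.2.1)) ∧
    condMutInf P (fun w => w.2.1) (fun w => w.2.2.2.2) (fun w => w.1) =
      Hof P (fun w => w.2.1) - Hof P (fun w => w.1) - Hof P (fun w => (w.2.1, w.2.2.2.2)) + Hof P (fun w => (w.1, w.2.2.2.2)) ∧
    -- nonnegativity
    0 ≤ Hof P (fun w => w.1) + Hof P (fun w => w.2.2.1) - Hof P (fun w => (w.1, w.2.2.1)) ∧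
    0 ≤ Hof P (fun w => (w.1, w.2.2.1)) - Hof P (fun w => w.1) - Hof P (fun w => (w.2.1, w.2.2.1)) + Hof P (fun w => w.2.1) ∧
    0 ≤ Hof P (fun w => (w.1, w.2.2.2.1)) - Hof P (fun w => w.1) - Hof P (fun w => (w.2.1, w.2.2.2.1)) + Hof P (fun w => w.2.1) ∧
    0 ≤ Hof P (fun w => (w.1, w.2.2.2.2)) - Hof P (fun w => w.1) - Hof P (fun w => (w.2.1, w.2.2.2.2)) + Hof P (fun w => w.2.1) ∧
    condH P (fun w => w.2.2.1) (fun w => (w.1, w.2.2.2.2)) ≤ condH P (fun w => w.2.2.1) (fun w => w.2.2.2.2) := by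
  subst hP
  set P := ch p k l m with hP
  have hPp : IsPMF P := ch_pmf hp hk hl hm
  have hpk : IsPMF (fun x : α × β => p x.1 * k x.1 x.2) := ⟨fun x => mul_nonneg (hp.1 _) ((hk _).1 _), by
    rw [Fintype.sum_prod_type]; simp only [← mul_sum, (hk _).2, mul_one, hp.2]⟩
  have MA := (tri_facts (triA p k l hm) hp hk hl).2.2.2.2.2.2
  have MB := (tri_facts (triB p k l m) hp hk (kc_kernel hl (m1_kernel hm))).2.2.2.2.2.2
  have MB2 := (tri_facts (triB2 p k l m) hp hk (kc_kernel hl (m2_kernel hm))).2.2.2.2.2.2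
  have MC := (tri_facts (triC p k l m) hp (kc_kernel hk hl) (m1_kernel hm)).2.2.2.2.2.2
  have MC2 := (tri_facts (triC2 p k l m) hp (kc_kernel hk hl) (m2_kernel hm)).2.2.2.2.2.2
  have MD := (tri_facts (triD p k l m) (pc_pmf hp hk) hl (m1_kernel hm)).2.2.2.2.2.2
  have ME := (tri_facts (triE p k l m) hpk (fun x => hl x.2) (m1_kernel hm)).2.2.2.2.2.2
  simp only [← hP] at MA MB MB2 MC MC2 MD ME
  have n1 := mi_nonneg hPp (fun w => w.1) (fun w => w.2.2.1)
  have n2 := cmi_nonneg hPp (fun w => w.2.1) (fun w => w.2.2.1) (fun w => w.1)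
  have n3 := cmi_nonneg hPp (fun w => w.2.1) (fun w => w.2.2.2.1) (fun w => w.1)
  have n4 := cmi_nonneg hPp (fun w => w.2.1) (fun w => w.2.2.2.2) (fun w => w.1)
  have n5 := cmi_nonneg hPp (fun w => w.2.2.1) (fun w => w.1) (fun w => w.2.2.2.2)
  have c1 := Hof_congr P (fun w => (w.2.1, w.2.2.2.1, w.1)) (fun w => (w.1, w.2.1, w.2.2.2.1)) (by simp; tauto)
  have c2 := Hof_congr P (fun w => (w.2.1, w.2.2.2.2, w.1)) (fun w => (w.1, w.2.1, w.2.2.2.2)) (by simp; tauto)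
  have c3 := Hof_congr P (fun w => (w.2.1, w.2.2.1, w.1)) (fun w => (w.1, w.2.1, w.2.2.1)) (by simp; tauto)
  have c4 := Hof_congr P (fun w => (w.2.1, w.1)) (fun w => (w.1, w.2.1)) (by simp; tauto)
  have c5 := Hof_congr P (fun w => (w.2.2.1, w.1)) (fun w => (w.1, w.2.2.1)) (by simp; tauto)
  have c6 := Hof_congr P (fun w => (w.2.2.2.1, w.1)) (fun w => (w.1, w.2.2.2.1)) (by simp; tauto)
  have c7 := Hof_congr P (fun w => (w.2.2.2.2, w.1)) (fun w => (w.1, w.2.2.2.2)) (by simp; tauto)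
  have c8 := Hof_congr P (fun w => (w.2.2.1, w.1, w.2.2.2.2)) (fun w => (w.1, w.2.2.1, w.2.2.2.2)) (by simp; tauto)
  have c9 := Hof_congr P (fun w => (w.2.1, w.2.2.1, w.1, w.2.2.2.1)) (fun w => ((w.1, w.2.1), w.2.2.1, w.2.2.2.1)) (by simp; tauto)
  have c10 := Hof_congr P (fun w => (w.2.1, w.1, w.2.2.2.1)) (fun w => (w.1, w.2.1, w.2.2.2.1)) (by simp; tauto)
  have c11 := Hof_congr P (fun w => (w.2.2.1, w.1, w.2.2.2.1)) (fun w => (w.1, w.2.2.1, w.2.2.2.1)) (by simp; tauto)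
  have c12 := Hof_congr P (fun w => ((w.1, w.2.1), w.2.2.1)) (fun w => (w.1, w.2.1, w.2.2.1)) (by simp; tauto)
  simp only [condMutInf, condH]
  clear_value P
  refine ⟨?_, ?_, ?_, ?_, ?_, ?_, ?_, ?_, ?_, ?_, ?_⟩ <;> linarith

end chain
end part13

section part14
lemma smooth {α β γ : Type} [Fintype α] [Fintype β] [Fintype γ] {p : α → ℝ} {k : α → β → ℝ} {l : β → γ → ℝ}
    (hp : IsPMF p) (hk : IsKernel k) (hl : IsKernel l) {t : ℝ} (ht : 0 < t) :
    ∃ pe : α → γ → ℝ, (∀ a c, 0 < pe a c) ∧ (∀ a, ∑ c, pe a c ≤ 1) ∧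
      (∃ C, 0 ≤ C ∧ ∀ a c, -Real.log (pe a c) ≤ C) ∧
      -S3 p k l (fun a _ c => Real.log (pe a c)) ≤ -S3 p k l (fun a _ c => Real.log (kc k l a c)) + t := by
  have hK := kc_kernel hk hl
  obtain ⟨a0⟩ : Nonempty α := by
    by_contra h
    have := not_nonempty_iff.1 h
    have := hp.2
    simp at this
  obtain ⟨c0⟩ : Nonempty γ := by
    by_contra h
    have := not_nonempty_iff.1 h
    have := (hK a0).2
    simp at this
  have hc : (0:ℝ) < Fintype.card γ := by exact_mod_cast Fintype.card_pos_iff.2 ⟨c0⟩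
  have hc1 : (1:ℝ) ≤ Fintype.card γ := by exact_mod_cast Fintype.card_pos_iff.2 ⟨c0⟩
  set s := Real.exp (-t) with hs
  have hs0 : 0 < s := Real.exp_pos _
  have hs1 : s < 1 := by rw [hs, Real.exp_lt_one_iff]; linarith
  have hlo : 0 < (1 - s) / Fintype.card γ := div_pos (by linarith) hc
  have pos : ∀ a c, (1 - s) / Fintype.card γ ≤ s * kc k l a c + (1 - s) / Fintype.card γ := fun a c => by
    have := mul_nonneg hs0.le ((hK a).1 c); linarith
  refine ⟨fun a c => s * kc k l a c + (1 - s) / Fintype.card γ, fun a c => hlo.trans_le (pos a c), ?_, ?_, ?_⟩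
  · intro a
    rw [sum_add_distrib, ← mul_sum, (hK a).2]
    simp only [sum_const, card_univ, nsmul_eq_mul]
    field_simp
    linarith
  · refine ⟨-Real.log ((1 - s) / Fintype.card γ), ?_, fun a c => neg_le_neg (Real.log_le_log hlo (pos a c))⟩
    have : (1 - s) / Fintype.card γ ≤ 1 := by
      rw [div_le_one hc]; linarith
    have := Real.log_nonpos hlo.le this
    linarith
  · have e : S3 p k l (fun a _ c => Real.log (kc k l a c) - t) = S3 p k l (fun a _ c => Real.log (kc k l a c)) - t := by
      rw [S3_sub p k l (fun a _ c => Real.log (kc k l a c)) (fun _ _ _ => t), S3_l hl (fun _ _ => t)]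
      simp only [← sum_mul, ← mul_sum, (hk _).2, mul_one, hp.2, one_mul]
    have : S3 p k l (fun a _ c => Real.log (kc k l a c) - t) ≤
        S3 p k l (fun a _ c => Real.log (s * kc k l a c + (1 - s) / Fintype.card γ)) := by
      unfold S3
      refine sum_le_sum fun a _ => sum_le_sum fun b _ => sum_le_sum fun c _ => ?_
      by_cases h0 : p a * k a b * l b c = 0
      · simp [h0]
      · refine mul_le_mul_of_nonneg_left ?_ (mul_nonneg (mul_nonneg (hp.1 a) ((hk a).1 b)) ((hl b).1 c))
        obtain ⟨_, h2, _⟩ := tri_pos hp hk hl (show tri p k l c a b ≠ 0 from h0)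
        have : Real.log (kc k l a c) - t = Real.log (s * kc k l a c) := by
          rw [Real.log_mul hs0.ne' h2.ne', hs, Real.log_exp]; ring
        refine this.le.trans ?_
        exact Real.log_le_log (mul_pos hs0 h2) (by linarith)
    rw [e] at this
    linarith

lemma params {iUA vau vbu yq zq qy uab k κ δ : ℝ} (h1 : 0 ≤ iUA) (h2 : 0 ≤ vau) (h3 : 0 ≤ vbu) (h4 : 0 ≤ yq)
    (h5 : 0 ≤ zq) (h6 : uab ≤ k * qy) (h7 : uab + (vau - vbu) ≤ k * (qy + yq)) (hk : 0 ≤ k) (hκ : k < κ)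
    (hδ : 0 < δ) (h8 : 3 * δ < (κ - k) * (qy + yq)) :
    ∃ r1 r2 r2' rL rL' : ℝ, 0 ≤ r1 ∧ r2 ≤ r2' ∧ 0 ≤ r2' ∧ rL ≤ rL' ∧ 0 ≤ rL' ∧ iUA < r1 ∧ iUA + vau < r1 + r2 ∧
      -(iUA + vau - (uab + (vau - vbu))) + κ * -(qy + yq) + (r1 + r2' + rL') < 0 ∧
      -vbu + κ * -yq + (r2 + rL') < 0 ∧ κ * -zq + rL < 0 ∧
      -iUA - max 0 ((vau - vbu) - k * (yq - zq)) - 4 * δ - (κ - k) * zq ≤ -r1 + rL - κ * zq := by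
  have hky : 0 ≤ k * yq := mul_nonneg hk h4
  have hkz : 0 ≤ k * zq := mul_nonneg hk h5
  have hy' : 0 ≤ (κ - k) * yq := mul_nonneg (by linarith) h4
  have hz' : 0 ≤ (κ - k) * zq := mul_nonneg (by linarith) h5
  rcases le_total (k * yq) (vau - vbu) with h | h
  · refine ⟨iUA + (vau - vbu - k * yq) + 3 * δ, vau - (vau - vbu - k * yq) - δ, vau - (vau - vbu - k * yq), -δ, 0,
      by linarith, by linarith, by linarith, by linarith, le_rfl, by linarith, by linarith, by linarith, by linarith, by linarith, ?_⟩
    have := le_max_right 0 ((vau - vbu) - k * (yq - zq))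
    linarith
  · refine ⟨iUA + 3 * δ, vau - δ, vau, min (k * zq) (k * yq - (vau - vbu)) - δ, min (k * zq) (k * yq - (vau - vbu)),
      by linarith, by linarith, by linarith, by linarith, le_min hkz (by linarith), by linarith, by linarith, ?_, ?_, ?_, ?_⟩
    · have := min_le_right (k * zq) (k * yq - (vau - vbu))
      linarith
    · have := min_le_right (k * zq) (k * yq - (vau - vbu))
      linarith
    · have := min_le_left (k * zq) (k * yq - (vau - vbu))
      linarith
    · rcases min_choice (k * zq) (k * yq - (vau - vbu)) with e | e <;> rw [e]
      · have := le_max_left 0 ((vau - vbu) - k * (yq - zq))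
        linarith
      · have := le_max_right 0 ((vau - vbu) - k * (yq - zq))
        linarith

lemma exists_rat {k b : ℝ} (hk : 0 ≤ k) (hb : k < b) : ∃ (p' q' : ℕ) (κ : ℝ), 0 < q' ∧ (p' : ℝ) = κ * q' ∧ k < κ ∧ κ < b := by
  obtain ⟨x, h1, h2⟩ := exists_rat_btwn hb
  refine ⟨x.num.toNat, x.den, x, x.den_pos, ?_, h1, h2⟩
  have hx : (0:ℝ) < x := lt_of_le_of_lt hk h1
  have hx' : 0 < x := by exact_mod_cast hx
  have hn : 0 ≤ x.num := (Rat.num_pos.2 hx').le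
  have h3 : ((x.num.toNat : ℤ) : ℝ) = x.num := by rw [Int.toNat_of_nonneg hn]
  have h4 : (x : ℝ) * x.den = x.num := by exact_mod_cast Rat.mul_den_eq_num x
  rw [h4, ← h3, Int.cast_natCast]
end part14

section part15
section
variable {A B E X Y Z U V Q T : Type} [Fintype A] [Fintype B] [Fintype E]
  [Fintype X] [Fintype Y] [Fintype Z] [Fintype U] [Fintype V] [Fintype Q] [Fintype T]

set_option maxHeartbeats 4000000 in
theorem main_case {pU : U → ℝ} {kV : U → V → ℝ} {kA : V → A → ℝ} {pQ : Q → ℝ} {kT : Q → T → ℝ}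
    {kX : T → X → ℝ} {kBE : A → B × E → ℝ} {W : X → Y × Z → ℝ} {pS : A × B × E → ℝ}
    (hU : IsPMF pU) (hV : IsKernel kV) (hA : IsKernel kA) (hQ : IsPMF pQ) (hT : IsKernel kT)
    (hX : IsKernel kX) (hBE : IsKernel kBE) (hW : IsKernel W) (hpS : IsPMF pS)
    (hS : ∀ w, pS w = pc pU (kc kV kA) w.1 * kBE w.1 w.2)
    (d : A → A → ℝ) (dmax : ℝ) (hd : ∀ a a', 0 ≤ d a a' ∧ d a a' ≤ dmax) (Ahat : V → B → A)
    (k D Δ : ℝ) (hk : 0 ≤ k)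
    (P : U × V × A × B × E → ℝ) (hP : P = ch pU kV kA kBE)
    (R : Q × T × X × Y × Z → ℝ) (hR : R = ch pQ kT kX W)
    (c1 : condMutInf P (fun w => w.1) (fun w => w.2.2.1) (fun w => w.2.2.2.1) ≤ k * mutInf R (fun w => w.1) (fun w => w.2.2.2.1))
    (c2 : condMutInf P (fun w => w.2.1) (fun w => w.2.2.1) (fun w => w.2.2.2.1) ≤ k * mutInf R (fun w => w.2.1) (fun w => w.2.2.2.1))
    (c3 : expVal P (fun w => d w.2.2.1 (Ahat w.2.1 w.2.2.2.1)) ≤ D)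
    (c4 : Δ ≤ condH P (fun w => w.2.2.1) (fun w => (w.1, w.2.2.2.2))
        - max 0 (condMutInf P (fun w => w.2.1) (fun w => w.2.2.1) (fun w => (w.1, w.2.2.2.1))
           - k * (condMutInf R (fun w => w.2.1) (fun w => w.2.2.2.1) (fun w => w.1)
                  - condMutInf R (fun w => w.2.1) (fun w => w.2.2.2.2) (fun w => w.1))))
    (hpos : 0 < mutInf R (fun w => w.2.1) (fun w => w.2.2.2.1)) :
    Achievable pS W d k D Δ := by
  intro ε hε
  obtain ⟨s1, s2, s3, s4, -, -, s7, s8, s9, -, -⟩ := ch_facts hU hV hA hBE P hP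
  obtain ⟨-, -, -, -, t5, t6, -, -, t9, t10, -⟩ := ch_facts hQ hT hX hW R hR
  have hkb := kc_kernel hA (m1_kernel hBE)
  have hky := kc_kernel hX (m1_kernel hW)
  have hkz := kc_kernel hX (m2_kernel hW)
  have hVA := kc_kernel hV hA
  obtain ⟨a1, -, a3, -⟩ := tri_facts (triA pU kV kA hBE) hU hV hA
  obtain ⟨-, b2, -, b4, -⟩ := tri_facts (triB pU kV kA kBE) hU hV hkb
  obtain ⟨-, y2, -, y4, -⟩ := tri_facts (triB pQ kT kX W) hQ hT hky
  obtain ⟨-, -, -, z4, z5, z6, -⟩ := tri_facts (triB2 pQ kT kX W) hQ hT hkz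
  obtain ⟨-, -, -, -, -, e6, -⟩ := tri_facts (triC2 pU kV kA kBE) hU hVA (m2_kernel hBE)
  obtain ⟨-, -, -, -, ae, -⟩ := S3_tri (triC2 pU kV kA kBE) hU hVA (m2_kernel hBE)
  rw [← hP] at a1 a3 b2 b4 e6 ae
  rw [← hR] at y2 y4 z4 z5 z6
  rw [S3_bc (fun b c => Real.log (pc pU (kc kV kA) b * m2 kBE b c))] at ae
  unfold mutInf at c1 c2 hpos
  rw [s1] at c1
  rw [s2] at c2
  rw [s3, s4, t5, t6] at c4
  have hdist : ∑ u, ∑ v, pU u * kV u v * ∑ a, kA v a * ∑ b, m1 kBE a b * d a (Ahat v b) ≤ D := by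
    refine le_trans (le_of_eq ?_) c3
    rw [expVal, hP, ch_sumd pU kV kA kBE (fun _ v a b => d a (Ahat v b))]
    refine sum_congr rfl fun u _ => sum_congr rfl fun v _ => ?_
    rw [mul_sum]
    refine sum_congr rfl fun a _ => ?_
    rw [mul_sum, mul_sum]
    exact sum_congr rfl fun b _ => by ring
  -- abbreviations
  generalize Hof P (fun w => w.1) = hu at *
  generalize Hof P (fun w => w.2.1) = hv at *
  generalize Hof P (fun w => w.2.2.1) = ha at *
  generalize Hof P (fun w => w.2.2.2.1) = hb at *
  generalize Hof P (fun w => (w.1, w.2.2.1)) = hua at *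
  generalize Hof P (fun w => (w.2.1, w.2.2.1)) = hva at *
  generalize Hof P (fun w => (w.1, w.2.2.2.1)) = hub at *
  generalize Hof P (fun w => (w.2.1, w.2.2.2.1)) = hvb at *
  generalize Hof P (fun w => (w.1, w.2.2.2.2)) = hue at *
  generalize Hof P (fun w => (w.2.2.1, w.2.2.2.2)) = hae at *
  generalize Hof R (fun w => w.1) = hq at *
  generalize Hof R (fun w => w.2.1) = ht at *
  generalize Hof R (fun w => w.2.2.2.1) = hy at *
  generalize Hof R (fun w => (w.1, w.2.2.2.1)) = hqy at *
  generalize Hof R (fun w => (w.2.1, w.2.2.2.1)) = hty at *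
  generalize Hof R (fun w => (w.1, w.2.2.2.2)) = hqz at *
  generalize Hof R (fun w => (w.2.1, w.2.2.2.2)) = htz at *
  clear s1 s2 s3 s4 t5 t6 c3
  have L0 : 0 < Real.log 2 := Real.log_pos (by norm_num)
  have L1 : Real.log 2 < 1 := Real.log_two_lt_d9.trans (by norm_num)
  set L := Real.log 2 with hL
  set zq := (ht - hq - htz + hqz) * L with hzq
  have hzq0 : 0 ≤ zq := mul_nonneg (by linarith) L0.le
  set e0 := ε * L / 16 with he0
  have he00 : 0 < e0 := by positivity
  obtain ⟨p', q', κ, hq', hκ, hκ1, hκ2⟩ := exists_rat (b := k + min (min 1 ε) (e0 / (zq + 1))) hk (by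
    have : 0 < min (min 1 ε) (e0 / (zq + 1)) := lt_min (lt_min one_pos hε) (by positivity)
    linarith)
  have hκa : κ < k + 1 := by have := (min_le_left (min 1 ε) (e0 / (zq + 1))).trans (min_le_left _ _); linarith only [this, hκ2]
  have hκb : κ < k + ε := by have := (min_le_left (min 1 ε) (e0 / (zq + 1))).trans (min_le_right _ _); linarith only [this, hκ2]
  have hκc : (κ - k) * zq ≤ e0 := by
    have h1 : κ - k ≤ e0 / (zq + 1) := by have := min_le_right (min 1 ε) (e0 / (zq + 1)); linarith only [this, hκ2]
    have := (le_div_iff₀ (by linarith)).1 h1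
    nlinarith only [this, hzq0, hκ1, he00]
  set ty := (ht + hy - hty) * L with hty'
  have hty0 : 0 < ty := mul_pos hpos L0
  set δ := min e0 ((κ - k) * ty / 4) with hδ
  have hδ1 : δ ≤ e0 := min_le_left _ _
  have hx0 : 0 < (κ - k) * ty := mul_pos (by linarith) hty0
  have hδ0 : 0 < δ := lt_min he00 (by linarith)
  have hδ2 : 3 * δ < (κ - k) * ty := by have := min_le_right e0 ((κ - k) * ty / 4); linarith
  have c1' : (hub - hb - hua + ha) * L ≤ k * ((hq + hy - hqy) * L) := by
    have := mul_le_mul_of_nonneg_right c1 L0.le; linarith only [this]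
  have c2' : (hvb - hb - hva + ha) * L ≤ k * ((ht + hy - hty) * L) := by
    have := mul_le_mul_of_nonneg_right c2 L0.le; linarith only [this]
  obtain ⟨r1, r2, r2', rL, rL', q1, q2, q3, q4, q5, q6, q7, q8, q9, q10, q11⟩ :=
    params (iUA := (hu + ha - hua) * L) (vau := (hua - hu - hva + hv) * L) (vbu := (hub - hu - hvb + hv) * L)
      (yq := (ht - hq - hty + hqy) * L) (zq := zq) (qy := (hq + hy - hqy) * L) (uab := (hub - hb - hua + ha) * L)
      (k := k) (κ := κ) (δ := δ) (mul_nonneg s7 L0.le) (mul_nonneg s8 L0.le) (mul_nonneg s9 L0.le)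
      (mul_nonneg (by linarith only [t9]) L0.le) hzq0 c1' (by linarith only [c2']) hk hκ1 hδ0 (by
        refine hδ2.trans_le (le_of_eq ?_); rw [hty']; ring)
  set η := e0 / (k + 2) with hη
  have hη0 : 0 < η := by positivity
  have hκ0 : 0 ≤ κ := hk.trans hκ1.le
  have hηb : η + κ * η ≤ e0 := by
    have h2 : η * (k + 2) = e0 := by rw [hη]; field_simp
    have : κ * η ≤ (k + 1) * η := mul_le_mul_of_nonneg_right hκa.le hη0.le
    linarith only [this, h2]
  obtain ⟨pe, pe0, pe1, ⟨CE, CE0, hCE⟩, pe2⟩ := smooth hU hVA (m2_kernel hBE) hη0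
  obtain ⟨pz, pz0, pz1, -, pz2⟩ := smooth hQ hT hkz hη0
  obtain ⟨N, hN, S, iS, w, F, g, hw, hF, hdi, heq⟩ := core hU hV hA hQ hT hX hBE hW hS d dmax hd Ahat pe pz pe0 pe1 pz0 pz1
    CE hCE CE0 p' q' hq' κ hκ r1 r2 r2' rL rL' q1 q2 q3 q4 q5 (by rw [a3]; linarith only [q6]) (by rw [a1]; linarith only [q7])
    (by rw [b2, y2]; linarith only [q8]) (by rw [b4, y4]; linarith only [q9]) (by rw [z4]; linarith only [q10, hzq]) he00
  obtain ⟨M, F', g', hM, hF', hd', he'⟩ := derand (ε := ε / 2) hpS hW d hw hF g (Nat.mul_pos hq' hN) (half_pos hε)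
  refine ⟨M * (q' * N), M * (p' * N), Nat.mul_pos hM (Nat.mul_pos hq' hN), F', g', hF', ?_, ?_, ?_⟩
  · have : ((M * (p' * N) : ℕ) : ℝ) = κ * ((M * (q' * N) : ℕ) : ℝ) := by push_cast; rw [hκ]; ring
    rw [this, mul_div_assoc, div_self, mul_one]
    · exact hκb.le
    · exact_mod_cast (Nat.mul_pos hM (Nat.mul_pos hq' hN)).ne'
  · have : e0 ≤ ε / 2 := by rw [he0]; nlinarith only [hε, L0, L1]
    linarith only [this, hd', hdi, hdist]
  · refine le_trans ?_ he'
    have hLE : ∑ u, ∑ v, pU u * kV u v * ∑ a, kA v a * ∑ e, m2 kBE a e * (- Real.log (pe u e)) =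
        -S3 pU (kc kV kA) (m2 kBE) (fun a _ c => Real.log (pe a c)) := by
      rw [← reg_c pU kV kA (m2 kBE) (fun a _ c => Real.log (pe a c))]
      simp only [mul_sum, ← sum_neg_distrib]
      refine sum_congr rfl fun u _ => sum_congr rfl fun v _ => sum_congr rfl fun a _ => sum_congr rfl fun e _ => by ring
    have hLZ : ∑ q, ∑ t, pQ q * kT q t * ∑ z, kc kX (m2 W) t z * (- Real.log (pz q z)) =
        -S3 pQ kT (kc kX (m2 W)) (fun a _ c => Real.log (pz a c)) := by
      unfold S3
      simp only [mul_sum, ← sum_neg_distrib]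
      refine sum_congr rfl fun u _ => sum_congr rfl fun v _ => sum_congr rfl fun a _ => by ring
    rw [hLE, hLZ, z5] at heq
    rw [e6] at pe2
    rw [z6] at pz2
    have pz3 := mul_le_mul_of_nonneg_left pz2 hκ0
    have hx : expVal w (fun s => ((q' * N : ℕ) : ℝ)⁻¹ * condH (codeJoint pS W (F s)) (fun w => w.1)
            (fun w => (w.2.2.1, w.2.2.2.2.2)) * L) = expVal w (fun s => ((q' * N : ℕ) : ℝ)⁻¹ * condH (codeJoint pS W (F s)) (fun w => w.1)
            (fun w => (w.2.2.1, w.2.2.2.2.2))) * L := by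
      unfold expVal; rw [sum_mul]; exact sum_congr rfl fun s _ => by ring
    rw [hx] at heq
    set Ξ := expVal w (fun s => ((q' * N : ℕ) : ℝ)⁻¹ * condH (codeJoint pS W (F s)) (fun w => w.1)
            (fun w => (w.2.2.1, w.2.2.2.2.2))) with hΞ
    have c4' := mul_le_mul_of_nonneg_right c4 L0.le
    rw [sub_mul, max_mul_of_nonneg _ _ L0.le, zero_mul] at c4'
    have hm : (hvb - hub - hva + hua - k * (ht - hq - hty + hqy - (ht - hq - htz + hqz))) * L =
        (hua - hu - hva + hv) * L - (hub - hu - hvb + hv) * L - k * ((ht - hq - hty + hqy) * L - zq) := by rw [hzq]; ring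
    rw [hm] at c4'
    have fin : Δ * L - 7 * e0 ≤ Ξ * L := by
      rw [← ae] at heq
      have hκz : κ * zq = κ * ((ht - hq - htz + hqz) * L) := by rw [hzq]
      linarith only [heq, pe2, pz3, q11, c4', hκc, hηb, hδ1, hκz]
    have : (Δ - ε / 2) * L ≤ Ξ * L := by
      have : 7 * e0 ≤ ε / 2 * L := by rw [he0]; nlinarith only [mul_pos hε L0]
      linarith only [this, fin]
    have := le_of_mul_le_mul_right this L0
    linarith only [this]
end
end part15

section part16
lemma Hof_push {Ω β α : Type} [Fintype Ω] [Fintype β] [Fintype α] {P : Ω → ℝ} {Q : β → ℝ} {π : Ω → β}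
    (h : ∀ G : β → ℝ, ∑ w, P w * G (π w) = ∑ x, Q x * G x) (φ : β → α) :
    Hof P (fun w => φ (π w)) = Hof Q φ := by
  unfold Hof
  rw [pushf_eq P (fun w => φ (π w)) (pushf Q φ) fun g => by rw [pushf_sum, h (fun x => g (φ x))]]

section
variable {A B E X Y Z U V : Type} [Fintype A] [Fintype B] [Fintype E]
  [Fintype X] [Fintype Y] [Fintype Z] [Fintype U] [Fintype V]

lemma one_zero_sum (pS : A × B × E → ℝ) (W : X → Y × Z → ℝ) (G : A × B × E → ℝ) :
    ∑ w, codeJoint pS W (n := 1) (m := 0) (fun _ _ => 1) w * G (w.1 0, w.2.1 0, w.2.2.1 0) = ∑ x, pS x * G x := by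
  simp only [codeJoint, Fintype.sum_prod_type, Fin.prod_univ_one, Finset.univ_eq_empty, Finset.prod_empty, mul_one,
    Fintype.sum_unique]
  rw [← (Equiv.funUnique (Fin 1) A).symm.sum_comp]
  refine sum_congr rfl fun a _ => ?_
  rw [← (Equiv.funUnique (Fin 1) B).symm.sum_comp]
  refine sum_congr rfl fun b _ => ?_
  rw [← (Equiv.funUnique (Fin 1) E).symm.sum_comp]
  rfl

theorem special_case {W : X → Y × Z → ℝ} {pS : A × B × E → ℝ}
    (d : A → A → ℝ) (Ahat : V → B → A)
    (k D Δ : ℝ) (hk : 0 ≤ k)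
    (P : U × V × A × B × E → ℝ) (hP : IsPMF P) (hPS : ∀ G : A × B × E → ℝ, ∑ w, P w * G w.2.2 = ∑ x, pS x * G x)
    (c2 : condMutInf P (fun w => w.2.1) (fun w => w.2.2.1) (fun w => w.2.2.2.1) ≤ 0)
    (c3 : expVal P (fun w => d w.2.2.1 (Ahat w.2.1 w.2.2.2.1)) ≤ D)
    (c4 : Δ ≤ condH P (fun w => w.2.2.1) (fun w => w.2.2.2.2)) :
    Achievable pS W d k D Δ := by
  intro ε hε
  have hne : Nonempty V := by
    by_contra h
    have := not_nonempty_iff.1 h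
    have := hP.2
    simp at this
  set p1 := pushf P (fun w => (w.2.2.1, w.2.2.2.1)) with hp1
  have hmin : ∀ b, ∃ v, ∀ v', ∑ a, p1 (a, b) * d a (Ahat v b) ≤ ∑ a, p1 (a, b) * d a (Ahat v' b) := fun b =>
    Finite.exists_min (fun v => ∑ a, p1 (a, b) * d a (Ahat v b))
  choose vs hvs using hmin
  refine ⟨1, 0, one_pos, fun _ _ => 1, fun b _ _ => Ahat (vs (b 0)) (b 0), ?_, ?_, ?_, ?_⟩
  · intro a
    exact ⟨fun _ => zero_le_one, by simp⟩
  · simp; linarith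
  · refine le_trans ?_ (le_add_of_nonneg_right hε.le)
    refine le_trans ?_ c3
    have e1 := one_zero_sum pS W (fun x => d x.1 (Ahat (vs x.2.1) x.2.1))
    rw [← hPS (fun x => d x.1 (Ahat (vs x.2.1) x.2.1))] at e1
    have e2 : expVal (codeJoint pS W (n := 1) (m := 0) (fun _ _ => 1))
        (fun w => seqDist d w.1 (fun _ => Ahat (vs (w.2.1 0)) (w.2.1 0))) =
        ∑ w, P w * d w.2.2.1 (Ahat (vs w.2.2.2.1) w.2.2.2.1) := by
      rw [← e1]
      unfold expVal seqDist
      simp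
    rw [e2, ← pushf_sum P (fun w => (w.2.2.1, w.2.2.2.1)) (fun x => d x.1 (Ahat (vs x.2) x.2)), ← hp1]
    set J := pushf P (fun w => (w.2.2.1, w.2.1, w.2.2.2.1)) with hJ
    have e3 : expVal P (fun w => d w.2.2.1 (Ahat w.2.1 w.2.2.2.1)) = ∑ x, J x * d x.1 (Ahat x.2.1 x.2.2) := by
      rw [hJ, pushf_sum]; rfl
    rw [e3]
    set p2 := pushf P (fun w => (w.2.1, w.2.2.2.1)) with hp2
    set p0 := pushf P (fun w => w.2.2.2.1) with hp0
    have ind : ∀ x, J x = p1 (x.1, x.2.2) * (p2 x.2 / p0 x.2.2) := by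
      have := (cmi_l1 hP (fun w => w.2.2.1) (fun w => w.2.1) (fun w => w.2.2.2.1) 0 (by
        refine mul_nonpos_of_nonpos_of_nonneg ?_ (Real.log_nonneg (by norm_num))
        simp only [condMutInf, condH] at c2
        have cc := Hof_congr P (fun w => (w.2.2.1, w.2.1, w.2.2.2.1)) (fun w => (w.2.1, w.2.2.1, w.2.2.2.1)) (by simp; tauto)
        linarith)).2
      rw [Real.sqrt_zero, mul_zero] at this
      intro x
      have h0 := (sum_eq_zero_iff_of_nonneg (fun _ _ => abs_nonneg _)).1 (le_antisymm this (sum_nonneg fun _ _ => abs_nonneg _)) x (mem_univ x)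
      have := abs_eq_zero.1 h0
      linarith
    have mg2 : ∀ c, ∑ b, p2 (b, c) = p0 c := by
      have : pushf P (fun w => w.2.2.2.1) = fun c => ∑ b, p2 (b, c) := pushf_eq _ _ _ fun G => by
        rw [← pushf_sum P (fun w => (w.2.1, w.2.2.2.1)) (fun x => G x.2), Fintype.sum_prod_type_right]
        exact sum_congr rfl fun c _ => by rw [sum_mul]
      intro c; rw [hp0, this]
    have mg1 : ∀ c, ∑ b, p1 (b, c) = p0 c := by
      have : pushf P (fun w => w.2.2.2.1) = fun c => ∑ b, p1 (b, c) := pushf_eq _ _ _ fun G => by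
        rw [← pushf_sum P (fun w => (w.2.2.1, w.2.2.2.1)) (fun x => G x.2), Fintype.sum_prod_type_right]
        exact sum_congr rfl fun c _ => by rw [sum_mul]
      intro c; rw [hp0, this]
    have nn : ∀ {δ : Type} (φ : _ → δ) x, 0 ≤ pushf P φ x := fun φ x => sum_nonneg fun c _ => by
      split_ifs
      · exact hP.1 c
      · exact le_rfl
    simp only [ind]
    rw [Fintype.sum_prod_type_right, Fintype.sum_prod_type_right, Fintype.sum_prod_type_right]
    refine sum_le_sum fun b _ => ?_
    by_cases hb : p0 b = 0
    · have : ∀ a, p1 (a, b) = 0 := fun a =>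
        (sum_eq_zero_iff_of_nonneg (fun a _ => nn _ (a, b))).1 ((mg1 b).trans hb) a (mem_univ a)
      simp [this]
    · have e4 : ∀ v, ∑ a, p1 (a, b) * (p2 (v, b) / p0 b) * d a (Ahat v b) =
          (p2 (v, b) / p0 b) * ∑ a, p1 (a, b) * d a (Ahat v b) := fun v => by
        rw [mul_sum]; exact sum_congr rfl fun a _ => by ring
      simp only [e4]
      calc ∑ a, p1 (a, b) * d a (Ahat (vs b) b) = ∑ v, (p2 (v, b) / p0 b) * ∑ a, p1 (a, b) * d a (Ahat (vs b) b) := by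
            rw [← sum_mul, ← sum_div, mg2, div_self hb, one_mul]
        _ ≤ _ := sum_le_sum fun v _ => mul_le_mul_of_nonneg_left (hvs b v) (div_nonneg (nn _ _) (nn _ _))
  · refine (sub_le_self _ hε.le).trans (c4.trans (le_of_eq ?_))
    simp only [condH, Nat.cast_one, inv_one, one_mul]
    have z1 := Hof_congr (codeJoint pS W (n := 1) (m := 0) (fun _ _ => 1))
      (fun w => (w.1, w.2.2.1, w.2.2.2.2.2)) (fun w => (w.1 0, w.2.2.1 0)) (by
        intro x y; simp [funext_iff, Fin.forall_fin_one])
    have z2 := Hof_congr (codeJoint pS W (n := 1) (m := 0) (fun _ _ => 1))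
      (fun w => (w.2.2.1, w.2.2.2.2.2)) (fun w => w.2.2.1 0) (by
        intro x y; simp [funext_iff, Fin.forall_fin_one])
    have z3 := Hof_push (one_zero_sum pS W) (fun x => (x.1, x.2.2))
    have z4 := Hof_push (one_zero_sum pS W) (fun x => x.2.2)
    have z5 := Hof_push hPS (fun x => (x.1, x.2.2))
    have z6 := Hof_push hPS (fun x => x.2.2)
    rw [z1, z2]
    rw [z3, z4, ← z5, ← z6]
end

section
variable {A B E X Y Z : Type} [Fintype A] [Fintype B] [Fintype E]
  [Fintype X] [Fintype Y] [Fintype Z]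

lemma source_marg {U V : Type} [Fintype U] [Fintype V] {pS : A × B × E → ℝ} {pU : V → U → ℝ} {pV : A → V → ℝ}
    (hU : IsKernel pU) (hV : IsKernel pV) (G : A × B × E → ℝ) :
    ∑ w, sourceJointChain pS pU pV w * G w.2.2 = ∑ x, pS x * G x := by
  rw [Fintype.sum_prod_type, sum_comm, Fintype.sum_prod_type, sum_comm]
  refine sum_congr rfl fun x _ => ?_
  simp only [sourceJointChain]
  simp only [← sum_mul, (hU _).2, one_mul, (hV _).2]

theorem final
    (pS : A × B × E → ℝ) (hpS : IsPMF pS)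
    (Wch : X → Y × Z → ℝ) (hW : IsKernel Wch)
    (d : A → A → ℝ) (dmax : ℝ)
    (hd : ∀ a a', 0 ≤ d a a' ∧ d a a' ≤ dmax)
    (k D Δ : ℝ) (hk : 0 ≤ k) (U V Q T : Type) [Fintype U] [Fintype V] [Fintype Q] [Fintype T]
    (h : DigitalCond U V Q T pS Wch d k D Δ) :
    Achievable pS Wch d k D Δ := by
  obtain ⟨pU, pV, pQ, pT, pXk, Ahat, hU, hV, hQ, hT, hX, c1, c2, c3, c4⟩ := h
  obtain ⟨kBE, hBE, eBE⟩ := bayes (fun a (x : B × E) => pS (a, x)) (fun a x => hpS.1 _) (by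
    rw [← hpS.2, Fintype.sum_prod_type])
  set pA : A → ℝ := fun a => ∑ x, pS (a, x) with hpA
  have pA0 : ∀ a, 0 ≤ pA a := fun a => sum_nonneg fun x _ => hpS.1 _
  have pA1 : ∑ a, pA a = 1 := by rw [hpA, ← hpS.2, Fintype.sum_prod_type]
  obtain ⟨kA, hA, eA⟩ := bayes (fun v a => pA a * pV a v) (fun v a => mul_nonneg (pA0 a) ((hV a).1 v)) (by
    rw [sum_comm]; simp only [← mul_sum, (hV _).2, mul_one, pA1])
  set pV' : V → ℝ := fun v => ∑ a, pA a * pV a v with hpV'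
  have pV0 : ∀ v, 0 ≤ pV' v := fun v => sum_nonneg fun a _ => mul_nonneg (pA0 a) ((hV a).1 v)
  have pV1 : ∑ v, pV' v = 1 := by
    rw [hpV', sum_comm]; simp only [← mul_sum, (hV _).2, mul_one, pA1]
  have hj3 : ∑ u, ∑ v, pV' v * pU v u = 1 := by
    rw [sum_comm]; simp only [← mul_sum, (hU _).2, mul_one, pV1]
  obtain ⟨kV, hkV, eV⟩ := bayes (fun u v => pV' v * pU v u) (fun u v => mul_nonneg (pV0 v) ((hU v).1 u)) hj3
  set pU' : U → ℝ := fun u => ∑ v, pV' v * pU v u with hpU'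
  have hpU1 : IsPMF pU' := ⟨fun u => sum_nonneg fun v _ => mul_nonneg (pV0 v) ((hU v).1 u), hj3⟩
  have eV' : ∀ u v, pV' v * pU v u = pU' u * kV u v := eV
  have eA' : ∀ v a, pA a * pV a v = pV' v * kA v a := eA
  have eBE' : ∀ a x, pS (a, x) = pA a * kBE a x := eBE
  have hP : sourceJointChain pS pU pV = ch pU' kV kA kBE := by
    funext w
    obtain ⟨u, v, a, b, e⟩ := w
    simp only [sourceJointChain, ch]
    rw [← eV', eBE']
    calc pU v u * pV a v * (pA a * kBE a (b, e)) = pU v u * (pA a * pV a v) * kBE a (b, e) := by ring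
      _ = _ := by rw [eA']; ring
  have hpcA : ∀ a, pc pU' (kc kV kA) a = pA a := by
    intro a
    unfold pc kc
    simp only [mul_sum, ← mul_assoc, ← eV']
    rw [sum_comm]
    calc ∑ v, ∑ u, pV' v * pU v u * kA v a = ∑ v, pV' v * kA v a := by
          refine sum_congr rfl fun v _ => ?_
          rw [← sum_mul, ← mul_sum, (hU v).2, mul_one]
      _ = ∑ v, pA a * pV a v := by simp only [eA']
      _ = pA a := by rw [← mul_sum, (hV a).2, mul_one]
  by_cases hpos : 0 < mutInf (chanJointQT Wch pQ pT pXk) (fun w => w.2.1) (fun w => w.2.2.2.1)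
  · exact main_case hpU1 hkV hA hQ hT hX hBE hW hpS (fun w => by rw [hpcA]; exact eBE' w.1 w.2) d dmax hd Ahat k D Δ hk
      _ hP _ rfl c1 c2 c3 c4 hpos
  · have hPp : IsPMF (sourceJointChain pS pU pV) := by rw [hP]; exact ch_pmf hpU1 hkV hA hBE
    refine special_case d Ahat k D Δ hk (sourceJointChain pS pU pV) hPp (source_marg hU hV) ?_ c3 ?_
    · exact c2.trans (mul_nonpos_of_nonneg_of_nonpos hk (not_lt.1 hpos))
    · obtain ⟨-, -, -, -, -, -, -, -, -, -, h5⟩ := ch_facts hpU1 hkV hA hBE (sourceJointChain pS pU pV) hP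
      refine (c4.trans ?_).trans h5
      have := le_max_left 0 (condMutInf (sourceJointChain pS pU pV)
              (fun w => w.2.1) (fun w => w.2.2.1) (fun w => (w.1, w.2.2.2.1))
           - k * (condMutInf (chanJointQT Wch pQ pT pXk)
                    (fun w => w.2.1) (fun w => w.2.2.2.1) (fun w => w.1)
                  - condMutInf (chanJointQT Wch pQ pT pXk)
                    (fun w => w.2.1) (fun w => w.2.2.2.2) (fun w => w.1)))
      linarith
end
end part16

/-- **Theorem 2 (Digital scheme, inner bound).** A tuple `(k, D, Δ) ∈ ℝ₊³` is achievable
whenever there exist finite auxiliary alphabets `𝒰, 𝒱, 𝒬, 𝒯`, random variables with joint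
distribution `p(u|v)·p(v|a)·p(a,b,e)·p(q)·p(t|q)·p(x|t)·p(y,z|x)`, and a function
`Â : 𝒱×ℬ → 𝒜` satisfying the single-letter inequalities of `ℛ_digital`. -/
theorem digital_inner_bound
    (pS : A × B × E → ℝ) (hpS : IsPMF pS)
    (Wch : X → Y × Z → ℝ) (hW : IsKernel Wch)
    (d : A → A → ℝ) (dmax : ℝ) (hdmax : 0 ≤ dmax)
    (hd : ∀ a a', 0 ≤ d a a' ∧ d a a' ≤ dmax)
    (k D Δ : ℝ) (hk : 0 ≤ k) (hD : 0 ≤ D) (hΔ : 0 ≤ Δ)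
    (hdig : ∃ (𝒰 𝒱 𝒬 𝒯 : Type) (i𝒰 : Fintype 𝒰) (i𝒱 : Fintype 𝒱)
      (i𝒬 : Fintype 𝒬) (i𝒯 : Fintype 𝒯),
      @DigitalCond A B E X Y Z _ _ _ _ _ _ 𝒰 𝒱 𝒬 𝒯 i𝒰 i𝒱 i𝒬 i𝒯 pS Wch d k D Δ) :
    Achievable pS Wch d k D Δ := by
  obtain ⟨U, V, Q, T, i1, i2, i3, i4, h⟩ := hdig
  exact final pS hpS Wch hW d dmax hd k D Δ hk U V Q T h

end SecureSC
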